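/- Let $X_n$ be the affine multiview variety associated to $n \geq 2$ cameras $A_1,\dots,A_n$ (real full-rank $3\times 4$ matrices) in general position, with respect to a general affine chart $\mathbb{C}^{2n}$ of $(\mathbb{P}^2)^n$. Then the Euclidean distance degree of $X_n$ equals $\frac{9}{2}n^3 - \frac{21}{2}n^2 + 8n - 4$. -/

import Mathlib

open scoped Manifold Topology
open Filter

noncomputable section

namespace PaperED

/-! Affine algebraic geometry over ℂ: algebraic subsets of ℂⁿ, genericity,
Zariski tangent spaces, smoothness, and the Euclidean distance degree. -/

/-- "P holds for a general point": P holds on a nonempty Zariski-open subset. -/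
def Generically {K : Type} [CommSemiring K] {σ : Type} (P : (σ → K) → Prop) : Prop :=
  ∃ q : MvPolynomial σ K, q ≠ 0 ∧ ∀ a : σ → K, MvPolynomial.eval a q ≠ 0 → P a

/-- Affine algebraic subsets of ℂⁿ (common zero loci of polynomials). -/
def IsAlgSet {n : ℕ} (X : Set (Fin n → ℂ)) : Prop :=
  ∃ S : Set (MvPolynomial (Fin n) ℂ),
    X = {x | ∀ p ∈ S, MvPolynomial.eval x p = 0}

/-- The differential of a polynomial at a point, as a linear functional. -/
def diffAt {n : ℕ} (p : MvPolynomial (Fin n) ℂ) (x : Fin n → ℂ) : (Fin n → ℂ) →ₗ[ℂ] ℂ :=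
  ∑ i, MvPolynomial.eval x (MvPolynomial.pderiv i p) • LinearMap.proj i

/-- The Zariski tangent space of `X ⊆ ℂⁿ` at `x`. -/
def zTangent {n : ℕ} (X : Set (Fin n → ℂ)) (x : Fin n → ℂ) : Submodule ℂ (Fin n → ℂ) :=
  ⨅ p ∈ {p : MvPolynomial (Fin n) ℂ | ∀ y ∈ X, MvPolynomial.eval y p = 0},
    LinearMap.ker (diffAt p x)

/-- `ψ` is a local holomorphic parametrization of `S` around `x`, with `d` parameters. -/
def IsParamAt {E : Type} [NormedAddCommGroup E] [NormedSpace ℂ E]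
    (S : Set E) (x : E) (d : ℕ) (ψ : (Fin d → ℂ) → E) (U : Set (Fin d → ℂ)) : Prop :=
  IsOpen U ∧ (0 : Fin d → ℂ) ∈ U ∧ ψ 0 = x ∧ DifferentiableOn ℂ ψ U ∧
    Set.InjOn ψ U ∧ Function.Injective (fderiv ℂ ψ 0) ∧
    ∃ V ∈ 𝓝 x, ψ '' U = S ∩ V

/-- `S` is, near `x`, a `d`-dimensional complex submanifold. -/
def IsSmoothGermAt {E : Type} [NormedAddCommGroup E] [NormedSpace ℂ E]
    (S : Set E) (x : E) (d : ℕ) : Prop :=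
  ∃ ψ U, IsParamAt S x d ψ U

/-- `X` is a (nonempty) smooth closed subvariety of ℂⁿ of pure dimension `d`. -/
def IsSmoothClosedOfDim {n : ℕ} (X : Set (Fin n → ℂ)) (d : ℕ) : Prop :=
  IsAlgSet X ∧ X.Nonempty ∧
    ∀ x ∈ X, IsSmoothGermAt X x d ∧ Module.finrank ℂ ↥(zTangent X x) = d

/-- Critical points of the squared distance function `f_α` on the locus of `X` where
the tangent space has dimension `d` (the smooth locus, when `dim X = d`):
the vector `x - α` is orthogonal to the tangent space w.r.t. `∑ zᵢwᵢ`. -/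
def edCritSet {n : ℕ} (X : Set (Fin n → ℂ)) (d : ℕ) (α : Fin n → ℂ) : Set (Fin n → ℂ) :=
  {x | x ∈ X ∧ Module.finrank ℂ ↥(zTangent X x) = d ∧
    ∀ v ∈ zTangent X x, (∑ i, (x i - α i) * v i) = 0}

/-- The Euclidean distance degree of `X` (of dimension `d`) equals `k`: for a general
data point `α`, the squared distance function `f_α` has exactly `k` critical points on
the smooth locus of `X`. -/
def HasEDDeg {n : ℕ} (X : Set (Fin n → ℂ)) (d : ℕ) (k : ℕ) : Prop :=
  Generically (K := ℂ) (σ := Fin n) fun α =>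
    (edCritSet X d α).Finite ∧ (edCritSet X d α).ncard = k

/-- `U_β`: the complement in ℂⁿ of the hypersurface `∑ (zᵢ - βᵢ)² + β₀ = 0`. -/
def quadCompl {n : ℕ} (β : Fin (n + 1) → ℂ) : Set (Fin n → ℂ) :=
  {z | (∑ i : Fin n, (z i - β i.succ) ^ 2) + β 0 ≠ 0}

/-! The multiview variety of `n` cameras in `(ℙ²)ⁿ` and its affine chart. -/

abbrev P2 := Projectivization ℂ (Fin 3 → ℂ)

instance : TopologicalSpace P2 :=
  @instTopologicalSpaceQuotient _ (projectivizationSetoid ℂ (Fin 3 → ℂ)) _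

/-- The point of ℙ² with homogeneous coordinate vector `v` (junk value if `v = 0`). -/
def mkP (v : Fin 3 → ℂ) : P2 :=
  if h : v ≠ 0 then Projectivization.mk ℂ v h
  else Projectivization.mk ℂ (fun _ => 1) (by
    intro h0; exact one_ne_zero (congrFun h0 0))

/-- The tuple of cameras (3×4 matrices) with complex parameters `a`. -/
def camOfC {n : ℕ} (a : Fin n × Fin 3 × Fin 4 → ℂ) : Fin n → Matrix (Fin 3) (Fin 4) ℂ :=
  fun i => Matrix.of fun r c => a (i, r, c)

/-- The tuple of cameras with real parameters `a`, viewed as complex matrices. -/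
def camOfR {n : ℕ} (a : Fin n × Fin 3 × Fin 4 → ℝ) : Fin n → Matrix (Fin 3) (Fin 4) ℂ :=
  fun i => Matrix.of fun r c => (a (i, r, c) : ℂ)

/-- The tuple of chart matrices (elements of GL₃ giving affine charts of ℙ²). -/
def chartOf {n : ℕ} (cpar : Fin n × Fin 3 × Fin 3 → ℂ) : Fin n → Matrix (Fin 3) (Fin 3) ℂ :=
  fun i => Matrix.of fun r c => cpar (i, r, c)

/-- The image of the joint camera map `ℙ³ ⇢ (ℙ²)ⁿ` (on its locus of definition). -/
def mvImage {n : ℕ} (A : Fin n → Matrix (Fin 3) (Fin 4) ℂ) : Set (Fin n → P2) :=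
  {P | ∃ y : Fin 4 → ℂ, y ≠ 0 ∧ (∀ i, (A i).mulVec y ≠ 0) ∧ ∀ i, P i = mkP ((A i).mulVec y)}

/-- The multiview variety `Yₙ ⊆ (ℙ²)ⁿ`: the closure of the image of the camera map. -/
def mvVariety {n : ℕ} (A : Fin n → Matrix (Fin 3) (Fin 4) ℂ) : Set (Fin n → P2) :=
  closure (mvImage A)

def affLift (z : Fin 2 → ℂ) : Fin 3 → ℂ := Fin.cons 1 z

/-- The coordinate pair of the `i`-th factor, for `z ∈ ℂ²ⁿ`. -/
def camCoord (n : ℕ) (z : Fin (2 * n) → ℂ) (i : Fin n) : Fin 2 → ℂ :=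
  fun k => z ⟨2 * i.1 + k.1, by have := i.2; have := k.2; omega⟩

/-- The affine chart `ℂ²ⁿ → (ℙ²)ⁿ` determined by the chart matrices `Cs`. -/
def chartMapN {n : ℕ} (Cs : Fin n → Matrix (Fin 3) (Fin 3) ℂ) (z : Fin (2 * n) → ℂ) :
    Fin n → P2 :=
  fun i => mkP ((Cs i).mulVec <| affLift (camCoord n z i))

/-- The affine multiview variety `Xₙ = Yₙ ∩ ℂ²ⁿ ⊆ ℂ²ⁿ`, in the chart `Cs`. -/
def affineMV {n : ℕ} (A : Fin n → Matrix (Fin 3) (Fin 4) ℂ)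
    (Cs : Fin n → Matrix (Fin 3) (Fin 3) ℂ) : Set (Fin (2 * n) → ℂ) :=
  chartMapN Cs ⁻¹' mvVariety A

/-- The line at infinity of the affine chart of ℙ² given by the matrix `Cm`. -/
def infLine (Cm : Matrix (Fin 3) (Fin 3) ℂ) : Set P2 :=
  {p | ∃ w : Fin 3 → ℂ, w ≠ 0 ∧ w 0 = 0 ∧ p = mkP (Cm.mulVec w)}

/-- `D_{∞,i} = Yₙ ∩ H_{∞,i}`. -/
def Dinf {n : ℕ} (A : Fin n → Matrix (Fin 3) (Fin 4) ℂ)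
    (Cs : Fin n → Matrix (Fin 3) (Fin 3) ℂ) (i : Fin n) : Set (Fin n → P2) :=
  mvVariety A ∩ {P | P i ∈ infLine (Cs i)}

/-- `D_∞ = Yₙ ∩ H_∞`, the divisor at infinity. -/
def DinfAll {n : ℕ} (A : Fin n → Matrix (Fin 3) (Fin 4) ℂ)
    (Cs : Fin n → Matrix (Fin 3) (Fin 3) ℂ) : Set (Fin n → P2) :=
  mvVariety A ∩ ⋃ i, {P | P i ∈ infLine (Cs i)}

/-- The affine quadric hypersurface `∑ (zᵢ - βᵢ)² + β₀ = 0` in `ℂ²ⁿ`. -/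
def quadSet (n : ℕ) (β : Fin (2 * n + 1) → ℂ) : Set (Fin (2 * n) → ℂ) :=
  {z | (∑ i : Fin (2 * n), (z i - β i.succ) ^ 2) + β 0 = 0}

/-- `H_Q`: the closure in `(ℙ²)ⁿ` of the affine quadric hypersurface. -/
def HQ {n : ℕ} (Cs : Fin n → Matrix (Fin 3) (Fin 3) ℂ) (β : Fin (2 * n + 1) → ℂ) :
    Set (Fin n → P2) :=
  closure (chartMapN Cs '' quadSet n β)

/-- `D_Q = Yₙ ∩ H_Q`. -/
def DQ {n : ℕ} (A : Fin n → Matrix (Fin 3) (Fin 4) ℂ)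
    (Cs : Fin n → Matrix (Fin 3) (Fin 3) ℂ) (β : Fin (2 * n + 1) → ℂ) :
    Set (Fin n → P2) :=
  mvVariety A ∩ HQ Cs β

/-- The partial derivative of `F` in the second variable is injective at `z`. -/
def PartialInj {T E G : Type*} [NormedAddCommGroup E] [NormedSpace ℂ E]
    [NormedAddCommGroup G] [NormedSpace ℂ G] (F : T × E → G) (z : T × E) : Prop :=
  ∀ δ : E, HasDerivAt (fun t : ℂ => F (z.1, z.2 + t • δ)) 0 0 → δ = 0

lemma partialInj_iff_fderiv {T E G : Type*} [NormedAddCommGroup E] [NormedSpace ℂ E]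
    [NormedAddCommGroup G] [NormedSpace ℂ G] [NormedAddCommGroup T] [NormedSpace ℂ T]
    {F : T × E → G} {z : T × E} (hd : DifferentiableAt ℂ F z) :
    PartialInj F z ↔ ∀ δ, fderiv ℂ F z (0, δ) = 0 → δ = 0 := by
  have key : ∀ δ : E, HasDerivAt (fun t : ℂ => F (z.1, z.2 + t • δ)) (fderiv ℂ F z (0, δ)) 0 := by
    intro δ
    have h1 : HasDerivAt (fun t : ℂ => (z.1, z.2 + t • δ)) ((0 : T), δ) 0 := by
      have h2 : HasDerivAt (fun t : ℂ => z.2 + t • δ) δ 0 := by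
        simpa using ((hasDerivAt_id (0:ℂ)).smul_const δ).const_add z.2
      exact (hasDerivAt_const (0:ℂ) z.1).prodMk h2
    have h3 : HasFDerivAt F (fderiv ℂ F z) (z.1, z.2 + (0:ℂ) • δ) := by
      simpa using hd.hasFDerivAt
    exact h3.comp_hasDerivAt (0:ℂ) h1
  constructor
  · intro h δ h0
    exact h δ (h0 ▸ key δ)
  · intro h δ h0
    exact h δ ((key δ).unique h0)

lemma exists_branch {T E : Type*} [NormedAddCommGroup E] [NormedSpace ℂ E]
    [FiniteDimensional ℂ E] [NormedAddCommGroup T] [NormedSpace ℂ T] [CompleteSpace T]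
    (F : T × E → E) (t0 : T) (x0 : E) (hF : ContDiffAt ℂ 1 F (t0, x0)) (h0 : F (t0, x0) = 0)
    (hinj : PartialInj F (t0, x0)) :
    ∃ φ : T → E, Tendsto φ (𝓝 t0) (𝓝 x0) ∧
      (∀ᶠ z in 𝓝 (t0, x0), F z = 0 ↔ φ z.1 = z.2) ∧
      (∀ᶠ t in 𝓝 t0, F (t, φ t) = 0) ∧
      ∀ᶠ z in 𝓝 (t0, x0), PartialInj F z := by
  have : CompleteSpace E := FiniteDimensional.complete ℂ E
  have hd : DifferentiableAt ℂ F (t0, x0) := hF.differentiableAt (by norm_num)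
  have hinj' := (partialInj_iff_fderiv hd).1 hinj
  have hs : HasStrictFDerivAt F (fderiv ℂ F (t0, x0)) (t0, x0) :=
    hF.hasStrictFDerivAt (by norm_num)
  have hiv : ∀ L : T × E →L[ℂ] E, (∀ δ, L (0, δ) = 0 → δ = 0) →
      ∃ e : E ≃L[ℂ] E, (e : E →L[ℂ] E) = L ∘L .inr ℂ T E := by
    intro L hL
    have hi : Function.Injective ((L ∘L .inr ℂ T E : E →L[ℂ] E) : E →ₗ[ℂ] E) := by
      rw [injective_iff_map_eq_zero]
      intro δ h
      exact hL δ (by simpa using h)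
    refine ⟨(LinearEquiv.ofInjectiveEndo _ hi).toContinuousLinearEquiv, ?_⟩
    ext; simp
  obtain ⟨e, he⟩ := hiv _ hinj'
  have hinv : (fderiv ℂ F (t0, x0) ∘L .inr ℂ T E).IsInvertible := ⟨e, he⟩
  refine ⟨hs.implicitFunctionOfProdDomain hinv, hs.tendsto_implicitFunctionOfProdDomain hinv,
    ?_, ?_, ?_⟩
  · simpa [h0] using hs.eventually_apply_eq_iff_implicitFunctionOfProdDomain hinv
  · simpa [h0] using hs.eventually_apply_implicitFunctionOfProdDomain hinv
  · have hc : ContinuousAt (fun z => fderiv ℂ F z ∘L .inr ℂ T E) (t0, x0) := by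
      have : ContinuousAt (fderiv ℂ F) (t0, x0) :=
        (hF.fderiv_right (m := 0) (by norm_num)).continuousAt
      exact this.clm_comp continuousAt_const
    have hn := hc.eventually (he ▸ ContinuousLinearEquiv.nhds e)
    have hdiff : ∀ᶠ z in 𝓝 (t0, x0), DifferentiableAt ℂ F z :=
      (hF.eventually (by simp)).mono fun z hz => hz.differentiableAt (by norm_num)
    filter_upwards [hn, hdiff] with z hz hzd
    rw [partialInj_iff_fderiv hzd]
    obtain ⟨e', he'⟩ := hz
    intro δ hδ
    have : e' δ = 0 := by
      have := congrArg (fun L : E →L[ℂ] E => L δ) he'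
      simpa [hδ] using this
    simpa using this

lemma eventually_eq_range {T E J : Type*} [Finite J] (l : Filter T) (S : T → Set E)
    (φ : J → T → E) (h1 : ∀ j, ∀ᶠ t in l, φ j t ∈ S t)
    (h2 : ∀ i j, i ≠ j → ∀ᶠ t in l, φ i t ≠ φ j t)
    (h3 : ∀ U : Ultrafilter T, ↑U ≤ l → ∀ y : T → E, (∀ᶠ t in U, y t ∈ S t) →
      ∃ j, ∀ᶠ t in U, y t = φ j t) :
    ∀ᶠ t in l, (S t).Finite ∧ (S t).ncard = Nat.card J ∧ S t = Set.range fun j => φ j t := by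
  have hA : ∀ᶠ t in l, S t ⊆ Set.range fun j => φ j t := by
    by_contra hcon
    rw [not_eventually] at hcon
    let B : Set T := {t | ¬ S t ⊆ Set.range fun j => φ j t}
    have hB : (l ⊓ 𝓟 B).NeBot := frequently_mem_iff_neBot.1 hcon
    have hy : ∀ t, ∃ y, t ∈ B → y ∈ S t ∧ ∀ j, y ≠ φ j t := by
      intro t
      by_cases ht : t ∈ B
      · obtain ⟨y, hy1, hy2⟩ := Set.not_subset.1 ht
        exact ⟨y, fun _ => ⟨hy1, fun j hj => hy2 ⟨j, hj.symm⟩⟩⟩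
      · by_cases hJ : Nonempty E
        · exact ⟨hJ.some, fun h => absurd h ht⟩
        · have : Nonempty B := by
            obtain ⟨t', ht'⟩ := (hcon.exists : ∃ t, t ∈ B)
            exact ⟨⟨t', ht'⟩⟩
          obtain ⟨t', ht'⟩ := this
          obtain ⟨y, -, -⟩ := Set.not_subset.1 ht'
          exact absurd ⟨y⟩ hJ
    choose y hy using hy
    let U := Ultrafilter.of (l ⊓ 𝓟 B)
    have hU : ↑U ≤ l ⊓ 𝓟 B := Ultrafilter.of_le _
    have hUB : ∀ᶠ t in U, t ∈ B := hU (mem_inf_of_right (mem_principal_self B))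
    obtain ⟨j, hj⟩ := h3 U (hU.trans inf_le_left) y (hUB.mono fun t ht => (hy t ht).1)
    obtain ⟨t, ht1, ht2⟩ := (hj.and hUB).exists
    exact (hy t ht2).2 j ht1
  have hB : ∀ᶠ t in l, ∀ j, φ j t ∈ S t := eventually_all.2 h1
  have hC : ∀ᶠ t in l, ∀ i j, i ≠ j → φ i t ≠ φ j t := by
    refine eventually_all.2 fun i => eventually_all.2 fun j => ?_
    by_cases hij : i = j
    · exact Eventually.of_forall fun _ h => absurd hij h
    · exact (h2 i j hij).mono fun _ h _ => h
  filter_upwards [hA, hB, hC] with t hA hB hC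
  have he : S t = Set.range fun j => φ j t :=
    Set.Subset.antisymm hA (by rintro _ ⟨j, rfl⟩; exact hB j)
  refine ⟨he ▸ Set.finite_range _, ?_, he⟩
  rw [he, ← Set.image_univ, Set.ncard_image_of_injective, Set.ncard_univ]
  intro i j hij
  by_contra hne
  exact hC i j hne hij

section

/-- Vectors of homogeneous coordinates on `ℙ³`. -/
abbrev V4 := Fin 4 → ℂ

/-- A family of triples `(l, u, v)` of linear forms, giving the function `∑ u v / l ^ 2`. -/
abbrev Fam (ι : Type) := ι → Fin 3 → V4

/-- The coefficients of the forms in the gradient of `u v / l ^ 2`. -/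
def coef (q : Fin 3 → V4) (y : V4) : Fin 3 → ℂ :=
  ![-2 * (q 1 ⬝ᵥ y) * (q 2 ⬝ᵥ y) / (q 0 ⬝ᵥ y) ^ 3, (q 2 ⬝ᵥ y) / (q 0 ⬝ᵥ y) ^ 2,
    (q 1 ⬝ᵥ y) / (q 0 ⬝ᵥ y) ^ 2]

/-- The derivative of `coef`. -/
def dcoef (q : Fin 3 → V4) (y δ : V4) : Fin 3 → ℂ :=
  ![-2 * ((q 1 ⬝ᵥ δ) * (q 2 ⬝ᵥ y) + (q 1 ⬝ᵥ y) * (q 2 ⬝ᵥ δ)) / (q 0 ⬝ᵥ y) ^ 3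
      + 6 * (q 1 ⬝ᵥ y) * (q 2 ⬝ᵥ y) * (q 0 ⬝ᵥ δ) / (q 0 ⬝ᵥ y) ^ 4,
    (q 2 ⬝ᵥ δ) / (q 0 ⬝ᵥ y) ^ 2 - 2 * (q 2 ⬝ᵥ y) * (q 0 ⬝ᵥ δ) / (q 0 ⬝ᵥ y) ^ 3,
    (q 1 ⬝ᵥ δ) / (q 0 ⬝ᵥ y) ^ 2 - 2 * (q 1 ⬝ᵥ y) * (q 0 ⬝ᵥ δ) / (q 0 ⬝ᵥ y) ^ 3]

def gradOne (q : Fin 3 → V4) (y : V4) : V4 := ∑ r, coef q y r • q r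

def hessOne (q : Fin 3 → V4) (y δ : V4) : V4 := ∑ r, dcoef q y δ r • q r

variable {ι : Type} [Fintype ι]

def grad (p : Fam ι) (y : V4) : V4 := ∑ i, gradOne (p i) y

def hess (p : Fam ι) (y δ : V4) : V4 := ∑ i, hessOne (p i) y δ

/-- Critical points supported on the coordinates in `F`, normalised by `l i0 = 1`. -/
def critSet (i0 : ι) (F : Finset (Fin 4)) (p : Fam ι) : Set V4 :=
  {y | (∀ k ∉ F, y k = 0) ∧ (∀ i, p i 0 ⬝ᵥ y ≠ 0) ∧ (∀ k ∈ F, grad p y k = 0) ∧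
    p i0 0 ⬝ᵥ y = 1}

/-- Nondegeneracy of a critical point. -/
def Nondeg (i0 : ι) (F : Finset (Fin 4)) (p : Fam ι) (y : V4) : Prop :=
  ∀ δ : V4, (∀ k ∉ F, δ k = 0) → (∀ k ∈ F, hess p y δ k = 0) → p i0 0 ⬝ᵥ δ = 0 → δ = 0

/-- The square system whose zeros are the critical points. -/
def critMap (i0 : ι) (F : Finset (Fin 4)) (z : Fam ι × V4) : V4 := fun k =>
  if k ∈ F then grad z.1 z.2 k + (z.1 i0 0 ⬝ᵥ z.2 - 1) * z.1 i0 0 k else z.2 k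

lemma gradOne_dot (q : Fin 3 → V4) (y : V4) (h : q 0 ⬝ᵥ y ≠ 0) : gradOne q y ⬝ᵥ y = 0 := by
  simp only [gradOne, Fin.sum_univ_three, add_dotProduct, smul_dotProduct, coef]
  simp
  field_simp
  ring

lemma hessOne_dot (q : Fin 3 → V4) (y δ : V4) (h : q 0 ⬝ᵥ y ≠ 0) :
    hessOne q y δ ⬝ᵥ y = - (gradOne q y ⬝ᵥ δ) := by
  simp only [gradOne, hessOne, Fin.sum_univ_three, add_dotProduct, smul_dotProduct, coef, dcoef]
  simp
  field_simp
  ring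

lemma sum_dot {α : Type*} (s : Finset α) (f : α → V4) (y : V4) :
    (∑ i ∈ s, f i) ⬝ᵥ y = ∑ i ∈ s, f i ⬝ᵥ y := by
  simp only [dotProduct, Finset.sum_apply, Finset.sum_mul]
  exact Finset.sum_comm

lemma grad_dot (p : Fam ι) (y : V4) (h : ∀ i, p i 0 ⬝ᵥ y ≠ 0) : grad p y ⬝ᵥ y = 0 := by
  rw [grad, sum_dot]
  exact Finset.sum_eq_zero fun i _ => gradOne_dot _ _ (h i)

lemma hess_dot (p : Fam ι) (y δ : V4) (h : ∀ i, p i 0 ⬝ᵥ y ≠ 0) :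
    hess p y δ ⬝ᵥ y = - (grad p y ⬝ᵥ δ) := by
  rw [hess, sum_dot, grad, sum_dot, ← Finset.sum_neg_distrib]
  exact Finset.sum_congr rfl fun i _ => hessOne_dot _ _ _ (h i)

lemma dot_congr_supp {F : Finset (Fin 4)} {a b y : V4} (hy : ∀ k ∉ F, y k = 0)
    (h : ∀ k ∈ F, a k = b k) : a ⬝ᵥ y = b ⬝ᵥ y := by
  refine Finset.sum_congr rfl fun k _ => ?_
  by_cases hk : k ∈ F
  · rw [h k hk]
  · rw [hy k hk]; simp

lemma dot_eq_zero_of_supp {F : Finset (Fin 4)} {a y : V4} (hy : ∀ k ∉ F, y k = 0)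
    (h : ∀ k ∈ F, a k = 0) : a ⬝ᵥ y = 0 := by
  rw [dot_congr_supp hy (b := 0) (by simpa using h), zero_dotProduct]

lemma critMap_eq_zero (i0 : ι) (F : Finset (Fin 4)) (p : Fam ι) (y : V4)
    (h : ∀ i, p i 0 ⬝ᵥ y ≠ 0) : critMap i0 F (p, y) = 0 ↔ y ∈ critSet i0 F p := by
  constructor
  · intro h0
    have hs : ∀ k ∉ F, y k = 0 := fun k hk => by
      have := congrFun h0 k
      simpa [critMap, hk] using this
    have hk : ∀ k ∈ F, (grad p y + (p i0 0 ⬝ᵥ y - 1) • p i0 0) k = 0 := fun k hk => by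
      have := congrFun h0 k
      simpa [critMap, hk] using this
    have h1 := dot_eq_zero_of_supp hs hk
    rw [add_dotProduct, grad_dot p y h, smul_dotProduct, zero_add, smul_eq_mul] at h1
    have h2 : p i0 0 ⬝ᵥ y = 1 := by
      rcases mul_eq_zero.1 h1 with h1 | h1
      · linear_combination h1
      · exact absurd h1 (h i0)
    refine ⟨hs, h, fun k hkF => ?_, h2⟩
    simpa [h2] using hk k hkF
  · rintro ⟨hs, -, hg, h1⟩
    funext k
    by_cases hk : k ∈ F
    · simp [critMap, hk, hg k hk, h1]
    · simp [critMap, hk, hs k hk]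

lemma hasDerivAt_dot (a y δ : V4) :
    HasDerivAt (fun t : ℂ => a ⬝ᵥ (y + t • δ)) (a ⬝ᵥ δ) 0 := by
  have : (fun t : ℂ => a ⬝ᵥ (y + t • δ)) = fun t => a ⬝ᵥ y + t * (a ⬝ᵥ δ) := by
    funext t; simp [dotProduct_add, dotProduct_smul]
  rw [this]
  simpa using ((hasDerivAt_id (0:ℂ)).mul_const (a ⬝ᵥ δ)).const_add (a ⬝ᵥ y)

lemma hasDerivAt_coef (q : Fin 3 → V4) (y δ : V4) (h : q 0 ⬝ᵥ y ≠ 0) :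
    HasDerivAt (fun t : ℂ => coef q (y + t • δ)) (dcoef q y δ) 0 := by
  rw [hasDerivAt_pi]
  have h0 := hasDerivAt_dot (q 0) y δ
  have h1 := hasDerivAt_dot (q 1) y δ
  have h2 := hasDerivAt_dot (q 2) y δ
  have hz : q 0 ⬝ᵥ (y + (0:ℂ) • δ) ≠ 0 := by simpa using h
  intro r
  fin_cases r
  · have := (((h1.const_mul (-2)).mul h2).div (h0.pow 3) (pow_ne_zero 3 hz))
    refine this.congr_deriv ?_
    simp [dcoef]
    field_simp
    ring
  · have := h2.div (h0.pow 2) (pow_ne_zero 2 hz)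
    refine this.congr_deriv ?_
    simp [dcoef]
    field_simp
  · have := h1.div (h0.pow 2) (pow_ne_zero 2 hz)
    refine this.congr_deriv ?_
    simp [dcoef]
    field_simp

lemma hasDerivAt_gradOne (q : Fin 3 → V4) (y δ : V4) (h : q 0 ⬝ᵥ y ≠ 0) :
    HasDerivAt (fun t : ℂ => gradOne q (y + t • δ)) (hessOne q y δ) 0 := by
  have := hasDerivAt_pi.1 (hasDerivAt_coef q y δ h)
  exact HasDerivAt.fun_sum fun r _ => (this r).smul_const (q r)

lemma hasDerivAt_grad (p : Fam ι) (y δ : V4) (h : ∀ i, p i 0 ⬝ᵥ y ≠ 0) :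
    HasDerivAt (fun t : ℂ => grad p (y + t • δ)) (hess p y δ) 0 :=
  HasDerivAt.fun_sum fun i _ => hasDerivAt_gradOne (p i) y δ (h i)

lemma hasDerivAt_critMap (i0 : ι) (F : Finset (Fin 4)) (p : Fam ι) (y δ : V4)
    (h : ∀ i, p i 0 ⬝ᵥ y ≠ 0) :
    HasDerivAt (fun t : ℂ => critMap i0 F (p, y + t • δ))
      (fun k => if k ∈ F then hess p y δ k + (p i0 0 ⬝ᵥ δ) * p i0 0 k else δ k) 0 := by
  rw [hasDerivAt_pi]
  intro k
  by_cases hk : k ∈ F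
  · simp only [critMap, hk, if_true]
    exact (hasDerivAt_pi.1 (hasDerivAt_grad p y δ h) k).add
      (((hasDerivAt_dot (p i0 0) y δ).sub_const 1).mul_const _)
  · simp only [critMap, hk, if_false]
    simpa using ((hasDerivAt_id (0:ℂ)).mul_const (δ k)).const_add (y k)

lemma dcrit_eq_zero {i0 : ι} {F : Finset (Fin 4)} {p : Fam ι} {y δ : V4}
    (hy : y ∈ critSet i0 F p) :
    (fun k => if k ∈ F then hess p y δ k + (p i0 0 ⬝ᵥ δ) * p i0 0 k else δ k) = (0 : V4) ↔
      (∀ k ∉ F, δ k = 0) ∧ (∀ k ∈ F, hess p y δ k = 0) ∧ p i0 0 ⬝ᵥ δ = 0 := by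
  obtain ⟨hs, hl, hg, h1⟩ := hy
  constructor
  · intro h0
    have hδ : ∀ k ∉ F, δ k = 0 := fun k hk => by simpa [hk] using congrFun h0 k
    have hF : ∀ k ∈ F, (hess p y δ + (p i0 0 ⬝ᵥ δ) • p i0 0) k = 0 := fun k hk => by
      simpa [hk] using congrFun h0 k
    have h2 := dot_eq_zero_of_supp hs hF
    rw [add_dotProduct, hess_dot p y δ hl, dot_eq_zero_of_supp hδ hg, smul_dotProduct, h1] at h2
    have h3 : p i0 0 ⬝ᵥ δ = 0 := by simpa using h2
    exact ⟨hδ, fun k hk => by simpa [h3] using hF k hk, h3⟩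
  · rintro ⟨h1, h2, h3⟩
    funext k
    by_cases hk : k ∈ F
    · simp [hk, h2 k hk, h3]
    · simp [hk, h1 k hk]

lemma partialInj_critMap {i0 : ι} {F : Finset (Fin 4)} {p : Fam ι} {y : V4}
    (hy : y ∈ critSet i0 F p) : PartialInj (critMap i0 F) (p, y) ↔ Nondeg i0 F p y := by
  constructor
  · intro h δ h1 h2 h3
    refine h δ ?_
    have := hasDerivAt_critMap i0 F p y δ hy.2.1
    rwa [(dcrit_eq_zero hy).2 ⟨h1, h2, h3⟩] at this
  · intro h δ h0
    have := h0.unique (hasDerivAt_critMap i0 F p y δ hy.2.1)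
    obtain ⟨h1, h2, h3⟩ := (dcrit_eq_zero hy).1 this.symm
    exact h δ h1 h2 h3

lemma contDiffAt_coef {E : Type*} [NormedAddCommGroup E] [NormedSpace ℂ E] {q : E → Fin 3 → V4}
    {y : E → V4} {x : E} (hq : ContDiffAt ℂ 1 q x) (hy : ContDiffAt ℂ 1 y x)
    (h : q x 0 ⬝ᵥ y x ≠ 0) : ContDiffAt ℂ 1 (fun x => coef (q x) (y x)) x := by
  have hd : ∀ r, ContDiffAt ℂ 1 (fun x => q x r ⬝ᵥ y x) x := by
    intro r
    simp only [dotProduct]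
    fun_prop
  rw [contDiffAt_pi]
  intro r
  fin_cases r
  · exact (((contDiffAt_const (c := (-2:ℂ))).mul (hd 1)).mul (hd 2)).div ((hd 0).pow 3)
      (pow_ne_zero 3 h)
  · exact (hd 2).div ((hd 0).pow 2) (pow_ne_zero 2 h)
  · exact (hd 1).div ((hd 0).pow 2) (pow_ne_zero 2 h)

lemma contDiffAt_gradOne {E : Type*} [NormedAddCommGroup E] [NormedSpace ℂ E]
    {q : E → Fin 3 → V4} {y : E → V4} {x : E} (hq : ContDiffAt ℂ 1 q x)
    (hy : ContDiffAt ℂ 1 y x) (h : q x 0 ⬝ᵥ y x ≠ 0) :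
    ContDiffAt ℂ 1 (fun x => gradOne (q x) (y x)) x := by
  have := contDiffAt_coef hq hy h
  refine ContDiffAt.sum fun r _ => ?_
  exact (contDiffAt_pi.1 this r).smul (contDiffAt_pi.1 hq r)

lemma contDiffAt_grad {E : Type*} [NormedAddCommGroup E] [NormedSpace ℂ E]
    {p : E → Fam ι} {y : E → V4} {x : E} (hq : ContDiffAt ℂ 1 p x)
    (hy : ContDiffAt ℂ 1 y x) (h : ∀ i, p x i 0 ⬝ᵥ y x ≠ 0) :
    ContDiffAt ℂ 1 (fun x => grad (p x) (y x)) x :=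
  ContDiffAt.sum fun i _ => contDiffAt_gradOne (contDiffAt_pi.1 hq i) hy (h i)

lemma contDiffAt_critMap {E : Type*} [NormedAddCommGroup E] [NormedSpace ℂ E]
    {p : E → Fam ι} {y : E → V4} {x : E} (i0 : ι) (F : Finset (Fin 4)) (hq : ContDiffAt ℂ 1 p x)
    (hy : ContDiffAt ℂ 1 y x) (h : ∀ i, p x i 0 ⬝ᵥ y x ≠ 0) :
    ContDiffAt ℂ 1 (fun x => critMap i0 F (p x, y x)) x := by
  rw [contDiffAt_pi]
  intro k
  have hg := contDiffAt_pi.1 (contDiffAt_grad hq hy h) k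
  have hq0 : ContDiffAt ℂ 1 (fun x => p x i0 0) x :=
    contDiffAt_pi.1 (contDiffAt_pi.1 hq i0) 0
  by_cases hk : k ∈ F
  · simp only [critMap, hk, if_true]
    refine hg.add (ContDiffAt.mul ?_ (contDiffAt_pi.1 hq0 k))
    simp only [dotProduct]
    fun_prop
  · simp only [critMap, hk, if_false]
    exact contDiffAt_pi.1 hy k

end

section

variable {ι : Type} [Fintype ι]

/-- Forms of the family that vanish at a point together with the first form of their triple are
linearly independent. -/
def Gen1 (F : Finset (Fin 4)) (p : Fam ι) : Prop :=
  ∀ y : V4, (∀ k ∉ F, y k = 0) → y ≠ 0 → ∀ c : ι → Fin 3 → ℂ,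
    (∀ i r, c i r ≠ 0 → p i 0 ⬝ᵥ y = 0 ∧ p i r ⬝ᵥ y = 0) →
    (∀ k ∈ F, (∑ i, ∑ r, c i r • p i r) k = 0) → c = 0

/-- The centre of a camera satisfies a nonvanishing condition for the other cameras. -/
def Gen2 (F : Finset (Fin 4)) (p : Fam ι) (w : ι → ℂ) : Prop :=
  ∀ y : V4, (∀ k ∉ F, y k = 0) → y ≠ 0 → ∀ i, w i ≠ 0 → (∀ r, p i r ⬝ᵥ y = 0) →
    ∃ z : V4, (∀ k ∉ F, z k = 0) ∧ p i 1 ⬝ᵥ z = 0 ∧ p i 2 ⬝ᵥ z = 0 ∧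
      ∀ s : ι → ℂ, s i = 0 → (∀ j, j ≠ i → s j = w j * (gradOne (p j) y ⬝ᵥ z)) → ∑ j, s j ≠ 0

def Gen3 (F : Finset (Fin 4)) (p : Fam ι) : Prop :=
  ∀ y : V4, (∀ k ∉ F, y k = 0) → y ≠ 0 → ∀ i j, j ≠ i → (∀ r, p i r ⬝ᵥ y = 0) → p j 0 ⬝ᵥ y ≠ 0

lemma exists_tendsto_of_bounded {T E : Type*} [NormedAddCommGroup E] [ProperSpace E]
    (U : Ultrafilter T) (f : T → E) (K : ℝ) (h : ∀ᶠ t in U, ‖f t‖ ≤ K) :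
    ∃ x, Tendsto f U (𝓝 x) := by
  obtain ⟨x, -, hx⟩ := (isCompact_closedBall (0:E) K).ultrafilter_le_nhds (U.map f) (by
    rw [le_principal_iff]
    exact h.mono fun t ht => by simpa using ht)
  exact ⟨x, hx⟩

lemma bounded_or_tendsto {T E : Type*} [NormedAddCommGroup E] (U : Ultrafilter T) (f : T → E) :
    (∃ K : ℝ, ∀ᶠ t in U, ‖f t‖ ≤ K) ∨ Tendsto (fun t => ‖f t‖) U atTop := by
  by_cases h : ∃ K : ℝ, ∀ᶠ t in U, ‖f t‖ ≤ K
  · exact Or.inl h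
  · right
    push Not at h
    exact tendsto_atTop.2 fun b => (h b).mono fun t ht => ht.le

lemma tendsto_dot {T : Type*} {l : Filter T} {a b : T → V4} {a0 b0 : V4}
    (ha : Tendsto a l (𝓝 a0)) (hb : Tendsto b l (𝓝 b0)) :
    Tendsto (fun t => a t ⬝ᵥ b t) l (𝓝 (a0 ⬝ᵥ b0)) := by
  simp only [dotProduct]
  exact tendsto_finsetSum _ fun k _ => ((tendsto_pi_nhds.1 ha k).mul (tendsto_pi_nhds.1 hb k))

lemma tendsto_coef {T : Type*} {l : Filter T} {q : T → Fin 3 → V4} {y : T → V4} {q0 : Fin 3 → V4}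
    {y0 : V4} (hq : Tendsto q l (𝓝 q0)) (hy : Tendsto y l (𝓝 y0)) (h : q0 0 ⬝ᵥ y0 ≠ 0) :
    Tendsto (fun t => coef (q t) (y t)) l (𝓝 (coef q0 y0)) := by
  have hd := fun r => tendsto_dot (tendsto_pi_nhds.1 hq r) hy
  rw [tendsto_pi_nhds]
  intro r
  fin_cases r
  · exact (((hd 1).const_mul (-2)).mul (hd 2)).div ((hd 0).pow 3) (pow_ne_zero 3 h)
  · exact (hd 2).div ((hd 0).pow 2) (pow_ne_zero 2 h)
  · exact (hd 1).div ((hd 0).pow 2) (pow_ne_zero 2 h)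

lemma tendsto_gradOne {T : Type*} {l : Filter T} {q : T → Fin 3 → V4} {y : T → V4}
    {q0 : Fin 3 → V4} {y0 : V4} (hq : Tendsto q l (𝓝 q0)) (hy : Tendsto y l (𝓝 y0))
    (h : q0 0 ⬝ᵥ y0 ≠ 0) : Tendsto (fun t => gradOne (q t) (y t)) l (𝓝 (gradOne q0 y0)) :=
  tendsto_finsetSum _ fun r _ =>
    (tendsto_pi_nhds.1 (tendsto_coef hq hy h) r).smul (tendsto_pi_nhds.1 hq r)

lemma tendsto_grad {T : Type*} {l : Filter T} {q : T → Fam ι} {y : T → V4} {q0 : Fam ι} {y0 : V4}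
    (hq : Tendsto q l (𝓝 q0)) (hy : Tendsto y l (𝓝 y0))
    (h : ∀ i, q0 i 0 ⬝ᵥ y0 ≠ 0) : Tendsto (fun t => grad (q t) (y t)) l (𝓝 (grad q0 y0)) :=
  tendsto_finsetSum _ fun i _ => tendsto_gradOne (tendsto_pi_nhds.1 hq i) hy (h i)

lemma coef_identities (q : Fin 3 → V4) (y : V4) (w : ℂ) (h : q 0 ⬝ᵥ y ≠ 0) :
    (q 0 ⬝ᵥ y) ^ 2 * (w * coef q y 1) = w * (q 2 ⬝ᵥ y) ∧
    (q 0 ⬝ᵥ y) ^ 2 * (w * coef q y 2) = w * (q 1 ⬝ᵥ y) ∧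
    (q 0 ⬝ᵥ y) * (w * coef q y 0) = -2 * (q 1 ⬝ᵥ y) * (w * coef q y 1) ∧
    (q 0 ⬝ᵥ y) * (w * coef q y 0) = -2 * (q 2 ⬝ᵥ y) * (w * coef q y 2) ∧
    w * (w * coef q y 0) = -2 * (w * coef q y 1) * (w * coef q y 2) * (q 0 ⬝ᵥ y) := by
  simp only [coef]
  refine ⟨?_, ?_, ?_, ?_, ?_⟩ <;> simp <;> field_simp

/-- A limit of critical points of weighted families does not lie on the polar planes of cameras
with nonzero limit weight. -/
lemma limit_ne_zero {T : Type*} (U : Ultrafilter T) {F : Finset (Fin 4)} {p : T → Fam ι}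
    {p0 : Fam ι} {w : T → ι → ℂ} {w0 : ι → ℂ} {y : T → V4} {y0 : V4}
    (hp : Tendsto p U (𝓝 p0)) (hw : Tendsto w U (𝓝 w0)) (hy : Tendsto y U (𝓝 y0)) (hy0 : y0 ≠ 0)
    (hs : ∀ᶠ t in U, ∀ k ∉ F, y t k = 0) (hl : ∀ᶠ t in U, ∀ i, p t i 0 ⬝ᵥ y t ≠ 0)
    (hc : ∀ᶠ t in U, ∀ k ∈ F, (∑ i, w t i • gradOne (p t i) (y t)) k = 0)
    (h1 : Gen1 F p0) (h3 : Gen3 F p0) (h2 : Gen2 F p0 w0) (i : ι) (hi : w0 i ≠ 0) :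
    p0 i 0 ⬝ᵥ y0 ≠ 0 := by
  have hs0 : ∀ k ∉ F, y0 k = 0 := fun k hk =>
    tendsto_nhds_unique ((tendsto_pi_nhds.1 hy k).congr' (hs.mono fun t ht => ht k hk))
      tendsto_const_nhds
  let c : T → ι → Fin 3 → ℂ := fun t i r => w t i * coef (p t i) (y t) r
  have hd : ∀ j r, Tendsto (fun t => p t j r ⬝ᵥ y t) U (𝓝 (p0 j r ⬝ᵥ y0)) := fun j r =>
    tendsto_dot (tendsto_pi_nhds.1 (tendsto_pi_nhds.1 hp j) r) hy
  have hwj : ∀ j, Tendsto (fun t => w t j) U (𝓝 (w0 j)) := tendsto_pi_nhds.1 hw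
  have hrel : ∀ᶠ t in U, ∀ k ∈ F, (∑ i, ∑ r, c t i r • p t i r) k = 0 := by
    filter_upwards [hc] with t ht k hk
    rw [← ht k hk]
    simp only [gradOne, Finset.smul_sum, smul_smul, c]
  have hlim : ∀ (b : T → ι → Fin 3 → ℂ) (b0 : ι → Fin 3 → ℂ), Tendsto b U (𝓝 b0) →
      (∀ᶠ t in U, ∀ k ∈ F, (∑ i, ∑ r, b t i r • p t i r) k = 0) →
      ∀ k ∈ F, (∑ i, ∑ r, b0 i r • p0 i r) k = 0 := by
    intro b b0 hb hz k hk
    have : Tendsto (fun t => ∑ i, ∑ r, b t i r • p t i r) U (𝓝 (∑ i, ∑ r, b0 i r • p0 i r)) :=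
      tendsto_finsetSum _ fun i _ => tendsto_finsetSum _ fun r _ =>
        (tendsto_pi_nhds.1 (tendsto_pi_nhds.1 hb i) r).smul
          (tendsto_pi_nhds.1 (tendsto_pi_nhds.1 hp i) r)
    exact tendsto_nhds_unique ((tendsto_pi_nhds.1 this k).congr' (hz.mono fun t ht => ht k hk))
      tendsto_const_nhds
  rcases bounded_or_tendsto U c with ⟨K, hK⟩ | hK
  · obtain ⟨c0, hc0⟩ := exists_tendsto_of_bounded U c K hK
    have hcj : ∀ j r, Tendsto (fun t => c t j r) U (𝓝 (c0 j r)) := fun j r =>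
      tendsto_pi_nhds.1 (tendsto_pi_nhds.1 hc0 j) r
    intro hli
    have e1 : (p0 i 0 ⬝ᵥ y0) ^ 2 * c0 i 1 = w0 i * (p0 i 2 ⬝ᵥ y0) :=
      tendsto_nhds_unique ((((hd i 0).pow 2).mul (hcj i 1)).congr' (hl.mono fun t ht =>
        (coef_identities _ _ (w t i) (ht i)).1)) ((hwj i).mul (hd i 2))
    have e2 : (p0 i 0 ⬝ᵥ y0) ^ 2 * c0 i 2 = w0 i * (p0 i 1 ⬝ᵥ y0) :=
      tendsto_nhds_unique ((((hd i 0).pow 2).mul (hcj i 2)).congr' (hl.mono fun t ht =>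
        (coef_identities _ _ (w t i) (ht i)).2.1)) ((hwj i).mul (hd i 1))
    have e5 : w0 i * c0 i 0 = -2 * c0 i 1 * c0 i 2 * (p0 i 0 ⬝ᵥ y0) :=
      tendsto_nhds_unique (((hwj i).mul (hcj i 0)).congr' (hl.mono fun t ht =>
        (coef_identities _ _ (w t i) (ht i)).2.2.2.2))
        ((((hcj i 1).const_mul (-2)).mul (hcj i 2)).mul (hd i 0))
    have z2 : p0 i 2 ⬝ᵥ y0 = 0 := by simpa [hli, hi] using e1.symm
    have z1 : p0 i 1 ⬝ᵥ y0 = 0 := by simpa [hli, hi] using e2.symm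
    have z0 : c0 i 0 = 0 := by simpa [hli, hi] using e5
    have hcen : ∀ r, p0 i r ⬝ᵥ y0 = 0 := by
      intro r; fin_cases r <;> assumption
    obtain ⟨z, hzs, hz1, hz2, hz⟩ := h2 y0 hs0 hy0 i hi hcen
    refine hz (fun j => (∑ r, c0 j r • p0 j r) ⬝ᵥ z) ?_ ?_ ?_
    · simp [Fin.sum_univ_three, add_dotProduct, smul_dotProduct, hz1, hz2, z0]
    · intro j hj
      have hlj := h3 y0 hs0 hy0 i j hj hcen
      have hcf : ∀ r, c0 j r = w0 j * coef (p0 j) y0 r := fun r =>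
        tendsto_nhds_unique (hcj j r) ((hwj j).mul
          (tendsto_pi_nhds.1 (tendsto_coef (tendsto_pi_nhds.1 hp j) hy hlj) r))
      simp only [hcf, gradOne, ← smul_smul, ← Finset.smul_sum, smul_dotProduct, smul_eq_mul]
    · rw [← sum_dot]
      exact dot_eq_zero_of_supp hzs (hlim c c0 hc0 hrel)
  · exfalso
    let b : T → ι → Fin 3 → ℂ := fun t => ((‖c t‖⁻¹ : ℝ) : ℂ) • c t
    have hpos : ∀ᶠ t in U, 0 < ‖c t‖ := hK.eventually_gt_atTop 0
    have hbn : ∀ᶠ t in U, ‖b t‖ = 1 := by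
      filter_upwards [hpos] with t ht
      simp only [b, norm_smul, Complex.norm_real, norm_inv, norm_norm]
      exact inv_mul_cancel₀ ht.ne'
    obtain ⟨b0, hb0⟩ := exists_tendsto_of_bounded U b 1 (hbn.mono fun t ht => ht.le)
    have hb0n : ‖b0‖ = 1 :=
      tendsto_nhds_unique (hb0.norm.congr' hbn) tendsto_const_nhds
    have hbj : ∀ j r, Tendsto (fun t => b t j r) U (𝓝 (b0 j r)) := fun j r =>
      tendsto_pi_nhds.1 (tendsto_pi_nhds.1 hb0 j) r
    have hinv : Tendsto (fun t => ((‖c t‖⁻¹ : ℝ) : ℂ)) U (𝓝 0) := by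
      have : Tendsto (fun t => ‖c t‖⁻¹) U (𝓝 0) := tendsto_inv_atTop_zero.comp hK
      exact Complex.ofReal_zero ▸ (Complex.continuous_ofReal.tendsto 0).comp this
    have e1 : ∀ j, (p0 j 0 ⬝ᵥ y0) ^ 2 * b0 j 1 = 0 := fun j => by
      have := tendsto_nhds_unique ((((hd j 0).pow 2).mul (hbj j 1)).congr' (hl.mono fun t ht => by
        have := (coef_identities _ _ (w t j) (ht j)).1
        show _ = ((‖c t‖⁻¹ : ℝ) : ℂ) * (w t j * (p t j 2 ⬝ᵥ y t))
        rw [← this]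
        simp only [b, c, Pi.smul_apply, smul_eq_mul]
        ring)) (hinv.mul ((hwj j).mul (hd j 2)))
      simpa using this
    have e2 : ∀ j, (p0 j 0 ⬝ᵥ y0) ^ 2 * b0 j 2 = 0 := fun j => by
      have := tendsto_nhds_unique ((((hd j 0).pow 2).mul (hbj j 2)).congr' (hl.mono fun t ht => by
        have := (coef_identities _ _ (w t j) (ht j)).2.1
        show _ = ((‖c t‖⁻¹ : ℝ) : ℂ) * (w t j * (p t j 1 ⬝ᵥ y t))
        rw [← this]
        simp only [b, c, Pi.smul_apply, smul_eq_mul]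
        ring)) (hinv.mul ((hwj j).mul (hd j 1)))
      simpa using this
    have e3 : ∀ j, (p0 j 0 ⬝ᵥ y0) * b0 j 0 = -2 * (p0 j 1 ⬝ᵥ y0) * b0 j 1 := fun j =>
      tendsto_nhds_unique (((hd j 0).mul (hbj j 0)).congr' (hl.mono fun t ht => by
        have := (coef_identities _ _ (w t j) (ht j)).2.2.1
        simp only [b, c, Pi.smul_apply, smul_eq_mul]
        linear_combination ((‖c t‖⁻¹ : ℝ) : ℂ) * this)) (((hd j 1).const_mul (-2)).mul (hbj j 1))
    have e4 : ∀ j, (p0 j 0 ⬝ᵥ y0) * b0 j 0 = -2 * (p0 j 2 ⬝ᵥ y0) * b0 j 2 := fun j =>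
      tendsto_nhds_unique (((hd j 0).mul (hbj j 0)).congr' (hl.mono fun t ht => by
        have := (coef_identities _ _ (w t j) (ht j)).2.2.2.1
        simp only [b, c, Pi.smul_apply, smul_eq_mul]
        linear_combination ((‖c t‖⁻¹ : ℝ) : ℂ) * this)) (((hd j 2).const_mul (-2)).mul (hbj j 2))
    have hb00 : b0 = 0 := by
      refine h1 y0 hs0 hy0 b0 ?_ (hlim b b0 hb0 ?_)
      · intro j r hjr
        by_cases hj : p0 j 0 ⬝ᵥ y0 = 0
        · refine ⟨hj, ?_⟩
          fin_cases r
          · exact hj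
          · have := e3 j
            rw [hj] at this
            simpa [show b0 j 1 ≠ 0 from hjr] using this.symm
          · have := e4 j
            rw [hj] at this
            simpa [show b0 j 2 ≠ 0 from hjr] using this.symm
        · exfalso
          have z1 : b0 j 1 = 0 := by simpa [hj] using e1 j
          have z2 : b0 j 2 = 0 := by simpa [hj] using e2 j
          have z0 : b0 j 0 = 0 := by simpa [hj, z1] using e3 j
          apply hjr
          fin_cases r <;> assumption
      · filter_upwards [hrel] with t ht k hk
        have := ht k hk
        simp only [b, Pi.smul_apply, smul_assoc, ← Finset.smul_sum] at this ⊢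
        rw [this, smul_zero]
    rw [hb00, norm_zero] at hb0n
    exact zero_ne_one hb0n

/-- Critical points of weighted families converge if the limit family is generic. -/
lemma exists_limit {T : Type*} (U : Ultrafilter T) {F : Finset (Fin 4)} {p : T → Fam ι}
    {p0 : Fam ι} {w : T → ι → ℂ} {w0 : ι → ℂ} {y : T → V4} (i0 : ι)
    (hp : Tendsto p U (𝓝 p0)) (hw : Tendsto w U (𝓝 w0))
    (hs : ∀ᶠ t in U, ∀ k ∉ F, y t k = 0) (hl : ∀ᶠ t in U, ∀ i, p t i 0 ⬝ᵥ y t ≠ 0)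
    (hc : ∀ᶠ t in U, ∀ k ∈ F, (∑ i, w t i • gradOne (p t i) (y t)) k = 0)
    (h01 : ∀ᶠ t in U, p t i0 0 ⬝ᵥ y t = 1)
    (h1 : Gen1 F p0) (h3 : Gen3 F p0) (h2 : Gen2 F p0 w0) (hi0 : w0 i0 ≠ 0) :
    ∃ y0, Tendsto y U (𝓝 y0) ∧ (∀ k ∉ F, y0 k = 0) ∧ p0 i0 0 ⬝ᵥ y0 = 1 ∧
      ∀ i, w0 i ≠ 0 → p0 i 0 ⬝ᵥ y0 ≠ 0 := by
  have hp0 := tendsto_pi_nhds.1 (tendsto_pi_nhds.1 hp i0) 0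
  have hfin : ∀ y0, Tendsto y U (𝓝 y0) → p0 i0 0 ⬝ᵥ y0 = 1 := fun y0 hy0 =>
    tendsto_nhds_unique ((tendsto_dot hp0 hy0).congr' h01) tendsto_const_nhds
  rcases bounded_or_tendsto U y with ⟨K, hK⟩ | hK
  · obtain ⟨y0, hy0⟩ := exists_tendsto_of_bounded U y K hK
    have hn : y0 ≠ 0 := by
      rintro rfl
      simpa using hfin 0 hy0
    refine ⟨y0, hy0, fun k hk => tendsto_nhds_unique ((tendsto_pi_nhds.1 hy0 k).congr'
      (hs.mono fun t ht => ht k hk)) tendsto_const_nhds, hfin y0 hy0, fun i hi => ?_⟩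
    exact limit_ne_zero U hp hw hy0 hn hs hl hc h1 h3 h2 i hi
  · exfalso
    let x : T → V4 := fun t => ((‖y t‖⁻¹ : ℝ) : ℂ) • y t
    have hpos : ∀ᶠ t in U, 0 < ‖y t‖ := hK.eventually_gt_atTop 0
    have hxn : ∀ᶠ t in U, ‖x t‖ = 1 := by
      filter_upwards [hpos] with t ht
      simp only [x, norm_smul, Complex.norm_real, norm_inv, norm_norm]
      exact inv_mul_cancel₀ ht.ne'
    obtain ⟨x0, hx0⟩ := exists_tendsto_of_bounded U x 1 (hxn.mono fun t ht => ht.le)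
    have hx0n : ‖x0‖ = 1 := tendsto_nhds_unique (hx0.norm.congr' hxn) tendsto_const_nhds
    have hx00 : x0 ≠ 0 := by
      rintro rfl
      simp at hx0n
    have hinv : Tendsto (fun t => ((‖y t‖⁻¹ : ℝ) : ℂ)) U (𝓝 0) := by
      have : Tendsto (fun t => ‖y t‖⁻¹) U (𝓝 0) := tendsto_inv_atTop_zero.comp hK
      exact Complex.ofReal_zero ▸ (Complex.continuous_ofReal.tendsto 0).comp this
    have hsc : ∀ᶠ t in U, ((‖y t‖⁻¹ : ℝ) : ℂ) ≠ 0 := hpos.mono fun t ht => by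
      simpa using norm_pos_iff.1 ht
    refine limit_ne_zero U hp hw hx0 hx00 ?_ ?_ ?_ h1 h3 h2 i0 hi0 ?_
    · filter_upwards [hs] with t ht k hk
      simp [x, ht k hk]
    · filter_upwards [hl, hsc] with t ht hn i
      simp only [x, dotProduct_smul, smul_eq_mul]
      exact mul_ne_zero hn (ht i)
    · filter_upwards [hc, hsc, hl] with t ht hn hlt k hk
      have key : ∀ i, gradOne (p t i) (x t) =
          (((‖y t‖⁻¹ : ℝ) : ℂ))⁻¹ • gradOne (p t i) (y t) := by
        intro i
        rw [gradOne, gradOne, Finset.smul_sum]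
        refine Finset.sum_congr rfl fun r _ => ?_
        rw [smul_smul]
        congr 1
        have hz := hlt i
        simp only [x, coef, dotProduct_smul, smul_eq_mul]
        fin_cases r <;> simp only [Fin.isValue, Fin.zero_eta, Fin.mk_one, Fin.reduceFinMk,
          Matrix.cons_val] <;> field_simp
      simp only [key]
      rw [Finset.sum_congr rfl fun i _ => smul_comm (w t i) _ _, ← Finset.smul_sum,
        Pi.smul_apply, ht k hk, smul_zero]
    · have : Tendsto (fun t => p t i0 0 ⬝ᵥ x t) U (𝓝 0) := by
        refine hinv.congr' ?_
        filter_upwards [h01] with t ht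
        simp only [x, dotProduct_smul, ht, smul_eq_mul, mul_one]
      exact tendsto_nhds_unique (tendsto_dot hp0 hx0) this

/-- The number of critical points is locally constant at a generic family. -/
lemma locally_constant {i0 : ι} {F : Finset (Fin 4)} {p0 : Fam ι} (h1 : Gen1 F p0)
    (h3 : Gen3 F p0) (h2 : Gen2 F p0 1) (hf : (critSet i0 F p0).Finite)
    (hn : ∀ y ∈ critSet i0 F p0, Nondeg i0 F p0 y) :
    ∀ᶠ p in 𝓝 p0, (critSet i0 F p).Finite ∧
      (critSet i0 F p).ncard = (critSet i0 F p0).ncard ∧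
      ∀ y ∈ critSet i0 F p, Nondeg i0 F p y := by
  have : Finite (critSet i0 F p0) := hf
  have hbr : ∀ y : critSet i0 F p0, _ := fun y => exists_branch (critMap i0 F) p0 (y : V4)
    (contDiffAt_critMap (p := Prod.fst) (y := Prod.snd) i0 F contDiffAt_fst contDiffAt_snd
      y.2.2.1) ((critMap_eq_zero i0 F p0 y y.2.2.1).2 y.2)
    ((partialInj_critMap y.2).2 (hn y y.2))
  choose φ hφ1 hφ2 hφ3 hφ4 using hbr
  have hlam : ∀ y : critSet i0 F p0, ∀ᶠ p in 𝓝 p0, ∀ i, p i 0 ⬝ᵥ φ y p ≠ 0 := by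
    intro y
    refine eventually_all.2 fun i => ?_
    have h : Tendsto (fun p : Fam ι => p i 0 ⬝ᵥ φ y p) (𝓝 p0) (𝓝 (p0 i 0 ⬝ᵥ (y : V4))) :=
      tendsto_dot (tendsto_pi_nhds.1 (tendsto_pi_nhds.1 tendsto_id i) 0) (hφ1 y)
    exact h.eventually_ne (y.2.2.1 i)
  have hmem : ∀ y : critSet i0 F p0, ∀ᶠ p in 𝓝 p0, φ y p ∈ critSet i0 F p := by
    intro y
    filter_upwards [hlam y, hφ3 y] with p hp hz
    exact (critMap_eq_zero i0 F p _ hp).1 hz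
  have hpair : ∀ y : critSet i0 F p0, Tendsto (fun p => (p, φ y p)) (𝓝 p0) (𝓝 (p0, (y : V4))) :=
    fun y => tendsto_id.prodMk_nhds (hφ1 y)
  have hnd : ∀ᶠ p in 𝓝 p0, ∀ y, Nondeg i0 F p (φ y p) := by
    refine eventually_all.2 fun y => ?_
    filter_upwards [(hpair y).eventually (hφ4 y), hmem y] with p h hm
    exact (partialInj_critMap hm).1 h
  have := eventually_eq_range (𝓝 p0) (fun p => critSet i0 F p) φ hmem ?_ ?_
  · filter_upwards [this, hnd] with p ⟨a, b, c⟩ hp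
    refine ⟨a, by rw [b]; rfl, ?_⟩
    rw [c]
    rintro _ ⟨j, rfl⟩
    exact hp j
  · intro i j hij
    have hij' : (i : V4) ≠ j := fun h => hij (Subtype.ext h)
    have := (hφ1 i).sub (hφ1 j)
    exact (this.eventually_ne (sub_ne_zero.2 hij')).mono fun p hp => sub_ne_zero.1 hp
  · intro U hU y hy
    obtain ⟨y0, hy0, hs, hi0, hl⟩ := exists_limit U (p := id) (p0 := p0) (w := fun _ => 1) (w0 := 1)
      (y := y) (F := F) i0 (tendsto_id.mono_left hU) tendsto_const_nhds
      (hy.mono fun t ht => ht.1) (hy.mono fun t ht => ht.2.1)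
      (hy.mono fun t ht k hk => by simpa [grad] using ht.2.2.1 k hk)
      (hy.mono fun t ht => ht.2.2.2) h1 h3 h2 one_ne_zero
    have hl' : ∀ i, p0 i 0 ⬝ᵥ y0 ≠ 0 := fun i => hl i one_ne_zero
    have hmem0 : y0 ∈ critSet i0 F p0 := by
      refine ⟨hs, hl', fun k hk => ?_, hi0⟩
      have := tendsto_pi_nhds.1 (tendsto_grad (tendsto_id.mono_left hU) hy0 hl') k
      exact tendsto_nhds_unique (this.congr' (hy.mono fun t ht => ht.2.2.1 k hk))
        tendsto_const_nhds
    refine ⟨⟨y0, hmem0⟩, ?_⟩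
    have hpr : Tendsto (fun p => (p, y p)) U (𝓝 (p0, y0)) :=
      (tendsto_id.mono_left hU).prodMk_nhds hy0
    filter_upwards [hpr.eventually (hφ2 ⟨y0, hmem0⟩), hy] with p hp hyp
    exact (hp.1 ((critMap_eq_zero i0 F p _ hyp.2.1).2 hyp)).symm

end

section

lemma exists_ringEquiv_of_bases {α β : Type} {v : α → ℂ} {w : β → ℂ}
    (hv : IsTranscendenceBasis ℚ v) (hw : IsTranscendenceBasis ℚ w) (e : α ≃ β) :
    ∃ τ : ℂ ≃+* ℂ, ∀ i, τ (v i) = w (e i) := by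
  have := IsAlgClosed.isAlgClosure_of_transcendence_basis v hv
  have := IsAlgClosed.isAlgClosure_of_transcendence_basis w hw
  let f : Algebra.adjoin ℚ (Set.range v) ≃+* Algebra.adjoin ℚ (Set.range w) :=
    (hv.1.aevalEquiv.symm.toRingEquiv.trans (MvPolynomial.renameEquiv ℚ e).toRingEquiv).trans
      hw.1.aevalEquiv.toRingEquiv
  refine ⟨IsAlgClosure.equivOfEquiv ℂ ℂ f, fun i => ?_⟩
  have h1 : v i = algebraMap (Algebra.adjoin ℚ (Set.range v)) ℂ
      (hv.1.aevalEquiv (MvPolynomial.X i)) := by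
    rw [hv.1.algebraMap_aevalEquiv, MvPolynomial.aeval_X]
  rw [h1, IsAlgClosure.equivOfEquiv_algebraMap]
  have h2 : f (hv.1.aevalEquiv (MvPolynomial.X i)) = hw.1.aevalEquiv (MvPolynomial.X (e i)) := by
    change hw.1.aevalEquiv (MvPolynomial.renameEquiv ℚ e
      (hv.1.aevalEquiv.symm (hv.1.aevalEquiv (MvPolynomial.X i)))) = _
    rw [AlgEquiv.symm_apply_apply]
    simp
  rw [h2, hw.1.algebraMap_aevalEquiv, MvPolynomial.aeval_X]

/-- Field automorphisms of `ℂ` act transitively on finite algebraically independent tuples. -/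
lemma exists_ringEquiv {σ : Type} [Finite σ] {x x' : σ → ℂ} (hx : AlgebraicIndependent ℚ x)
    (hx' : AlgebraicIndependent ℚ x') : ∃ τ : ℂ ≃+* ℂ, ∀ i, τ (x i) = x' i := by
  obtain ⟨t, ht, hbt⟩ := exists_isTranscendenceBasis_superset
    (s := Set.range x) (R := ℚ) hx.coe_range
  obtain ⟨t', ht', hbt'⟩ := exists_isTranscendenceBasis_superset
    (s := Set.range x') (R := ℚ) hx'.coe_range
  have hC : Cardinal.aleph0 < Cardinal.mk ℂ := by
    rw [Cardinal.mk_complex]; exact Cardinal.aleph0_lt_continuum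
  have hct := IsAlgClosed.cardinal_eq_cardinal_transcendence_basis_of_aleph0_lt' _ hbt
    (by simp) hC
  have hct' := IsAlgClosed.cardinal_eq_cardinal_transcendence_basis_of_aleph0_lt' _ hbt'
    (by simp) hC
  let s : Set t := {y | (y : ℂ) ∈ Set.range x}
  have hs : s.Finite := Set.Finite.preimage Subtype.val_injective.injOn (Set.finite_range x)
  let inv : s → σ := fun y => y.2.choose
  have hinv : ∀ y : s, x (inv y) = (y : t) := fun y => y.2.choose_spec
  let f : s ↪ t' := ⟨fun y => ⟨x' (inv y), ht' ⟨_, rfl⟩⟩, by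
    intro y z h
    have h1 : x' (inv y) = x' (inv z) := congrArg Subtype.val h
    have h2 := hx'.injective h1
    apply Subtype.ext; apply Subtype.ext
    rw [← hinv, ← hinv, h2]⟩
  obtain ⟨e, he⟩ := Cardinal.extend_function_of_lt f
    (by rw [← hct]; exact lt_trans (Cardinal.lt_aleph0_iff_set_finite.2 hs) hC)
    (Cardinal.eq.1 (hct.symm.trans hct'))
  obtain ⟨τ, hτ⟩ := exists_ringEquiv_of_bases hbt hbt' e
  refine ⟨τ, fun i => ?_⟩
  let y : s := ⟨⟨x i, ht ⟨i, rfl⟩⟩, ⟨i, rfl⟩⟩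
  have h1 : inv y = i := hx.injective (hinv y)
  have h2 := hτ (y : t)
  rw [he y] at h2
  rw [show x i = ((y : t) : ℂ) from rfl, h2]
  show x' (inv y) = x' i
  rw [h1]

lemma dense_eval_ne_zero {σ : Type} [Finite σ] (f : MvPolynomial σ ℂ) (hf : f ≠ 0) :
    Dense {x : σ → ℂ | MvPolynomial.eval x f ≠ 0} := by
  have := Fintype.ofFinite σ
  rw [dense_iff_inter_open]
  intro U hU ⟨x0, hx0⟩
  by_contra hcon
  apply hf
  obtain ⟨ε, hε, hball⟩ := Metric.isOpen_iff.1 hU x0 hx0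
  refine MvPolynomial.funext_set (fun i => Metric.ball (x0 i) ε) (fun i => ?_) fun x hx => ?_
  · exact infinite_of_mem_nhds (x0 i) (Metric.ball_mem_nhds _ hε)
  · by_contra hne
    refine hcon ⟨x, hball ?_, by simpa using hne⟩
    exact (dist_pi_lt_iff hε).2 fun i => hx i trivial

lemma exists_eval_ne_zero {σ : Type} [Finite σ] {α : Type*} [Countable α]
    (f : α → MvPolynomial σ ℂ) (hf : ∀ a, f a ≠ 0) (U : Set (σ → ℂ)) (hU : IsOpen U)
    (hne : U.Nonempty) : ∃ x ∈ U, ∀ a, MvPolynomial.eval x (f a) ≠ 0 := by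
  have := Fintype.ofFinite σ
  have hd : Dense (⋂ a, {x : σ → ℂ | MvPolynomial.eval x (f a) ≠ 0}) := by
    refine dense_iInter_of_isOpen (fun a => ?_) fun a => dense_eval_ne_zero _ (hf a)
    exact isOpen_ne_fun (MvPolynomial.continuous_eval _) continuous_const
  obtain ⟨x, hx, hx'⟩ := hd.inter_open_nonempty U hU hne
  exact ⟨x, hx, fun a => Set.mem_iInter.1 hx' a⟩

lemma algebraicIndependent_iff_eval {σ : Type} {x : σ → ℂ} : AlgebraicIndependent ℚ x ↔
    ∀ f : MvPolynomial σ ℚ, f ≠ 0 → MvPolynomial.aeval x f ≠ 0 := by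
  rw [algebraicIndependent_iff]
  exact forall_congr' fun f => not_imp_not.symm

lemma countable_mvPolynomial {σ : Type} [Finite σ] : Countable (MvPolynomial σ ℚ) := by
  rw [← Cardinal.mk_le_aleph0_iff]
  refine MvPolynomial.cardinalMk_le_max.trans ?_
  simp

lemma exists_algebraicIndependent {σ : Type} [Finite σ] (U : Set (σ → ℂ)) (hU : IsOpen U)
    (hne : U.Nonempty) : ∃ x ∈ U, AlgebraicIndependent ℚ x := by
  have := countable_mvPolynomial (σ := σ)
  obtain ⟨x, hx, hx'⟩ := exists_eval_ne_zero
    (fun f : {f : MvPolynomial σ ℚ // f ≠ 0} => MvPolynomial.map (algebraMap ℚ ℂ) f.1)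
    (fun f h => f.2 (MvPolynomial.map_injective _ (algebraMap ℚ ℂ).injective (by simpa using h)))
    U hU hne
  refine ⟨x, hx, algebraicIndependent_iff_eval.2 fun f hf => ?_⟩
  have := hx' ⟨f, hf⟩
  rwa [MvPolynomial.eval_map, ← MvPolynomial.aeval_def] at this

variable {ι : Type} [Fintype ι]

/-- All coordinates of the family are algebraically independent over `ℚ`. -/
def Indep (p : Fam ι) : Prop :=
  AlgebraicIndependent ℚ fun t : ι × Fin 3 × Fin 4 => p t.1 t.2.1 t.2.2

def mapFam (τ : ℂ ≃+* ℂ) (p : Fam ι) : Fam ι := fun i r k => τ (p i r k)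

def mapV (τ : ℂ ≃+* ℂ) (y : V4) : V4 := fun k => τ (y k)

lemma map_dot (τ : ℂ ≃+* ℂ) (a b : V4) : mapV τ a ⬝ᵥ mapV τ b = τ (a ⬝ᵥ b) := by
  simp [dotProduct, mapV]

lemma mapV_eq_zero (τ : ℂ ≃+* ℂ) (y : V4) : mapV τ y = 0 ↔ y = 0 := by
  simp [funext_iff, mapV]

lemma mapV_symm (τ : ℂ ≃+* ℂ) (y : V4) : mapV τ (mapV τ.symm y) = y := by
  funext k; simp [mapV]

lemma mapV_injective (τ : ℂ ≃+* ℂ) : Function.Injective (mapV τ) := by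
  intro a b h
  funext k
  exact τ.injective (congrFun h k)

lemma map_gradOne (τ : ℂ ≃+* ℂ) (q : Fin 3 → V4) (y : V4) :
    gradOne (fun r => mapV τ (q r)) (mapV τ y) = mapV τ (gradOne q y) := by
  funext k
  simp only [gradOne, coef, Fin.sum_univ_three, map_dot]
  simp [mapV, map_ofNat τ]

lemma map_hessOne (τ : ℂ ≃+* ℂ) (q : Fin 3 → V4) (y δ : V4) :
    hessOne (fun r => mapV τ (q r)) (mapV τ y) (mapV τ δ) = mapV τ (hessOne q y δ) := by
  funext k
  simp only [hessOne, dcoef, Fin.sum_univ_three, map_dot]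
  simp [mapV, map_ofNat τ]

lemma map_grad (τ : ℂ ≃+* ℂ) (p : Fam ι) (y : V4) :
    grad (mapFam τ p) (mapV τ y) = mapV τ (grad p y) := by
  have : ∀ i, gradOne (mapFam τ p i) (mapV τ y) = mapV τ (gradOne (p i) y) :=
    fun i => map_gradOne τ (p i) y
  funext k
  simp only [grad, this]
  simp [mapV]

lemma map_hess (τ : ℂ ≃+* ℂ) (p : Fam ι) (y δ : V4) :
    hess (mapFam τ p) (mapV τ y) (mapV τ δ) = mapV τ (hess p y δ) := by
  have : ∀ i, hessOne (mapFam τ p i) (mapV τ y) (mapV τ δ) = mapV τ (hessOne (p i) y δ) :=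
    fun i => map_hessOne τ (p i) y δ
  funext k
  simp only [hess, this]
  simp [mapV]

lemma mapFam_dot (τ : ℂ ≃+* ℂ) (p : Fam ι) (i : ι) (r : Fin 3) (y : V4) :
    mapFam τ p i r ⬝ᵥ mapV τ y = τ (p i r ⬝ᵥ y) := map_dot τ _ _

lemma mem_critSet_map (τ : ℂ ≃+* ℂ) {i0 : ι} {F : Finset (Fin 4)} {p : Fam ι} {y : V4} :
    mapV τ y ∈ critSet i0 F (mapFam τ p) ↔ y ∈ critSet i0 F p := by
  simp only [critSet, Set.mem_ofPred_eq, mapFam_dot, map_grad]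
  simp [mapV]

lemma critSet_map (τ : ℂ ≃+* ℂ) (i0 : ι) (F : Finset (Fin 4)) (p : Fam ι) :
    critSet i0 F (mapFam τ p) = mapV τ '' critSet i0 F p := by
  ext y
  rw [← mapV_symm τ y, mem_critSet_map, (mapV_injective τ).mem_set_image]

lemma nondeg_map (τ : ℂ ≃+* ℂ) {i0 : ι} {F : Finset (Fin 4)} {p : Fam ι} {y : V4}
    (h : Nondeg i0 F p y) : Nondeg i0 F (mapFam τ p) (mapV τ y) := by
  intro δ
  rw [← mapV_symm τ δ, map_hess, mapFam_dot, mapV_eq_zero]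
  intro h1 h2 h3
  exact h _ (by simpa [mapV] using h1) (by simpa [mapV] using h2) (by simpa using h3)

lemma exists_mapFam {p p' : Fam ι} (h : Indep p) (h' : Indep p') :
    ∃ τ : ℂ ≃+* ℂ, mapFam τ p = p' := by
  obtain ⟨τ, hτ⟩ := exists_ringEquiv h h'
  exact ⟨τ, by funext i r k; exact hτ (i, r, k)⟩

/-- The number of critical points of algebraically independent families is `N`, and all of them
are nondegenerate. -/
def CritCount (i0 : ι) (F : Finset (Fin 4)) (N : ℕ) : Prop :=
  ∀ p : Fam ι, Indep p → (critSet i0 F p).Finite ∧ (critSet i0 F p).ncard = N ∧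
    ∀ y ∈ critSet i0 F p, Nondeg i0 F p y

lemma exists_indep {p0 : Fam ι} {P : Fam ι → Prop} (h : ∀ᶠ p in 𝓝 p0, P p) :
    ∃ p, Indep p ∧ P p := by
  let e : (ι × Fin 3 × Fin 4 → ℂ) → Fam ι := fun x i r k => x (i, r, k)
  have he : Continuous e := by fun_prop
  let x0 : ι × Fin 3 × Fin 4 → ℂ := fun t => p0 t.1 t.2.1 t.2.2
  have h0 : ∀ᶠ x in 𝓝 x0, P (e x) := (he.tendsto x0).eventually h
  obtain ⟨U, hU, hUo, hx0⟩ := eventually_nhds_iff.1 h0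
  obtain ⟨x, hx, hind⟩ := exists_algebraicIndependent U hUo ⟨x0, hx0⟩
  exact ⟨e x, hind, hU x hx⟩

lemma critCount_of_indep {i0 : ι} {F : Finset (Fin 4)} {N : ℕ} {p : Fam ι} (hi : Indep p)
    (hf : (critSet i0 F p).Finite) (hN : (critSet i0 F p).ncard = N)
    (hn : ∀ y ∈ critSet i0 F p, Nondeg i0 F p y) : CritCount i0 F N := by
  intro p' hp'
  obtain ⟨τ, rfl⟩ := exists_mapFam hi hp'
  rw [critSet_map]
  refine ⟨hf.image _, ?_, ?_⟩
  · rw [Set.ncard_image_of_injective _ (mapV_injective τ), hN]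
  · rintro _ ⟨y, hy, rfl⟩
    exact nondeg_map τ (hn y hy)

lemma critCount_of_example {i0 : ι} {F : Finset (Fin 4)} {N : ℕ} {p0 : Fam ι} (h1 : Gen1 F p0)
    (h3 : Gen3 F p0) (h2 : Gen2 F p0 1) (hf : (critSet i0 F p0).Finite)
    (hN : (critSet i0 F p0).ncard = N) (hn : ∀ y ∈ critSet i0 F p0, Nondeg i0 F p0 y) :
    CritCount i0 F N := by
  obtain ⟨p, hp, a, b, c⟩ := exists_indep (locally_constant h1 h3 h2 hf hn)
  exact critCount_of_indep hp a (b.trans hN) c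

end

section

section RPoly
variable {σ : Type}

/-- Polynomial functions with rational coefficients. -/
def RPoly (f : (σ → ℂ) → ℂ) : Prop :=
  ∃ P : MvPolynomial σ ℚ, ∀ x, f x = MvPolynomial.aeval x P

lemma RPoly.coord (s : σ) : RPoly fun x : σ → ℂ => x s :=
  ⟨MvPolynomial.X s, fun x => by simp⟩

lemma RPoly.ratCast (c : ℚ) : RPoly fun _ : σ → ℂ => (c : ℂ) :=
  ⟨MvPolynomial.C c, fun x => by simp⟩

lemma RPoly.intCast (c : ℤ) : RPoly fun _ : σ → ℂ => (c : ℂ) := by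
  simpa using RPoly.ratCast (σ := σ) c

lemma RPoly.add {f g : (σ → ℂ) → ℂ} (hf : RPoly f) (hg : RPoly g) : RPoly fun x => f x + g x := by
  obtain ⟨P, hP⟩ := hf
  obtain ⟨Q, hQ⟩ := hg
  exact ⟨P + Q, fun x => by simp [hP, hQ]⟩

lemma RPoly.mul {f g : (σ → ℂ) → ℂ} (hf : RPoly f) (hg : RPoly g) : RPoly fun x => f x * g x := by
  obtain ⟨P, hP⟩ := hf
  obtain ⟨Q, hQ⟩ := hg
  exact ⟨P * Q, fun x => by simp [hP, hQ]⟩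

lemma RPoly.sub {f g : (σ → ℂ) → ℂ} (hf : RPoly f) (hg : RPoly g) : RPoly fun x => f x - g x := by
  obtain ⟨P, hP⟩ := hf
  obtain ⟨Q, hQ⟩ := hg
  exact ⟨P - Q, fun x => by simp [hP, hQ]⟩

lemma RPoly.pow {f : (σ → ℂ) → ℂ} (hf : RPoly f) (n : ℕ) : RPoly fun x => f x ^ n := by
  obtain ⟨P, hP⟩ := hf
  exact ⟨P ^ n, fun x => by simp [hP]⟩

lemma RPoly.sum {α : Type*} (s : Finset α) {f : α → (σ → ℂ) → ℂ} (hf : ∀ a ∈ s, RPoly (f a)) :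
    RPoly fun x => ∑ a ∈ s, f a x := by
  classical
  induction s using Finset.induction_on with
  | empty => simpa using RPoly.intCast (σ := σ) 0
  | insert a s ha ih =>
    simp only [Finset.sum_insert ha]
    exact (hf a (by simp)).add (ih fun b hb => hf b (by simp [hb]))

lemma RPoly.prod {α : Type*} (s : Finset α) {f : α → (σ → ℂ) → ℂ} (hf : ∀ a ∈ s, RPoly (f a)) :
    RPoly fun x => ∏ a ∈ s, f a x := by
  classical
  induction s using Finset.induction_on with
  | empty => simpa using RPoly.intCast (σ := σ) 1
  | insert a s ha ih =>
    simp only [Finset.prod_insert ha]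
    exact (hf a (by simp)).mul (ih fun b hb => hf b (by simp [hb]))

lemma RPoly.dot {n : ℕ} {a b : (σ → ℂ) → Fin n → ℂ} (ha : ∀ k, RPoly fun x => a x k)
    (hb : ∀ k, RPoly fun x => b x k) : RPoly fun x => a x ⬝ᵥ b x :=
  RPoly.sum _ fun k _ => (ha k).mul (hb k)

lemma RPoly.det {n : ℕ} {M : (σ → ℂ) → Matrix (Fin n) (Fin n) ℂ}
    (h : ∀ i j, RPoly fun x => M x i j) : RPoly fun x => (M x).det := by
  simp only [Matrix.det_apply']
  refine RPoly.sum _ fun e _ => (RPoly.intCast _).mul (RPoly.prod _ fun i _ => h _ _)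

/-- `P` holds off a hypersurface defined over `ℚ`. -/
def GenQ (P : (σ → ℂ) → Prop) : Prop :=
  ∃ r : MvPolynomial σ ℚ, r ≠ 0 ∧ ∀ x : σ → ℂ, MvPolynomial.aeval x r ≠ 0 → P x

lemma GenQ.mono {P Q : (σ → ℂ) → Prop} (h : GenQ P) (hPQ : ∀ x, P x → Q x) : GenQ Q := by
  obtain ⟨r, hr, h⟩ := h
  exact ⟨r, hr, fun x hx => hPQ x (h x hx)⟩

lemma GenQ.and {P Q : (σ → ℂ) → Prop} (hP : GenQ P) (hQ : GenQ Q) : GenQ fun x => P x ∧ Q x := by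
  obtain ⟨r, hr, h⟩ := hP
  obtain ⟨s, hs, h'⟩ := hQ
  refine ⟨r * s, mul_ne_zero hr hs, fun x hx => ?_⟩
  rw [map_mul] at hx
  exact ⟨h x (left_ne_zero_of_mul hx), h' x (right_ne_zero_of_mul hx)⟩

lemma GenQ.forall {α : Type*} [Finite α] {P : α → (σ → ℂ) → Prop} (h : ∀ a, GenQ (P a)) :
    GenQ fun x => ∀ a, P a x := by
  have := Fintype.ofFinite α
  choose r hr h using h
  refine ⟨∏ a, r a, Finset.prod_ne_zero_iff.2 fun a _ => hr a, fun x hx a => h a x ?_⟩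
  rw [map_prod] at hx
  exact Finset.prod_ne_zero_iff.1 hx a (Finset.mem_univ a)

lemma GenQ.of_rpoly {f : (σ → ℂ) → ℂ} (hf : RPoly f) (x0 : σ → ℂ) (h0 : f x0 ≠ 0) :
    GenQ fun x => f x ≠ 0 := by
  obtain ⟨P, hP⟩ := hf
  refine ⟨P, ?_, fun x hx => by change f x ≠ 0; rwa [hP]⟩
  rintro rfl
  exact h0 (by simp [hP])

lemma GenQ.holds {P : (σ → ℂ) → Prop} (h : GenQ P) {x : σ → ℂ} (hx : AlgebraicIndependent ℚ x) :
    P x := by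
  obtain ⟨r, hr, h⟩ := h
  exact h x (algebraicIndependent_iff_eval.1 hx r hr)

end RPoly

variable {ι : Type}

/-- The family with given coordinates. -/
def famOf (x : ι × Fin 3 × Fin 4 → ℂ) : Fam ι := fun i r k => x (i, r, k)

lemma rpoly_famOf (i : ι) (r : Fin 3) (k : Fin 4) :
    RPoly fun x : ι × Fin 3 × Fin 4 → ℂ => famOf x i r k := RPoly.coord _

lemma GenQ.indep {P : Fam ι → Prop} (h : GenQ fun x => P (famOf x)) {p : Fam ι} (hp : Indep p) :
    P p := h.holds hp

/-- All minors of the matrix of coefficients are nonzero. -/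
def Minors (p : Fam ι) : Prop :=
  ∀ s : Fin 5, ∀ (e : Fin s ↪ ι × Fin 3) (f : Fin s ↪ Fin 4),
    (Matrix.of fun a b => p (e a).1 (e a).2 (f b)).det ≠ 0

lemma genQ_minors [Finite ι] : GenQ fun x : ι × Fin 3 × Fin 4 → ℂ => Minors (famOf x) := by
  classical
  refine GenQ.forall fun s => GenQ.forall fun e => GenQ.forall fun f => ?_
  refine GenQ.of_rpoly (RPoly.det fun i j => rpoly_famOf _ _ _)
    (fun t => if ∃ a, e a = (t.1, t.2.1) ∧ f a = t.2.2 then 1 else 0) ?_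
  refine ne_of_eq_of_ne ?_ one_ne_zero
  refine Eq.trans (congrArg Matrix.det ?_) (Matrix.det_one (n := Fin s))
  ext a b
  simp only [famOf, Matrix.of_apply, Matrix.one_apply, Prod.mk.eta, e.injective.eq_iff,
    f.injective.eq_iff, exists_eq_left]

lemma Minors.eq_zero {p : Fam ι} (hp : Minors p) {F : Finset (Fin 4)} {T : Finset (ι × Fin 3)}
    (hFT : F.card ≤ T.card) {y : V4} (hy : ∀ k ∉ F, y k = 0)
    (h : ∀ t ∈ T, p t.1 t.2 ⬝ᵥ y = 0) : y = 0 := by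
  obtain ⟨T', hT', hc⟩ := Finset.exists_subset_card_eq hFT
  have hF4 : F.card < 5 := by
    have := F.card_le_univ
    simp at this; omega
  let f : Fin F.card ↪ Fin 4 := (F.orderEmbOfFin rfl).toEmbedding
  let e : Fin F.card ↪ ι × Fin 3 := (T'.equivFinOfCardEq hc).symm.toEmbedding.trans
    (Function.Embedding.subtype _)
  have hd := hp ⟨F.card, hF4⟩ e f
  have hz := Matrix.eq_zero_of_mulVec_eq_zero hd (v := fun b => y (f b)) (by
    funext a
    have h1 := h (e a) (hT' (by simp [e]))
    simp only [Matrix.mulVec, dotProduct, Matrix.of_apply, Pi.zero_apply]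
    rw [dotProduct, ← Finset.sum_subset (Finset.subset_univ F)
      (fun k _ hk => by rw [hy k hk, mul_zero])] at h1
    rw [← h1, ← Finset.sum_map Finset.univ f (fun k => p (e a).1 (e a).2 k * y k)]
    congr 1
    rw [← Finset.coe_inj, Finset.coe_map, Finset.coe_univ, Set.image_univ]
    exact Finset.range_orderEmbOfFin F rfl)
  funext k
  by_cases hk : k ∈ F
  · rw [← Finset.mem_coe, ← Finset.range_orderEmbOfFin F rfl] at hk
    obtain ⟨b, rfl⟩ := hk
    exact congrFun hz b
  · exact hy k hk

lemma Minors.coef_eq_zero [Fintype ι] {p : Fam ι} (hp : Minors p) {F : Finset (Fin 4)}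
    {T : Finset (ι × Fin 3)} (hFT : T.card ≤ F.card) {c : ι → Fin 3 → ℂ}
    (hc : ∀ t ∉ T, c t.1 t.2 = 0) (h : ∀ k ∈ F, (∑ i, ∑ r, c i r • p i r) k = 0) : c = 0 := by
  classical
  obtain ⟨F', hF', hcard⟩ := Finset.exists_subset_card_eq hFT
  have hF4 : T.card < 5 := by
    have := F.card_le_univ
    simp at this; omega
  let f : Fin T.card ↪ Fin 4 := (F'.orderEmbOfFin hcard).toEmbedding
  let e : Fin T.card ↪ ι × Fin 3 := T.equivFin.symm.toEmbedding.trans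
    (Function.Embedding.subtype _)
  have hd := hp ⟨T.card, hF4⟩ e f
  have hT : Finset.univ.map e = T := by
    ext t
    simp only [e, Finset.mem_map, Finset.mem_univ, true_and]
    constructor
    · rintro ⟨a, rfl⟩; simp
    · intro ht; exact ⟨T.equivFin ⟨t, ht⟩, by simp⟩
  have hz := Matrix.eq_zero_of_vecMul_eq_zero hd (v := fun a => c (e a).1 (e a).2) (by
    funext b
    have h1 := h (f b) (hF' (by simp [f]))
    simp only [Matrix.vecMul, dotProduct, Matrix.of_apply, Pi.zero_apply]
    simp only [Finset.sum_apply, Pi.smul_apply, smul_eq_mul] at h1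
    rw [← Fintype.sum_prod_type' (fun i r => c i r * p i r (f b)),
      ← Finset.sum_subset (Finset.subset_univ T) (fun t _ ht => by rw [hc t ht, zero_mul]),
      ← Finset.sum_congr hT (fun _ _ => rfl), Finset.sum_map] at h1
    exact h1)
  funext i r
  by_cases ht : (i, r) ∈ T
  · rw [← hT] at ht
    obtain ⟨a, -, ha⟩ := Finset.mem_map.1 ht
    have := congrFun hz a
    simpa [ha] using this
  · exact hc (i, r) ht

lemma Minors.gen1 [Fintype ι] {p : Fam ι} (hp : Minors p) (F : Finset (Fin 4)) : Gen1 F p := by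
  classical
  intro y hy hy0 c hc h
  let T : Finset (ι × Fin 3) := Finset.univ.filter fun t => p t.1 t.2 ⬝ᵥ y = 0
  refine hp.coef_eq_zero (T := T) ?_ (fun t ht => ?_) h
  · by_contra hcon
    exact hy0 (hp.eq_zero (T := T) (by omega) hy (by simp [T]))
  · by_contra hne
    exact ht (by simpa [T] using (hc _ _ hne).2)

lemma Minors.eq_zero_of_centre {p : Fam ι} (hp : Minors p) {F : Finset (Fin 4)} (hF : F.card ≤ 3)
    {y : V4} (hy : ∀ k ∉ F, y k = 0) (i : ι) (h : ∀ r, p i r ⬝ᵥ y = 0) : y = 0 := by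
  classical
  refine hp.eq_zero (T := Finset.univ.map ⟨fun r : Fin 3 => (i, r), fun a b h => by simpa using h⟩)
    (by simpa using hF) hy ?_
  intro t ht
  obtain ⟨r, -, rfl⟩ := Finset.mem_map.1 ht
  exact h r

lemma Minors.gen3 [Fintype ι] {p : Fam ι} (hp : Minors p) (F : Finset (Fin 4)) : Gen3 F p := by
  classical
  intro y hy hy0 i j hij hc hl
  have hF4 := F.card_le_univ
  refine hy0 (hp.eq_zero (T := insert (j, 0)
    (Finset.univ.map ⟨fun r : Fin 3 => (i, r), fun a b h => by simpa using h⟩)) ?_ hy ?_)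
  · rw [Finset.card_insert_of_notMem (fun hm => by
      obtain ⟨r, -, hr⟩ := Finset.mem_map.1 hm
      exact hij (congrArg Prod.fst hr).symm)]
    simpa using hF4
  · intro t ht
    rcases Finset.mem_insert.1 ht with rfl | ht
    · exact hl
    · obtain ⟨r, -, rfl⟩ := Finset.mem_map.1 ht
      exact hc r

lemma Minors.gen2_of_card [Fintype ι] {p : Fam ι} (hp : Minors p) {F : Finset (Fin 4)}
    (hF : F.card ≤ 3) (w : ι → ℂ) : Gen2 F p w := by
  intro y hy hy0 i _ hc
  exact absurd (hp.eq_zero_of_centre hF hy i hc) hy0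

end

section

lemma det_four (M : Matrix (Fin 4) (Fin 4) ℂ) : M.det =
    M 0 0 * (M 1 1 * (M 2 2 * M 3 3 - M 2 3 * M 3 2) - M 1 2 * (M 2 1 * M 3 3 - M 2 3 * M 3 1)
      + M 1 3 * (M 2 1 * M 3 2 - M 2 2 * M 3 1))
    - M 0 1 * (M 1 0 * (M 2 2 * M 3 3 - M 2 3 * M 3 2) - M 1 2 * (M 2 0 * M 3 3 - M 2 3 * M 3 0)
      + M 1 3 * (M 2 0 * M 3 2 - M 2 2 * M 3 0))
    + M 0 2 * (M 1 0 * (M 2 1 * M 3 3 - M 2 3 * M 3 1) - M 1 1 * (M 2 0 * M 3 3 - M 2 3 * M 3 0)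
      + M 1 3 * (M 2 0 * M 3 1 - M 2 1 * M 3 0))
    - M 0 3 * (M 1 0 * (M 2 1 * M 3 2 - M 2 2 * M 3 1) - M 1 1 * (M 2 0 * M 3 2 - M 2 2 * M 3 0)
      + M 1 2 * (M 2 0 * M 3 1 - M 2 1 * M 3 0)) := by
  simp only [Matrix.det_succ_row_zero (n := 3), Fin.sum_univ_four, Matrix.det_fin_three,
    Matrix.submatrix_apply]
  simp [Fin.succAbove]
  ring

/-- The generalized cross product of three vectors of `ℂ⁴`. -/
def cross (a b c : V4) : V4 := fun k => Matrix.det (Matrix.of ![Pi.single k 1, a, b, c])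

lemma cross_dot (a b c y : V4) : cross a b c ⬝ᵥ y = Matrix.det (Matrix.of ![y, a, b, c]) := by
  simp only [cross, dotProduct, Fin.sum_univ_four, det_four, Matrix.of_apply]
  simp
  ring

lemma dot_cross_fst (a b c : V4) : a ⬝ᵥ cross a b c = 0 := by
  rw [dotProduct_comm, cross_dot]
  exact Matrix.det_zero_of_row_eq (i := 0) (j := 1) (by decide) rfl

lemma dot_cross_snd (a b c : V4) : b ⬝ᵥ cross a b c = 0 := by
  rw [dotProduct_comm, cross_dot]
  exact Matrix.det_zero_of_row_eq (i := 0) (j := 2) (by decide) rfl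

lemma dot_cross_trd (a b c : V4) : c ⬝ᵥ cross a b c = 0 := by
  rw [dotProduct_comm, cross_dot]
  exact Matrix.det_zero_of_row_eq (i := 0) (j := 3) (by decide) rfl

lemma rpoly_cross {σ : Type} {a b c : (σ → ℂ) → V4} (ha : ∀ k, RPoly fun x => a x k)
    (hb : ∀ k, RPoly fun x => b x k) (hc : ∀ k, RPoly fun x => c x k) (k : Fin 4) :
    RPoly fun x => cross (a x) (b x) (c x) k := by
  refine RPoly.det fun i j => ?_
  fin_cases i
  · by_cases h : j = k
    · simpa [h] using RPoly.intCast (σ := σ) 1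
    · simpa [h] using RPoly.intCast (σ := σ) 0
  · exact ha j
  · exact hb j
  · exact hc j

/-- The centre of a camera. -/
def centre (q : Fin 3 → V4) : V4 := cross (q 0) (q 1) (q 2)

lemma dot_centre (q : Fin 3 → V4) (r : Fin 3) : q r ⬝ᵥ centre q = 0 := by
  fin_cases r
  · exact dot_cross_fst _ _ _
  · exact dot_cross_snd _ _ _
  · exact dot_cross_trd _ _ _

/-- `l ^ 3` times the derivative of `u v / l ^ 2` in the direction `z`. -/
def gradNum (q : Fin 3 → V4) (y z : V4) : ℂ :=
  -2 * (q 1 ⬝ᵥ y) * (q 2 ⬝ᵥ y) * (q 0 ⬝ᵥ z) +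
    (q 0 ⬝ᵥ y) * ((q 2 ⬝ᵥ y) * (q 1 ⬝ᵥ z) + (q 1 ⬝ᵥ y) * (q 2 ⬝ᵥ z))

lemma gradOne_dot_eq (q : Fin 3 → V4) (y z : V4) (h : q 0 ⬝ᵥ y ≠ 0) :
    gradOne q y ⬝ᵥ z = gradNum q y z / (q 0 ⬝ᵥ y) ^ 3 := by
  simp only [gradOne, Fin.sum_univ_three, add_dotProduct, smul_dotProduct, coef, gradNum]
  simp
  field_simp
  ring

lemma gradOne_smul (q : Fin 3 → V4) (y : V4) {κ : ℂ} (hκ : κ ≠ 0) :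
    gradOne q (κ • y) = κ⁻¹ • gradOne q y := by
  by_cases h : q 0 ⬝ᵥ y = 0
  · simp [gradOne, coef, Fin.sum_univ_three, h]
  · funext k
    simp only [gradOne, Fin.sum_univ_three, coef, dotProduct_smul, Pi.add_apply, Pi.smul_apply,
      smul_eq_mul]
    simp
    field_simp

lemma grad_smul {ι : Type} [Fintype ι] (p : Fam ι) (y : V4) {κ : ℂ} (hκ : κ ≠ 0) :
    grad p (κ • y) = κ⁻¹ • grad p y := by
  simp only [grad, Finset.smul_sum, gradOne_smul _ _ hκ]

variable {ι : Type} [Fintype ι]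

lemma Minors.centre_ne_zero {p : Fam ι} (hp : Minors p) (i : ι) : centre (p i) ≠ 0 := by
  intro h
  have h0 := congrFun h 0
  have h3 := hp 3 ⟨fun r : Fin 3 => (i, r), fun a b h => congrArg Prod.snd h⟩
    ⟨fun k : Fin 3 => k.succ, Fin.succ_injective _⟩
  refine h3 ((Matrix.det_fin_three _).trans ?_)
  simp only [centre, cross, det_four] at h0
  simp at h0
  rw [← h0]
  change p i 0 1 * p i 1 2 * p i 2 3 - p i 0 1 * p i 1 3 * p i 2 2 - p i 0 2 * p i 1 1 * p i 2 3 +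
    p i 0 2 * p i 1 3 * p i 2 1 + p i 0 3 * p i 1 1 * p i 2 2 - p i 0 3 * p i 1 2 * p i 2 1 = _
  ring

lemma Minors.eq_smul_centre {p : Fam ι} (hp : Minors p) {i : ι} {y : V4}
    (h : ∀ r, p i r ⬝ᵥ y = 0) : ∃ κ : ℂ, y = κ • centre (p i) := by
  obtain ⟨k, hk⟩ : ∃ k, centre (p i) k ≠ 0 := by
    by_contra! hcon
    exact hp.centre_ne_zero i (funext hcon)
  refine ⟨y k / centre (p i) k, ?_⟩
  have := hp.eq_zero_of_centre (F := Finset.univ.erase k)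
    (y := y - (y k / centre (p i) k) • centre (p i)) (by simp) ?_ i ?_
  · exact sub_eq_zero.1 this
  · intro j hj
    have : j = k := by simpa using hj
    subst this
    simp [hk]
  · intro r
    rw [dotProduct_sub, h r, dotProduct_smul, dot_centre]
    simp

/-- The polynomial whose nonvanishing gives `Gen2`. -/
def centrePoly (p : Fam ι) (i : ι) : ℂ := by
  classical
  exact ∑ j ∈ Finset.univ.erase i,
    gradNum (p j) (centre (p i)) (cross (p i 1) (p i 2) (Pi.single 0 1)) *
      ∏ k ∈ (Finset.univ.erase i).erase j, (p k 0 ⬝ᵥ centre (p i)) ^ 3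

lemma gen2_of_centrePoly {p : Fam ι} (hp : Minors p) (h : ∀ i, centrePoly p i ≠ 0)
    (F : Finset (Fin 4)) : Gen2 F p 1 := by
  classical
  by_cases hF : F.card ≤ 3
  · exact hp.gen2_of_card hF 1
  have hF4 : F = Finset.univ := by
    rw [← Finset.card_eq_iff_eq_univ]
    have := F.card_le_univ
    simp at this ⊢; omega
  subst hF4
  intro y _ hy0 i _ hc
  have hl : ∀ j, j ≠ i → p j 0 ⬝ᵥ y ≠ 0 := fun j hj =>
    hp.gen3 Finset.univ y (by simp) hy0 i j hj hc
  obtain ⟨κ, rfl⟩ := hp.eq_smul_centre hc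
  have hκ : κ ≠ 0 := by rintro rfl; simp at hy0
  refine ⟨cross (p i 1) (p i 2) (Pi.single 0 1), by simp, dot_cross_fst _ _ _,
    dot_cross_snd _ _ _, fun s hs0 hs hsum => h i ?_⟩
  have hl' : ∀ j, j ≠ i → p j 0 ⬝ᵥ centre (p i) ≠ 0 := fun j hj h0 => hl j hj (by
    rw [dotProduct_smul, h0, smul_zero])
  rw [← Finset.add_sum_erase _ _ (Finset.mem_univ i), hs0, zero_add] at hsum
  have h2 : ∀ j ∈ Finset.univ.erase i,
      gradNum (p j) (centre (p i)) (cross (p i 1) (p i 2) (Pi.single 0 1)) *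
      ∏ k ∈ (Finset.univ.erase i).erase j, (p k 0 ⬝ᵥ centre (p i)) ^ 3 =
      κ * (∏ k ∈ Finset.univ.erase i, (p k 0 ⬝ᵥ centre (p i)) ^ 3) * s j := by
    intro j hj
    have hj' := Finset.ne_of_mem_erase hj
    rw [hs j hj', gradOne_smul _ _ hκ, smul_dotProduct, gradOne_dot_eq _ _ _ (hl' j hj'),
      ← Finset.mul_prod_erase _ _ hj, Pi.one_apply, smul_eq_mul]
    have := hl' j hj'
    field_simp
  rw [centrePoly, Finset.sum_congr rfl h2, ← Finset.mul_sum, hsum, mul_zero]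

lemma RPoly.gradNum {σ : Type} {q : (σ → ℂ) → Fin 3 → V4} {y z : (σ → ℂ) → V4}
    (hq : ∀ r k, RPoly fun x => q x r k) (hy : ∀ k, RPoly fun x => y x k)
    (hz : ∀ k, RPoly fun x => z x k) : RPoly fun x => gradNum (q x) (y x) (z x) := by
  have hd : ∀ r, RPoly fun x => q x r ⬝ᵥ y x := fun r => RPoly.dot (hq r) hy
  have hd' : ∀ r, RPoly fun x => q x r ⬝ᵥ z x := fun r => RPoly.dot (hq r) hz
  have h2 : RPoly fun _ : σ → ℂ => (-2 : ℂ) := by simpa using RPoly.intCast (σ := σ) (-2)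
  exact (((h2.mul (hd 1)).mul (hd 2)).mul (hd' 0)).add
    ((hd 0).mul (((hd 2).mul (hd' 1)).add ((hd 1).mul (hd' 2))))

lemma rpoly_centrePoly (i : ι) : RPoly fun x : ι × Fin 3 × Fin 4 → ℂ => centrePoly (famOf x) i := by
  have hc : ∀ k, RPoly fun x : ι × Fin 3 × Fin 4 → ℂ => centre (famOf x i) k :=
    rpoly_cross (rpoly_famOf i 0) (rpoly_famOf i 1) (rpoly_famOf i 2)
  refine RPoly.sum _ fun j _ => (RPoly.gradNum (rpoly_famOf j) hc ?_).mul
    (RPoly.prod _ fun k _ => RPoly.pow (RPoly.dot (rpoly_famOf k 0) hc) 3)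
  refine rpoly_cross (rpoly_famOf i 1) (rpoly_famOf i 2) fun k => ?_
  by_cases h : k = 0
  · subst h; simpa using RPoly.intCast (σ := ι × Fin 3 × Fin 4) 1
  · simpa [h] using RPoly.intCast (σ := ι × Fin 3 × Fin 4) 0

lemma genQ_centrePoly (hι : 2 ≤ Fintype.card ι) :
    GenQ fun x : ι × Fin 3 × Fin 4 → ℂ => ∀ i, centrePoly (famOf x) i ≠ 0 := by
  classical
  refine GenQ.forall fun i => ?_
  let p0 : Fam ι := fun j => if j = i then ![Pi.single 1 1, Pi.single 2 1, Pi.single 3 1] else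
    ![Pi.single 0 1 + Pi.single 1 1, Pi.single 0 1, Pi.single 0 1]
  refine GenQ.of_rpoly (rpoly_centrePoly i) (fun t => p0 t.1 t.2.1 t.2.2) ?_
  have hf : famOf (fun t : ι × Fin 3 × Fin 4 => p0 t.1 t.2.1 t.2.2) = p0 := rfl
  rw [hf]
  have hc : centre (p0 i) = Pi.single 0 1 := by
    funext k
    simp only [centre, cross, p0]
    fin_cases k <;> simp [det_four]
  have hz : cross (p0 i 1) (p0 i 2) (Pi.single 0 1) = Pi.single 1 (-1) := by
    funext k
    simp only [cross, p0]
    fin_cases k <;> simp [det_four]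
  rw [centrePoly, hc, hz]
  have h1 : ∀ j ∈ Finset.univ.erase i, gradNum (p0 j) (Pi.single 0 1) (Pi.single 1 (-1)) *
      ∏ k ∈ (Finset.univ.erase i).erase j, (p0 k 0 ⬝ᵥ Pi.single 0 1) ^ 3 = (2 : ℂ) := by
    intro j hj
    rw [Finset.prod_eq_one]
    · simp [gradNum, p0, Finset.ne_of_mem_erase hj]
    · intro k hk
      simp [p0, Finset.ne_of_mem_erase (Finset.mem_of_mem_erase hk)]
  rw [Finset.sum_congr rfl h1, Finset.sum_const, Finset.card_erase_of_mem (Finset.mem_univ i)]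
  simp only [Finset.card_univ, nsmul_eq_mul]
  refine mul_ne_zero (Nat.cast_ne_zero.2 (by omega)) two_ne_zero

end

section

variable {ι : Type} [Fintype ι]

lemma Indep.minors {p : Fam ι} (hp : Indep p) : Minors p := genQ_minors.indep hp

lemma Minors.exists_coef_ne_zero {p : Fam ι} (hp : Minors p) {F : Finset (Fin 4)}
    (hF : F.card ≤ 2 * Fintype.card ι) {y : V4} (hy : ∀ k ∉ F, y k = 0) (hy0 : y ≠ 0)
    (hl : ∀ i, p i 0 ⬝ᵥ y ≠ 0) : ∃ i r, coef (p i) y r ≠ 0 := by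
  classical
  by_contra! hcon
  refine hy0 (hp.eq_zero (T := Finset.univ ×ˢ {1, 2}) ?_ hy ?_)
  · rw [Finset.card_product, Finset.card_univ, Finset.card_pair (by decide)]
    omega
  · rintro ⟨i, r⟩ ht
    have h1 := hcon i 1
    have h2 := hcon i 2
    have hli := hl i
    simp [coef] at h1 h2
    simp only [Finset.mem_product, Finset.mem_univ, true_and, Finset.mem_insert,
      Finset.mem_singleton] at ht
    rcases ht with rfl | rfl
    · exact h2.resolve_right hli
    · exact h1.resolve_right hli

/-- Replace one column of the coefficient matrix. -/
def setCol (p : Fam ι) (x : Fin 4) (X : ι × Fin 3 → ℂ) : Fam ι :=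
  fun i r k => if k = x then X (i, r) else p i r k

lemma exists_setCol {p : Fam ι} (hp : Indep p) (x : Fin 4) {α : Type} [Countable α]
    (c : α → ι → Fin 3 → ℂ) (hc : ∀ a, ∃ i r, c a i r ≠ 0) :
    ∃ X, Indep (setCol p x X) ∧ ∀ a, ∑ i, ∑ r, c a i r * X (i, r) ≠ 0 := by
  classical
  let g : ι × Fin 3 × Fin 4 → MvPolynomial (ι × Fin 3) ℂ := fun t =>
    if t.2.2 = x then MvPolynomial.X (t.1, t.2.1) else MvPolynomial.C (p t.1 t.2.1 t.2.2)
  have hg : ∀ (X : ι × Fin 3 → ℂ) (f : MvPolynomial (ι × Fin 3 × Fin 4) ℚ),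
      MvPolynomial.eval X (MvPolynomial.aeval g f) =
      MvPolynomial.aeval (fun t : ι × Fin 3 × Fin 4 => setCol p x X t.1 t.2.1 t.2.2) f := by
    intro X f
    rw [MvPolynomial.aeval_def, MvPolynomial.aeval_def, ← MvPolynomial.coe_eval₂Hom,
      ← RingHom.comp_apply, MvPolynomial.comp_eval₂Hom, MvPolynomial.coe_eval₂Hom]
    congr 1
    · exact RingHom.ext fun q => by simp
    · funext t
      by_cases h : t.2.2 = x <;> simp [g, setCol, h]
  have hl : ∀ (X : ι × Fin 3 → ℂ) (d : ι → Fin 3 → ℂ),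
      MvPolynomial.eval X (∑ i, ∑ r, MvPolynomial.C (d i r) * MvPolynomial.X (i, r)) =
      ∑ i, ∑ r, d i r * X (i, r) := by
    intro X d
    simp
  have := countable_mvPolynomial (σ := ι × Fin 3 × Fin 4)
  obtain ⟨X, -, hX⟩ := exists_eval_ne_zero
    (Sum.elim (fun f : {f : MvPolynomial (ι × Fin 3 × Fin 4) ℚ // f ≠ 0} =>
      MvPolynomial.aeval g f.1)
      (fun a : α => ∑ i, ∑ r, MvPolynomial.C (c a i r) * MvPolynomial.X (i, r))) (by
    rintro (⟨f, hf⟩ | a) h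
    · have h1 := hg (fun t => p t.1 t.2 x) f
      rw [Sum.elim_inl] at h
      rw [h, map_zero] at h1
      refine algebraicIndependent_iff_eval.1 hp f hf ?_
      rw [h1]
      congr 2
      funext t
      by_cases ht : t.2.2 = x <;> simp [setCol, ht]
    · obtain ⟨i, r, hir⟩ := hc a
      have h1 := hl (Pi.single (i, r) 1) (c a)
      rw [Sum.elim_inr] at h
      rw [h, map_zero, Finset.sum_eq_single i, Finset.sum_eq_single r] at h1
      · simp at h1; exact hir h1.symm
      · intro s _ hs; simp [hs]
      · simp
      · intro j _ hj
        exact Finset.sum_eq_zero fun s _ => by simp [hj]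
      · simp) Set.univ isOpen_univ Set.univ_nonempty
  refine ⟨X, algebraicIndependent_iff_eval.2 fun f hf => ?_, fun a => ?_⟩
  · rw [← hg]
    exact hX (Sum.inl ⟨f, hf⟩)
  · rw [← hl]
    exact hX (Sum.inr a)

lemma setCol_dot (p : Fam ι) {F : Finset (Fin 4)} {x : Fin 4} (hx : x ∉ F) (X : ι × Fin 3 → ℂ)
    {y : V4} (hy : ∀ k ∉ F, y k = 0) (i : ι) (r : Fin 3) :
    setCol p x X i r ⬝ᵥ y = p i r ⬝ᵥ y := by
  refine dot_congr_supp hy fun k hk => ?_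
  have : k ≠ x := by rintro rfl; exact hx hk
  simp [setCol, this]

lemma setCol_coef (p : Fam ι) {F : Finset (Fin 4)} {x : Fin 4} (hx : x ∉ F) (X : ι × Fin 3 → ℂ)
    {y : V4} (hy : ∀ k ∉ F, y k = 0) (i : ι) : coef (setCol p x X i) y = coef (p i) y := by
  simp only [coef, setCol_dot p hx X hy]

lemma grad_apply (p : Fam ι) (y : V4) (k : Fin 4) :
    grad p y k = ∑ i, ∑ r, coef (p i) y r * p i r k := by
  simp [grad, gradOne, Finset.sum_apply]

lemma setCol_critSet (p : Fam ι) {F : Finset (Fin 4)} {x : Fin 4} (hx : x ∉ F)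
    (X : ι × Fin 3 → ℂ) (i0 : ι) : critSet i0 F (setCol p x X) = critSet i0 F p := by
  ext y
  simp only [critSet, Set.mem_ofPred_eq]
  refine and_congr_right fun hy => ?_
  simp only [setCol_dot p hx X hy]
  refine and_congr_right fun _ => and_congr_left fun _ => ?_
  refine forall₂_congr fun k hk => ?_
  have : k ≠ x := by rintro rfl; exact hx hk
  rw [grad_apply, grad_apply]
  simp only [setCol_coef p hx X hy]
  simp [setCol, this]

/-- At a critical point supported on `F`, the other partial derivatives do not vanish. -/
lemma CritCount.grad_ne_zero {i0 : ι} {F : Finset (Fin 4)} {N : ℕ} (h : CritCount i0 F N)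
    (hF : F.card ≤ 2 * Fintype.card ι) {p : Fam ι} (hp : Indep p) {y : V4}
    (hy : y ∈ critSet i0 F p) {x : Fin 4} (hx : x ∉ F) : grad p y x ≠ 0 := by
  have hfin := (h p hp).1
  have hc : ∀ z : critSet i0 F p, ∃ i r, coef (p i) z.1 r ≠ 0 := fun z =>
    hp.minors.exists_coef_ne_zero hF z.2.1 (by
      intro h0
      have := z.2.2.2.2
      simp [h0] at this) z.2.2.1
  have := hfin.countable.to_subtype
  obtain ⟨X, hX, hne⟩ := exists_setCol hp x (fun z : critSet i0 F p => fun i => coef (p i) z.1) hc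
  obtain ⟨τ, hτ⟩ := exists_mapFam hp hX
  have hz : mapV τ y ∈ critSet i0 F p := by
    rw [← setCol_critSet p hx X, ← hτ, mem_critSet_map]
    exact hy
  intro h0
  refine hne ⟨_, hz⟩ ?_
  have h1 : grad (setCol p x X) (mapV τ y) x = 0 := by
    rw [← hτ, map_grad]
    simp [mapV, h0]
  rw [grad_apply] at h1
  simp only [setCol_coef p hx X hz.1] at h1
  simpa [setCol] using h1

end

section

variable {ι : Type} [Fintype ι]

/-- Add a camera to a family. -/
def extFam (p : Fam ι) (q : Fin 3 → V4) : Fam (Option ι) := fun o => o.elim q p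

lemma grad_extFam (p : Fam ι) (q : Fin 3 → V4) (y : V4) :
    grad (extFam p q) y = gradOne q y + grad p y := by
  simp [grad, Fintype.sum_option, extFam]

lemma critMap_extFam {p : Fam ι} {q : Fin 3 → V4} {F : Finset (Fin 4)} (i0 : ι)
    (hq : ∀ r, ∀ k ∉ F, q r k = 0) (y : V4) :
    critMap (some i0) F (extFam p q, y) = critMap i0 F (p, y) + gradOne q y := by
  funext k
  by_cases hk : k ∈ F
  · simp only [critMap, hk, if_true, Pi.add_apply, grad_extFam]
    simp only [extFam, Option.elim]
    ring
  · simp [critMap, hk, gradOne, Fin.sum_univ_three, hq _ k hk]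

/-- The camera with scaled coordinate forms. -/
def camAt (c : Fin 3 → Fin 4) (w : ℂ) : Fin 3 → V4 :=
  ![Pi.single (c 0) 1, w • Pi.single (c 1) 1, Pi.single (c 2) 1]

lemma camAt_one (c : Fin 3 → Fin 4) (r : Fin 3) : camAt c 1 r = Pi.single (c r) 1 := by
  fin_cases r <;> simp [camAt]

/-- A scaling of the coordinates in `Z` by the `m`-th power of a parameter, with the exponents `b`
of the terms of the gradient of a new camera. -/
structure Scaling (c : Fin 3 → Fin 4) (F : Finset (Fin 4)) where
  Z : Finset (Fin 4)
  m : ℕ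
  b : Fin 3 → ℕ
  hm : m ≠ 0
  hZ : Z ⊆ F
  hb : ∀ r, b r = 0 ↔ c r ∈ Z
  h0 : b 0 + 3 * (if c 0 ∈ Z then m else 0) =
    6 + (if c 1 ∈ Z then m else 0) + (if c 2 ∈ Z then m else 0)
  h1 : b 1 + 2 * (if c 0 ∈ Z then m else 0) = 6 + (if c 2 ∈ Z then m else 0)
  h2 : b 2 + 2 * (if c 0 ∈ Z then m else 0) = 6 + (if c 1 ∈ Z then m else 0)

variable {c : Fin 3 → Fin 4} {F : Finset (Fin 4)}

namespace Scaling

def act (s : Scaling c F) (τ : ℂ) (x : V4) : V4 := fun k => τ ^ (if k ∈ s.Z then s.m else 0) * x k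

lemma act_zero (s : Scaling c F) (x : V4) (k : Fin 4) :
    s.act 0 x k = if k ∈ s.Z then 0 else x k := by
  by_cases h : k ∈ s.Z <;> simp [act, h, s.hm]

lemma act_add_smul (s : Scaling c F) (τ : ℂ) (x δ : V4) (t : ℂ) :
    s.act τ (x + t • δ) = s.act τ x + t • s.act τ δ := by
  funext k; simp only [act, Pi.add_apply, Pi.smul_apply, smul_eq_mul]; ring

/-- The gradient of the new camera in scaled coordinates. -/
def term (s : Scaling c F) (τ : ℂ) (x : V4) : V4 :=
  ∑ r, (τ ^ s.b r * coef (camAt c 1) x r) • camAt c 1 r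

def dterm (s : Scaling c F) (τ : ℂ) (x δ : V4) : V4 :=
  ∑ r, (τ ^ s.b r * dcoef (camAt c 1) x δ r) • camAt c 1 r

lemma term_eq (s : Scaling c F) {τ : ℂ} (hτ : τ ≠ 0) (x : V4) :
    s.term τ x = gradOne (camAt c (τ ^ 6)) (s.act τ x) := by
  have h0 := congrArg (fun n => τ ^ n) s.h0
  have h1 := congrArg (fun n => τ ^ n) s.h1
  have h2 := congrArg (fun n => τ ^ n) s.h2
  simp only [pow_add, pow_mul'] at h0 h1 h2
  by_cases hx : x (c 0) = 0
  · funext k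
    simp [term, gradOne, coef, Fin.sum_univ_three, camAt, act, hx]
  have ht : τ ^ (if c 0 ∈ s.Z then s.m else 0) ≠ 0 := pow_ne_zero _ hτ
  simp only [term, gradOne, Fin.sum_univ_three]
  congr 1
  congr 1
  · simp only [coef, camAt, Matrix.cons_val, smul_dotProduct, single_dotProduct, act,
      smul_eq_mul, one_mul]
    congr 1
    field_simp
    linear_combination (-x (c 1) * x (c 2)) * h0
  · simp only [smul_smul, coef, camAt, Matrix.cons_val, smul_dotProduct, single_dotProduct, act,
      smul_eq_mul, one_mul]
    congr 1
    field_simp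
    linear_combination (x (c 2)) * h1
  · simp only [coef, camAt, Matrix.cons_val, smul_dotProduct, single_dotProduct, act,
      smul_eq_mul, one_mul]
    congr 1
    field_simp
    linear_combination (x (c 1)) * h2

/-- The system for critical points in scaled coordinates. -/
def sys (s : Scaling c F) (i0 : ι) (p : Fam ι) (z : ℂ × V4) : V4 :=
  critMap i0 F (p, s.act z.1 z.2) + s.term z.1 z.2

lemma sys_eq (s : Scaling c F) (hc : ∀ r, c r ∈ F) (i0 : ι) (p : Fam ι) {τ : ℂ} (hτ : τ ≠ 0)
    (x : V4) : s.sys i0 p (τ, x) =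
      critMap (some i0) F (extFam p (camAt c (τ ^ 6)), s.act τ x) := by
  rw [critMap_extFam, sys, s.term_eq hτ]
  intro r k hk
  have : ∀ r, k ≠ c r := fun r h => hk (h ▸ hc r)
  fin_cases r <;> simp [camAt, this]

lemma partialInj_of_sys (s : Scaling c F) (hc : ∀ r, c r ∈ F) {i0 : ι} {p : Fam ι} {τ : ℂ}
    (hτ : τ ≠ 0) {x : V4} (h : PartialInj (s.sys i0 p) (τ, x)) :
    PartialInj (critMap (some i0) F) (extFam p (camAt c (τ ^ 6)), s.act τ x) := by
  intro δ hδ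
  let δ' : V4 := fun k => δ k / τ ^ (if k ∈ s.Z then s.m else 0)
  have h1 : s.act τ δ' = δ := by
    funext k
    simp only [act, δ']
    field_simp
  have h2 := h δ' (by
    refine hδ.congr_of_eventuallyEq (Eventually.of_forall fun t => ?_)
    simp only [s.sys_eq hc i0 p hτ, s.act_add_smul, h1])
  rw [← h1, h2]
  funext k
  simp [act]

lemma contDiffAt_sys (s : Scaling c F) (i0 : ι) {p : Fam ι} {z : ℂ × V4}
    (h : ∀ i, p i 0 ⬝ᵥ s.act z.1 z.2 ≠ 0) (hx : z.2 (c 0) ≠ 0) :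
    ContDiffAt ℂ 1 (s.sys i0 p) z := by
  have ha : ContDiffAt ℂ 1 (fun z : ℂ × V4 => s.act z.1 z.2) z := by
    unfold act
    fun_prop
  refine (contDiffAt_critMap i0 F contDiffAt_const ha h).add ?_
  have hco := contDiffAt_coef (q := fun _ : ℂ × V4 => camAt c 1) (y := fun z => z.2) (x := z)
    contDiffAt_const contDiffAt_snd (by simpa [camAt] using hx)
  refine ContDiffAt.sum fun r _ => ?_
  exact ((contDiffAt_fst.pow _).mul (contDiffAt_pi.1 hco r)).smul contDiffAt_const

lemma hasDerivAt_term (s : Scaling c F) (τ : ℂ) (x δ : V4) (hx : x (c 0) ≠ 0) :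
    HasDerivAt (fun t : ℂ => s.term τ (x + t • δ)) (s.dterm τ x δ) 0 := by
  have := hasDerivAt_pi.1 (hasDerivAt_coef (camAt c 1) x δ (by simpa [camAt] using hx))
  exact HasDerivAt.fun_sum fun r _ => ((this r).const_mul _).smul_const _

lemma term_zero_apply (s : Scaling c F) (x : V4) {k : Fin 4} (hk : k ∉ s.Z) :
    s.term 0 x k = 0 := by
  simp only [term, Finset.sum_apply]
  refine Finset.sum_eq_zero fun r _ => ?_
  by_cases h : c r ∈ s.Z
  · have : k ≠ c r := fun h' => hk (h' ▸ h)
    simp [camAt_one, this]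
  · have : s.b r ≠ 0 := fun h' => h ((s.hb r).1 h')
    simp [this]

lemma dterm_zero_apply (s : Scaling c F) (x δ : V4) {k : Fin 4} (hk : k ∉ s.Z) :
    s.dterm 0 x δ k = 0 := by
  simp only [dterm, Finset.sum_apply]
  refine Finset.sum_eq_zero fun r _ => ?_
  by_cases h : c r ∈ s.Z
  · have : k ≠ c r := fun h' => hk (h' ▸ h)
    simp [camAt_one, this]
  · have : s.b r ≠ 0 := fun h' => h ((s.hb r).1 h')
    simp [this]

/-- The solutions of the limiting system. -/
def target (s : Scaling c F) (i0 : ι) (p : Fam ι) : Set V4 :=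
  {x | s.act 0 x ∈ critSet i0 (F \ s.Z) p ∧ x (c 0) ≠ 0 ∧
    ∀ k ∈ s.Z, grad p (s.act 0 x) k + s.term 0 x k = 0}

lemma sys_zero_iff (s : Scaling c F) {i0 : ι} {p : Fam ι} {x : V4} (hx : x (c 0) ≠ 0)
    (h : ∀ i, p i 0 ⬝ᵥ s.act 0 x ≠ 0) : s.sys i0 p (0, x) = 0 ↔ x ∈ s.target i0 p := by
  have key : critMap i0 (F \ s.Z) (p, s.act 0 x) = 0 ↔ ∀ k ∉ s.Z, s.sys i0 p (0, x) k = 0 := by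
    constructor
    · intro h0 k hk
      have := congrFun h0 k
      simp only [sys, Pi.add_apply, s.term_zero_apply x hk, add_zero]
      simpa [critMap, hk] using this
    · intro h0
      funext k
      by_cases hk : k ∈ s.Z
      · simp [critMap, hk, s.act_zero]
      · have := h0 k hk
        simp only [sys, Pi.add_apply, s.term_zero_apply x hk, add_zero] at this
        simpa [critMap, hk] using this
  constructor
  · intro h0
    have hc := (critMap_eq_zero i0 _ p _ h).1 (key.2 fun k _ => by rw [h0]; rfl)
    refine ⟨hc, hx, fun k hk => ?_⟩
    have := congrFun h0 k
    simpa [sys, critMap, s.hZ hk, hc.2.2.2] using this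
  · rintro ⟨h1, -, h3⟩
    funext k
    by_cases hk : k ∈ s.Z
    · simpa [sys, critMap, s.hZ hk, h1.2.2.2] using h3 k hk
    · exact key.1 ((critMap_eq_zero i0 _ p _ h).2 h1) k hk

lemma partialInj_sys (s : Scaling c F) {i0 : ι} {p : Fam ι} {x : V4} (hx : x ∈ s.target i0 p)
    (hn : Nondeg i0 (F \ s.Z) p (s.act 0 x))
    (hd : ∀ δ : V4, (∀ k ∉ s.Z, δ k = 0) → (∀ k ∈ s.Z, s.dterm 0 x δ k = 0) → δ = 0) :
    PartialInj (s.sys i0 p) (0, x) := by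
  intro δ h0
  have h1 : HasDerivAt (fun t : ℂ => s.sys i0 p (0, x + t • δ))
      ((fun k => if k ∈ F then hess p (s.act 0 x) (s.act 0 δ) k +
        (p i0 0 ⬝ᵥ s.act 0 δ) * p i0 0 k else s.act 0 δ k) + s.dterm 0 x δ) 0 := by
    simp only [sys, s.act_add_smul]
    exact (hasDerivAt_critMap i0 F p _ _ hx.1.2.1).add (s.hasDerivAt_term 0 x δ hx.2.1)
  have h2 := h0.unique h1
  have h3 : s.act 0 δ = 0 := by
    obtain ⟨ha, hb, hc⟩ := (dcrit_eq_zero (δ := s.act 0 δ) hx.1).1 (by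
      funext k
      by_cases hk : k ∈ s.Z
      · simp [hk, s.act_zero]
      · have := congrFun h2 k
        simp only [Pi.add_apply, s.dterm_zero_apply x δ hk, add_zero] at this
        simpa [hk] using this.symm)
    exact hn _ ha hb hc
  refine hd δ (fun k hk => ?_) fun k hk => ?_
  · have := congrFun h3 k
    simpa [s.act_zero, hk] using this
  · have := congrFun h2 k
    rw [h3] at this
    simpa [s.hZ hk, hess, hessOne, dcoef, Fin.sum_univ_three] using this.symm

end Scaling

end

section

variable {ι : Type} [Fintype ι]

lemma finite_roots {m : ℕ} (hm : m ≠ 0) {κ : ℂ} (hκ : κ ≠ 0) :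
    {z : ℂ | z ^ m = κ}.Finite ∧ {z : ℂ | z ^ m = κ}.ncard = m := by
  classical
  obtain ⟨a, ha⟩ := IsAlgClosed.exists_pow_nat_eq κ (Nat.pos_of_ne_zero hm)
  have hζ := Complex.isPrimitiveRoot_exp m hm
  have he : {z : ℂ | z ^ m = κ} = ((Polynomial.nthRoots m κ).toFinset : Set ℂ) := by
    ext z
    simp [Polynomial.mem_nthRoots (Nat.pos_of_ne_zero hm)]
  refine ⟨by rw [he]; exact Finset.finite_toSet _, ?_⟩
  rw [he, Set.ncard_coe_finset, Multiset.toFinset_card_of_nodup (hζ.nthRoots_nodup hκ),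
    hζ.card_nthRoots, if_pos ⟨a, ha⟩]

lemma ncard_of_fibres {E : Type*} {S T : Set E} (hS : S.Finite) {m : ℕ} (hm : m ≠ 0)
    (κ : E → ℂ) (f : E → E) (e : E → ℂ) (g : E → ℂ → E) (hκ : ∀ y ∈ S, κ y ≠ 0)
    (h1 : ∀ x ∈ T, f x ∈ S ∧ e x ^ m = κ (f x) ∧ g (f x) (e x) = x)
    (h2 : ∀ y ∈ S, ∀ z, z ^ m = κ y → g y z ∈ T ∧ f (g y z) = y ∧ e (g y z) = z) :
    T.Finite ∧ T.ncard = m * S.ncard := by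
  classical
  have hr : ∀ y : E, y ∈ S → {z : ℂ | z ^ m = κ y}.Finite := fun y hy => (finite_roots hm (hκ y hy)).1
  let A : Finset E := hS.toFinset
  let B : E → Finset ℂ := fun y => if h : y ∈ S then (hr y h).toFinset else ∅
  have hB : ∀ y ∈ S, ∀ z, z ∈ B y ↔ z ^ m = κ y := fun y hy z => by simp [B, hy]
  let D := A.sigma B
  have hT : T = ((D.image fun w => g w.1 w.2 : Finset E) : Set E) := by
    ext x
    simp only [Finset.coe_image, Set.mem_image, Finset.mem_coe, D, Finset.mem_sigma, A,
      Set.Finite.mem_toFinset]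
    constructor
    · intro hx
      obtain ⟨a, b, c⟩ := h1 x hx
      exact ⟨⟨f x, e x⟩, ⟨a, (hB _ a _).2 b⟩, c⟩
    · rintro ⟨⟨y, z⟩, ⟨hy, hz⟩, rfl⟩
      exact (h2 y hy z ((hB y hy z).1 hz)).1
  refine ⟨by rw [hT]; exact Finset.finite_toSet _, ?_⟩
  rw [hT, Set.ncard_coe_finset, Finset.card_image_of_injOn, Finset.card_sigma,
    Finset.sum_const_nat (m := m), mul_comm, Set.ncard_eq_toFinset_card S hS]
  · intro y hy
    have hy' : y ∈ S := by simpa [A] using hy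
    have := (finite_roots hm (hκ y hy')).2
    rw [Set.ncard_eq_toFinset_card _ (hr y hy')] at this
    simpa [B, hy'] using this
  · rintro ⟨y, z⟩ h ⟨y', z'⟩ h' heq
    simp only [Finset.mem_coe, D, Finset.mem_sigma, A, Set.Finite.mem_toFinset] at h h'
    obtain ⟨-, a, b⟩ := h2 y h.1 z ((hB y h.1 z).1 h.2)
    obtain ⟨-, a', b'⟩ := h2 y' h'.1 z' ((hB y' h'.1 z').1 h'.2)
    dsimp only at heq
    have e1 : y = y' := by rw [← a, ← a', heq]
    have e2 : z = z' := by rw [← b, ← b', heq]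
    subst e1 e2
    rfl

lemma coef_camAt_zero (c : Fin 3 → Fin 4) (x : V4) :
    coef (camAt c 1) x 0 = -2 * x (c 1) * x (c 2) / x (c 0) ^ 3 := by
  simp [coef, camAt]

lemma coef_camAt (c : Fin 3 → Fin 4) (x : V4) {j : Fin 3} (hj : j ≠ 0) :
    coef (camAt c 1) x j = x (c (-j)) / x (c 0) ^ 2 := by
  fin_cases j
  · exact absurd rfl hj
  · simp [coef, camAt]; rfl
  · simp [coef, camAt]; rfl

lemma mul_camAt (c : Fin 3 → Fin 4) (x y : V4) {j : Fin 3} (hj : j ≠ 0) :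
    x (c 1) * y (c 2) + y (c 1) * x (c 2) = x (c j) * y (c (-j)) + y (c j) * x (c (-j)) := by
  fin_cases j
  · exact absurd rfl hj
  · rfl
  · show _ = x (c 2) * y (c 1) + y (c 2) * x (c 1); ring

lemma dcoef_camAt_zero (c : Fin 3 → Fin 4) (x δ : V4) :
    dcoef (camAt c 1) x δ 0 = -2 * (δ (c 1) * x (c 2) + x (c 1) * δ (c 2)) / x (c 0) ^ 3 +
      6 * x (c 1) * x (c 2) * δ (c 0) / x (c 0) ^ 4 := by
  simp [dcoef, camAt]

lemma dcoef_camAt (c : Fin 3 → Fin 4) (x δ : V4) {j : Fin 3} (hj : j ≠ 0) :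
    dcoef (camAt c 1) x δ j =
      δ (c (-j)) / x (c 0) ^ 2 - 2 * x (c (-j)) * δ (c 0) / x (c 0) ^ 3 := by
  fin_cases j
  · exact absurd rfl hj
  · simp [dcoef, camAt]; rfl
  · simp [dcoef, camAt]; rfl

variable {c : Fin 3 → Fin 4} {F : Finset (Fin 4)}

namespace Scaling

lemma term_apply (s : Scaling c F) (τ : ℂ) (x : V4) {j : Fin 3} (hc : ∀ r, r ≠ j → c r ≠ c j) :
    s.term τ x (c j) = τ ^ s.b j * coef (camAt c 1) x j := by
  simp only [term, Finset.sum_apply]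
  rw [Finset.sum_eq_single j]
  · simp [camAt_one]
  · intro r _ hr
    simp [camAt_one, (hc r hr).symm]
  · simp

lemma dterm_apply (s : Scaling c F) (τ : ℂ) (x δ : V4) {j : Fin 3} (hc : ∀ r, r ≠ j → c r ≠ c j) :
    s.dterm τ x δ (c j) = τ ^ s.b j * dcoef (camAt c 1) x δ j := by
  simp only [dterm, Finset.sum_apply]
  rw [Finset.sum_eq_single j]
  · simp [camAt_one]
  · intro r _ hr
    simp [camAt_one, (hc r hr).symm]
  · simp

/-- The trivial scaling. -/
def triv (c : Fin 3 → Fin 4) (F : Finset (Fin 4)) : Scaling c F where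
  Z := ∅
  m := 1
  b := fun _ => 6
  hm := by simp
  hZ := by simp
  hb := by simp
  h0 := by simp
  h1 := by simp
  h2 := by simp

/-- The scaling of one coordinate. -/
def single (hF : c 0 ∈ F) (hc : ∀ r, r ≠ 0 → c r ≠ c 0) : Scaling c F where
  Z := {c 0}
  m := 2
  b := ![0, 2, 2]
  hm := by simp
  hZ := by simpa using hF
  hb := by
    intro r
    by_cases h : r = 0
    · simp [h]
    · have := hc r h
      fin_cases r <;> simp_all
  h0 := by simp [hc]
  h1 := by simp [hc]
  h2 := by simp [hc]

/-- The scaling of two coordinates. -/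
def pair (hF : ∀ r, c r ∈ F) (hc : Function.Injective c) {j : Fin 3} (hj : j ≠ 0) :
    Scaling c F where
  Z := {c 0, c j}
  m := 3
  b := fun r => if r = -j then 3 else 0
  hm := by simp
  hZ := by
    intro k hk
    simp only [Finset.mem_insert, Finset.mem_singleton] at hk
    rcases hk with rfl | rfl <;> exact hF _
  hb := by
    intro r
    simp only [Finset.mem_insert, Finset.mem_singleton, hc.eq_iff]
    fin_cases j <;> fin_cases r <;> simp_all <;> decide
  h0 := by
    simp only [Finset.mem_insert, Finset.mem_singleton, hc.eq_iff]
    fin_cases j <;> simp_all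
  h1 := by
    simp only [Finset.mem_insert, Finset.mem_singleton, hc.eq_iff]
    fin_cases j <;> simp_all <;> decide
  h2 := by
    simp only [Finset.mem_insert, Finset.mem_singleton, hc.eq_iff]
    fin_cases j <;> simp_all <;> decide

/-- The scaling of three coordinates. -/
def full (hF : ∀ r, c r ∈ F) : Scaling c F where
  Z := Finset.univ.image c
  m := 6
  b := fun _ => 0
  hm := by simp
  hZ := by
    intro k hk
    obtain ⟨r, -, rfl⟩ := Finset.mem_image.1 hk
    exact hF r
  hb := by simp
  h0 := by simp
  h1 := by simp
  h2 := by simp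

end Scaling

/-- The gradient has no further zero coordinates at critical points off a given coordinate. -/
def GradNe (i0 : ι) (F : Finset (Fin 4)) (a : Fin 4) (p : Fam ι) : Prop :=
  ∀ F' ⊆ F, a ∉ F' → ∀ y ∈ critSet i0 F' p, ∀ x ∉ F', grad p y x ≠ 0

lemma GradNe.apply_ne_zero {i0 : ι} {a : Fin 4} {p : Fam ι} (h : GradNe i0 F a p)
    {F' : Finset (Fin 4)} (hF : F' ⊆ F) (ha : a ∉ F') {y : V4} (hy : y ∈ critSet i0 F' p)
    {k : Fin 4} (hk : k ∈ F') : y k ≠ 0 := by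
  intro h0
  refine h (F'.erase k) ((Finset.erase_subset _ _).trans hF)
    (fun h' => ha (Finset.mem_of_mem_erase h')) y ⟨fun l hl => ?_, hy.2.1, fun l hl =>
      hy.2.2.1 l (Finset.mem_of_mem_erase hl), hy.2.2.2⟩ k (Finset.notMem_erase _ _)
      (hy.2.2.1 k hk)
  by_cases hlk : l = k
  · rw [hlk, h0]
  · exact hy.1 l fun h' => hl (Finset.mem_erase.2 ⟨hlk, h'⟩)

end

section

variable {ι : Type} [Fintype ι] {c : Fin 3 → Fin 4} {F : Finset (Fin 4)} {i0 : ι} {p : Fam ι}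

lemma GradNe.fst_ne_zero {a : Fin 4} (h : GradNe i0 F a p) {y : V4} (hy : y ∈ critSet i0 F p)
    (ha : a ∈ F) : y a ≠ 0 := by
  intro h0
  refine h (F.erase a) (Finset.erase_subset _ _) (Finset.notMem_erase _ _) y
    ⟨fun l hl => ?_, hy.2.1, fun l hl => hy.2.2.1 l (Finset.mem_of_mem_erase hl), hy.2.2.2⟩ a
    (Finset.notMem_erase _ _) (hy.2.2.1 a ha)
  by_cases hlk : l = a
  · rw [hlk, h0]
  · exact hy.1 l fun h' => hl (Finset.mem_erase.2 ⟨hlk, h'⟩)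

lemma neg_fin_three : ∀ j : Fin 3, j ≠ 0 → -j ≠ 0 ∧ -j ≠ j := by decide

namespace Scaling

lemma target_triv (hF : c 0 ∈ F) (hg : GradNe i0 F (c 0) p) :
    (triv c F).target i0 p = critSet i0 F p := by
  have : ∀ x, (triv c F).act 0 x = x := fun x => by
    funext k; simp [act_zero, triv]
  ext x
  simp only [target, this, Set.mem_ofPred_eq]
  have hz : (triv c F).Z = ∅ := rfl
  simp only [hz, Finset.sdiff_empty]
  refine ⟨fun h => h.1, fun h => ⟨h, hg.fst_ne_zero h hF, by simp⟩⟩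

lemma card_target_single (hF : ∀ r, c r ∈ F) (hc : ∀ r, r ≠ 0 → c r ≠ c 0)
    (hg : GradNe i0 F (c 0) p) (hS : (critSet i0 (F \ {c 0}) p).Finite) :
    ((single (hF 0) hc).target i0 p).Finite ∧
      ((single (hF 0) hc).target i0 p).ncard = 3 * (critSet i0 (F \ {c 0}) p).ncard := by
  have hZ : (single (hF 0) hc).Z = {c 0} := rfl
  have ht : ∀ x, (single (hF 0) hc).term 0 x (c 0) = -2 * x (c 1) * x (c 2) / x (c 0) ^ 3 := by
    intro x
    rw [term_apply _ _ _ hc, coef_camAt_zero]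
    simp [single]
  have hy : ∀ y ∈ critSet i0 (F \ {c 0}) p, y (c 1) ≠ 0 ∧ y (c 2) ≠ 0 ∧ grad p y (c 0) ≠ 0 := by
    intro y hy
    refine ⟨hg.apply_ne_zero Finset.sdiff_subset (by simp) hy (by simp [hF, hc]),
      hg.apply_ne_zero Finset.sdiff_subset (by simp) hy (by simp [hF, hc]),
      hg _ Finset.sdiff_subset (by simp) y hy _ (by simp)⟩
  refine ncard_of_fibres hS three_ne_zero (fun y => 2 * y (c 1) * y (c 2) / grad p y (c 0))
    ((single (hF 0) hc).act 0) (fun x => x (c 0)) (fun y z => Function.update y (c 0) z)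
    ?_ ?_ ?_
  · intro y h
    obtain ⟨a, b, d⟩ := hy y h
    exact div_ne_zero (mul_ne_zero (mul_ne_zero two_ne_zero a) b) d
  · rintro x ⟨h1, h2, h3⟩
    rw [hZ] at h1 h3
    have h4 := h3 (c 0) (by simp)
    obtain ⟨a, b, d⟩ := hy _ h1
    rw [ht] at h4
    refine ⟨h1, ?_, ?_⟩
    · simp only [act_zero, hZ, Finset.mem_singleton, hc 1 (by simp), hc 2 (by simp), if_false]
      field_simp at h4 ⊢
      linear_combination h4
    · funext k
      by_cases hk : k = c 0
      · subst hk; simp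
      · simp [hk, act_zero, hZ]
  · intro y h z hz
    obtain ⟨a, b, d⟩ := hy y h
    have hz0 : z ≠ 0 := by
      rintro rfl
      have : (2:ℂ) * y (c 1) * y (c 2) / grad p y (c 0) ≠ 0 :=
        div_ne_zero (mul_ne_zero (mul_ne_zero two_ne_zero a) b) d
      exact this (by rw [← hz]; simp)
    have e : (single (hF 0) hc).act 0 (Function.update y (c 0) z) = y := by
      funext k
      by_cases hk : k = c 0
      · subst hk; simpa [act_zero, hZ] using (h.1 (c 0) (by simp)).symm
      · simp [hk, act_zero, hZ]
    refine ⟨⟨by rwa [e], by simpa using hz0, fun k hk => ?_⟩, e, by simp⟩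
    rw [hZ, Finset.mem_singleton] at hk
    subst hk
    rw [e, ht]
    simp only [Function.update_self, ne_eq, hc 1 (by simp), hc 2 (by simp), not_false_eq_true,
      Function.update_of_ne]
    rw [hz]
    field_simp
    ring

lemma dterm_single (hF : ∀ r, c r ∈ F) (hc : ∀ r, r ≠ 0 → c r ≠ c 0)
    (hg : GradNe i0 F (c 0) p) {x : V4} (hx : x ∈ (single (hF 0) hc).target i0 p)
    (δ : V4) (h1 : ∀ k ∉ (single (hF 0) hc).Z, δ k = 0)
    (h2 : ∀ k ∈ (single (hF 0) hc).Z, (single (hF 0) hc).dterm 0 x δ k = 0) : δ = 0 := by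
  have hZ : (single (hF 0) hc).Z = {c 0} := rfl
  have a : x (c 1) ≠ 0 := by
    have := hg.apply_ne_zero Finset.sdiff_subset (by simp [hZ]) hx.1 (k := c 1) (by simp [hF, hc, hZ])
    simpa [act_zero, hZ, hc] using this
  have b : x (c 2) ≠ 0 := by
    have := hg.apply_ne_zero Finset.sdiff_subset (by simp [hZ]) hx.1 (k := c 2) (by simp [hF, hc, hZ])
    simpa [act_zero, hZ, hc] using this
  have h3 := h2 (c 0) (by simp [hZ])
  rw [dterm_apply _ _ _ _ hc, dcoef_camAt_zero, h1 (c 1) (by simp [hZ, hc]),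
    h1 (c 2) (by simp [hZ, hc])] at h3
  have hx0 := hx.2.1
  have : δ (c 0) = 0 := by
    simpa [single, a, b, hx0] using h3
  funext k
  by_cases hk : k = c 0
  · rw [hk, this]; rfl
  · exact h1 k (by simpa [hZ] using hk)

lemma card_target_pair (hF : ∀ r, c r ∈ F) (hc : Function.Injective c) {j : Fin 3} (hj : j ≠ 0)
    (hg : GradNe i0 F (c 0) p) (hS : (critSet i0 (F \ {c 0, c j}) p).Finite) :
    ((pair hF hc hj).target i0 p).Finite ∧
      ((pair hF hc hj).target i0 p).ncard = 2 * (critSet i0 (F \ {c 0, c j}) p).ncard := by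
  have hZ : (pair hF hc hj).Z = {c 0, c j} := rfl
  have hn : -j ≠ 0 ∧ -j ≠ j := neg_fin_three j hj
  have hj0 : -(-j) = j := neg_neg j
  have hcj : c (-j) ≠ c 0 ∧ c (-j) ≠ c j ∧ c j ≠ c 0 :=
    ⟨hc.ne hn.1, hc.ne hn.2, hc.ne hj⟩
  obtain ⟨hc1, hc2, hc3⟩ := hcj
  have ht : ∀ x, (pair hF hc hj).term 0 x (c 0) = -2 * (x (c j) * x (c (-j))) / x (c 0) ^ 3 := by
    intro x
    rw [term_apply _ _ _ fun r hr => hc.ne hr, coef_camAt_zero]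
    have := mul_camAt c x x hj
    simp only [pair, hn.1.symm, if_false, pow_zero, one_mul]
    congr 1
    linear_combination -this
  have ht' : ∀ x, (pair hF hc hj).term 0 x (c j) = x (c (-j)) / x (c 0) ^ 2 := by
    intro x
    rw [term_apply _ _ _ fun r hr => hc.ne hr, coef_camAt _ _ hj]
    simp only [pair, hn.2.symm, if_false, pow_zero, one_mul]
  have hy : ∀ y ∈ critSet i0 (F \ {c 0, c j}) p,
      y (c (-j)) ≠ 0 ∧ grad p y (c 0) ≠ 0 ∧ grad p y (c j) ≠ 0 := by
    intro y hy
    refine ⟨hg.apply_ne_zero Finset.sdiff_subset (by simp) hy (by simp [hF, hc1, hc2]),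
      hg _ Finset.sdiff_subset (by simp) y hy _ (by simp),
      hg _ Finset.sdiff_subset (by simp) y hy _ (by simp)⟩
  refine ncard_of_fibres hS two_ne_zero (fun y => - y (c (-j)) / grad p y (c j))
    ((pair hF hc hj).act 0) (fun x => x (c 0))
    (fun y z => Function.update (Function.update y (c 0) z) (c j)
      (grad p y (c 0) * z ^ 3 / (2 * y (c (-j))))) ?_ ?_ ?_
  · intro y h
    obtain ⟨a, b, d⟩ := hy y h
    exact div_ne_zero (neg_ne_zero.2 a) d
  · rintro x ⟨h1, h2, h3⟩
    rw [hZ] at h1 h3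
    have h4 := h3 (c 0) (by simp)
    have h5 := h3 (c j) (by simp)
    obtain ⟨a, b, d⟩ := hy _ h1
    rw [ht] at h4
    rw [ht'] at h5
    have e : (pair hF hc hj).act 0 x (c (-j)) = x (c (-j)) := by simp [act_zero, hZ, hc1, hc2]
    rw [e] at a ⊢
    refine ⟨h1, ?_, ?_⟩
    · field_simp at h5 ⊢
      linear_combination h5
    · funext k
      by_cases hk : k = c j
      · subst hk
        simp only [Function.update_self]
        field_simp at h4 ⊢
        linear_combination h4
      by_cases hk0 : k = c 0
      · subst hk0; simp [hk]
      · simp [hk, hk0, act_zero, hZ]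
  · intro y h z hz
    obtain ⟨a, b, d⟩ := hy y h
    have hz0 : z ≠ 0 := by
      rintro rfl
      have : - y (c (-j)) / grad p y (c j) ≠ 0 := div_ne_zero (neg_ne_zero.2 a) d
      exact this (by rw [← hz]; simp)
    generalize hx : Function.update (Function.update y (c 0) z) (c j)
      (grad p y (c 0) * z ^ 3 / (2 * y (c (-j)))) = x
    have x0 : x (c 0) = z := by simp [← hx, hc3.symm]
    have xj : x (c j) = grad p y (c 0) * z ^ 3 / (2 * y (c (-j))) := by simp [← hx]
    have xk : ∀ k, k ≠ c 0 → k ≠ c j → x k = y k := fun k h1 h2 => by simp [← hx, h1, h2]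
    have e : (pair hF hc hj).act 0 x = y := by
      funext k
      rw [act_zero, hZ]
      by_cases hk : k ∈ ({c 0, c j} : Finset (Fin 4))
      · rw [if_pos hk, h.1 k fun h' => (Finset.mem_sdiff.1 h').2 hk]
      · rw [if_neg hk]
        simp only [Finset.mem_insert, Finset.mem_singleton, not_or] at hk
        exact xk k hk.1 hk.2
    refine ⟨⟨by rwa [e], by rwa [x0], fun k hk => ?_⟩, e, x0⟩
    simp only [hZ, Finset.mem_insert, Finset.mem_singleton] at hk
    have e1 := xk (c (-j)) hc1 hc2
    rcases hk with rfl | rfl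
    · rw [e, ht, x0, xj, e1]
      field_simp
      ring
    · rw [e, ht', x0, e1, hz]
      field_simp
      ring

lemma dterm_pair (hF : ∀ r, c r ∈ F) (hc : Function.Injective c) {j : Fin 3} (hj : j ≠ 0)
    (hg : GradNe i0 F (c 0) p) {x : V4} (hx : x ∈ (pair hF hc hj).target i0 p)
    (δ : V4) (h1 : ∀ k ∉ (pair hF hc hj).Z, δ k = 0)
    (h2 : ∀ k ∈ (pair hF hc hj).Z, (pair hF hc hj).dterm 0 x δ k = 0) : δ = 0 := by
  have hZ : (pair hF hc hj).Z = {c 0, c j} := rfl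
  have hn : -j ≠ 0 ∧ -j ≠ j := neg_fin_three j hj
  have hcj : c (-j) ≠ c 0 ∧ c (-j) ≠ c j ∧ c j ≠ c 0 :=
    ⟨hc.ne hn.1, hc.ne hn.2, hc.ne hj⟩
  obtain ⟨hc1, hc2, hc3⟩ := hcj
  have a : x (c (-j)) ≠ 0 := by
    have := hg.apply_ne_zero Finset.sdiff_subset (by simp [hZ]) hx.1 (k := c (-j))
      (by simp [hF, hc1, hc2, hZ])
    simpa [act_zero, hZ, hc1, hc2] using this
  have h3 := h2 (c 0) (by simp [hZ])
  have h4 := h2 (c j) (by simp [hZ])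
  have h5 : δ (c (-j)) = 0 := h1 _ (by simp [hZ, hc1, hc2])
  have hx0 := hx.2.1
  rw [dterm_apply _ _ _ _ fun r hr => hc.ne hr, dcoef_camAt _ _ _ hj, h5] at h4
  have h6 : δ (c 0) = 0 := by
    simpa [pair, hn.2.symm, a, hx0] using h4
  have hm := mul_camAt c δ x hj
  rw [dterm_apply _ _ _ _ fun r hr => hc.ne hr, dcoef_camAt_zero,
    mul_comm (x (c 1)) (δ (c 2)), h6] at h3
  rw [h5, mul_comm (x (c 1)) (δ (c 2))] at hm
  rw [mul_comm (δ (c 2)) (x (c 1)), mul_comm (x (c 1)), mul_comm (δ (c 2))] at h3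
  have h7 : δ (c j) = 0 := by
    have h8 : δ (c 1) * x (c 2) + x (c 1) * δ (c 2) = δ (c j) * x (c (-j)) := by
      linear_combination hm
    simp only [pair, hn.1.symm, if_false, pow_zero, one_mul, mul_zero, zero_div, add_zero,
      div_eq_zero_iff, pow_eq_zero_iff, ne_eq, OfNat.ofNat_ne_zero, not_false_eq_true, hx0,
      or_false, mul_eq_zero, neg_eq_zero, false_or] at h3
    have h9 : δ (c j) * x (c (-j)) = 0 := by rw [← h8, ← h3]
    simpa [a] using h9
  funext k
  by_cases hk : k ∈ (pair hF hc hj).Z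
  · simp only [hZ, Finset.mem_insert, Finset.mem_singleton] at hk
    rcases hk with rfl | rfl
    · exact h6
    · exact h7
  · exact h1 k hk

end Scaling

end

section

variable {ι : Type} [Fintype ι] {c : Fin 3 → Fin 4} {F : Finset (Fin 4)} {i0 : ι} {p : Fam ι}

namespace Scaling

lemma mem_full (hF : ∀ r, c r ∈ F) (k : Fin 4) :
    k ∈ (full hF).Z ↔ k = c 0 ∨ k = c 1 ∨ k = c 2 := by
  simp [full, Fin.exists_fin_succ, eq_comm]

lemma term_full (hF : ∀ r, c r ∈ F) (hc : Function.Injective c) (x : V4) :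
    (full hF).term 0 x (c 0) = -2 * x (c 1) * x (c 2) / x (c 0) ^ 3 ∧
    (full hF).term 0 x (c 1) = x (c 2) / x (c 0) ^ 2 ∧
    (full hF).term 0 x (c 2) = x (c 1) / x (c 0) ^ 2 := by
  have h := fun j => term_apply (full hF) 0 x (j := j) fun r hr => hc.ne hr
  refine ⟨?_, ?_, ?_⟩
  · rw [h, coef_camAt_zero]; simp [full]
  · rw [h, coef_camAt _ _ (by simp)]; simp [full]; rfl
  · rw [h, coef_camAt _ _ (by simp)]; simp [full]; rfl

lemma card_target_full (hF : ∀ r, c r ∈ F) (hc : Function.Injective c)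
    (hg : GradNe i0 F (c 0) p) (hS : (critSet i0 (F \ (full hF).Z) p).Finite) :
    ((full hF).target i0 p).Finite ∧
      ((full hF).target i0 p).ncard = (critSet i0 (F \ (full hF).Z) p).ncard := by
  have hy : ∀ y ∈ critSet i0 (F \ (full hF).Z) p, ∀ r, grad p y (c r) ≠ 0 := by
    intro y hy r
    exact hg _ Finset.sdiff_subset (by simp [mem_full]) y hy _ (by simp [full])
  have c10 : c 1 ≠ c 0 := hc.ne (by simp)
  have c20 : c 2 ≠ c 0 := hc.ne (by simp)
  have c21 : c 2 ≠ c 1 := hc.ne (by simp)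
  rw [← one_mul (critSet i0 (F \ (full hF).Z) p).ncard]
  refine ncard_of_fibres hS one_ne_zero
    (fun y => grad p y (c 0) / (2 * grad p y (c 1) * grad p y (c 2)))
    ((full hF).act 0) (fun x => x (c 0))
    (fun y z k => if k = c 0 then z else if k = c 1 then - grad p y (c 2) * z ^ 2 else
      if k = c 2 then - grad p y (c 1) * z ^ 2 else y k) ?_ ?_ ?_
  · intro y h
    exact div_ne_zero (hy y h 0) (mul_ne_zero (mul_ne_zero two_ne_zero (hy y h 1)) (hy y h 2))
  · rintro x ⟨h1, h2, h3⟩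
    obtain ⟨t0, t1, t2⟩ := term_full hF hc x
    have g := hy _ h1
    have e0 := h3 (c 0) (by simp [mem_full])
    have e1 := h3 (c 1) (by simp [mem_full])
    have e2 := h3 (c 2) (by simp [mem_full])
    rw [t0] at e0
    rw [t1] at e1
    rw [t2] at e2
    have g0 := g 0
    have g1 := g 1
    have g2 := g 2
    generalize grad p ((full hF).act 0 x) (c 0) = G0 at *
    generalize grad p ((full hF).act 0 x) (c 1) = G1 at *
    generalize grad p ((full hF).act 0 x) (c 2) = G2 at *
    have f2 : x (c 2) = -G1 * x (c 0) ^ 2 := by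
      field_simp at e1; linear_combination e1
    have f1 : x (c 1) = -G2 * x (c 0) ^ 2 := by
      field_simp at e2; linear_combination e2
    refine ⟨h1, ?_, ?_⟩
    · rw [f1, f2] at e0
      field_simp at e0 ⊢
      linear_combination -e0
    · funext k
      by_cases hk0 : k = c 0
      · simp [hk0]
      by_cases hk1 : k = c 1
      · simp [hk1, c10, f1]
      by_cases hk2 : k = c 2
      · simp [hk2, c20, c21, f2]
      simp [hk0, hk1, hk2, act_zero, mem_full]
  · intro y h z hz
    have g0 := hy y h 0
    have g1 := hy y h 1
    have g2 := hy y h 2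
    rw [pow_one] at hz
    have hz0 : z ≠ 0 := by
      rw [hz]; exact div_ne_zero g0 (mul_ne_zero (mul_ne_zero two_ne_zero g1) g2)
    generalize hx : (fun k => if k = c 0 then z else if k = c 1 then - grad p y (c 2) * z ^ 2 else
      if k = c 2 then - grad p y (c 1) * z ^ 2 else y k) = x
    have x0 : x (c 0) = z := by simp [← hx]
    have x1 : x (c 1) = - grad p y (c 2) * z ^ 2 := by simp [← hx, c10]
    have x2 : x (c 2) = - grad p y (c 1) * z ^ 2 := by simp [← hx, c20, c21]
    have e : (full hF).act 0 x = y := by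
      funext k
      rw [act_zero]
      by_cases hk : k ∈ (full hF).Z
      · rw [if_pos hk, h.1 k fun h' => (Finset.mem_sdiff.1 h').2 hk]
      · rw [if_neg hk]
        rw [mem_full] at hk
        simp only [not_or] at hk
        simp [← hx, hk]
    obtain ⟨t0, t1, t2⟩ := term_full hF hc x
    refine ⟨⟨by rwa [e], by rwa [x0], fun k hk => ?_⟩, e, x0⟩
    rw [mem_full] at hk
    rcases hk with rfl | rfl | rfl
    · rw [e, t0, x0, x1, x2]
      field_simp
      rw [hz]
      field_simp
      ring
    · rw [e, t1, x0, x2]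
      field_simp
      ring
    · rw [e, t2, x0, x1]
      field_simp
      ring

lemma dterm_full (hF : ∀ r, c r ∈ F) (hc : Function.Injective c)
    (hg : GradNe i0 F (c 0) p) {x : V4} (hx : x ∈ (full hF).target i0 p)
    (δ : V4) (h1 : ∀ k ∉ (full hF).Z, δ k = 0)
    (h2 : ∀ k ∈ (full hF).Z, (full hF).dterm 0 x δ k = 0) : δ = 0 := by
  obtain ⟨ha, hx0, h3⟩ := hx
  have g : ∀ r, grad p ((full hF).act 0 x) (c r) ≠ 0 := fun r =>
    hg _ Finset.sdiff_subset (by simp [mem_full]) _ ha _ (by simp [full])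
  obtain ⟨t0, t1, t2⟩ := term_full hF hc x
  have e1 := h3 (c 1) (by simp [mem_full])
  have e2 := h3 (c 2) (by simp [mem_full])
  rw [t1] at e1
  rw [t2] at e2
  have x2 : x (c 2) ≠ 0 := by
    intro h; rw [h] at e1; exact g 1 (by simpa using e1)
  have x1 : x (c 1) ≠ 0 := by
    intro h; rw [h] at e2; exact g 2 (by simpa using e2)
  have d := fun j => dterm_apply (full hF) 0 x δ (j := j) fun r hr => hc.ne hr
  have d0 := h2 (c 0) (by simp [mem_full])
  have d1 := h2 (c 1) (by simp [mem_full])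
  have d2 := h2 (c 2) (by simp [mem_full])
  rw [d, dcoef_camAt_zero] at d0
  rw [d, dcoef_camAt _ _ _ (by simp)] at d1 d2
  have n1 : (-1 : Fin 3) = 2 := rfl
  have n2 : (-2 : Fin 3) = 1 := rfl
  simp only [full, pow_zero, one_mul, n1, n2] at d0 d1 d2
  have f2 : δ (c 2) = 2 * x (c 2) * δ (c 0) / x (c 0) := by
    field_simp at d1 ⊢; linear_combination d1
  have f1 : δ (c 1) = 2 * x (c 1) * δ (c 0) / x (c 0) := by
    field_simp at d2 ⊢; linear_combination d2
  have f0 : δ (c 0) = 0 := by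
    rw [f1, f2] at d0
    field_simp at d0
    have : x (c 1) * x (c 2) * δ (c 0) = 0 := by linear_combination (-1/2) * d0
    simpa [x1, x2] using this
  rw [f0] at f1 f2
  funext k
  by_cases hk : k ∈ (full hF).Z
  · rw [mem_full] at hk
    rcases hk with rfl | rfl | rfl
    · exact f0
    · simp [f1]
    · simp [f2]
  · exact h1 k hk

end Scaling

end

section

variable {ι : Type} [Fintype ι] {c : Fin 3 → Fin 4} {F : Finset (Fin 4)} {i0 : ι} {p : Fam ι}

lemma Scaling.act_injective (s : Scaling c F) {τ : ℂ} (hτ : τ ≠ 0) :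
    Function.Injective (s.act τ) := by
  intro x y h
  funext k
  exact mul_left_cancel₀ (pow_ne_zero _ hτ) (congrFun h k)

lemma Scaling.exists_branch (s : Scaling c F) {x : V4} (h : PartialInj (s.sys i0 p) (0, x))
    (hx : x ∈ s.target i0 p) :
    ∃ φ : ℂ → V4, Tendsto φ (𝓝 0) (𝓝 x) ∧
      (∀ᶠ z in 𝓝 ((0, x) : ℂ × V4), s.sys i0 p z = 0 ↔ φ z.1 = z.2) ∧
      (∀ᶠ τ in 𝓝 (0:ℂ), s.sys i0 p (τ, φ τ) = 0) ∧
      ∀ᶠ z in 𝓝 ((0, x) : ℂ × V4), PartialInj (s.sys i0 p) z :=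
  PaperED.exists_branch (s.sys i0 p) 0 x (s.contDiffAt_sys i0 hx.1.2.1 hx.2.1)
    ((s.sys_zero_iff hx.2.1 hx.1.2.1).2 hx) h

lemma Scaling.tendsto_act (s : Scaling c F) {A : Type*} {l : Filter A} {f : A → ℂ} {x : A → V4}
    {f0 : ℂ} {x0 : V4} (hf : Tendsto f l (𝓝 f0)) (hx : Tendsto x l (𝓝 x0)) :
    Tendsto (fun a => s.act (f a) (x a)) l (𝓝 (s.act f0 x0)) :=
  tendsto_pi_nhds.2 fun k => (hf.pow _).mul (tendsto_pi_nhds.1 hx k)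

lemma extFam_dot_ne_zero {q : Fin 3 → V4} {y : V4} (h : ∀ i, p i 0 ⬝ᵥ y ≠ 0)
    (hq : q 0 ⬝ᵥ y ≠ 0) : ∀ i, extFam p q i 0 ⬝ᵥ y ≠ 0 := by
  rintro (_ | i)
  · exact hq
  · exact h i

/-- Critical points for a family extended by a camera with scaled coordinate forms are counted by
the solutions of the limiting systems. -/
lemma count_branches {κ : Type} [Fintype κ] (T : κ → Scaling c F) (hcF : ∀ r, c r ∈ F)
    (hfin : ∀ t, ((T t).target i0 p).Finite)
    (hinj : ∀ t, ∀ x ∈ (T t).target i0 p, PartialInj ((T t).sys i0 p) (0, x))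
    (hsep : ∀ t t', t ≠ t' → ∀ x ∈ (T t).target i0 p, ∀ x' ∈ (T t').target i0 p,
      (T t).act 0 x ≠ (T t').act 0 x')
    (hclass : ∀ U : Ultrafilter ℂ, ↑U ≤ 𝓝[≠] (0:ℂ) → ∀ y : ℂ → V4,
      (∀ᶠ τ in U, y τ ∈ critSet (some i0) F (extFam p (camAt c (τ ^ 6)))) →
      ∃ t, ∃ x : ℂ → V4, ∃ x0, (∀ᶠ τ in U, (T t).act τ (x τ) = y τ) ∧ Tendsto x U (𝓝 x0) ∧
        x0 (c 0) ≠ 0 ∧ ∀ i, p i 0 ⬝ᵥ (T t).act 0 x0 ≠ 0) :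
    ∀ᶠ τ in 𝓝[≠] (0:ℂ), (critSet (some i0) F (extFam p (camAt c (τ ^ 6)))).Finite ∧
      (critSet (some i0) F (extFam p (camAt c (τ ^ 6)))).ncard =
        ∑ t, ((T t).target i0 p).ncard ∧
      ∀ y ∈ critSet (some i0) F (extFam p (camAt c (τ ^ 6))),
        Nondeg (some i0) F (extFam p (camAt c (τ ^ 6))) y := by
  classical
  have hF' : ∀ t, Finite ((T t).target i0 p) := fun t => hfin t
  have hbr := fun j : Σ t, (T t).target i0 p => (T j.1).exists_branch (hinj j.1 _ j.2.2) j.2.2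
  choose φ hφ1 hφ2 hφ3 hφ4 using hbr
  have hpair : ∀ j, Tendsto (fun τ => (τ, φ j τ)) (𝓝 0) (𝓝 (0, (j.2 : V4))) :=
    fun j => tendsto_id.prodMk_nhds (hφ1 j)
  have hψ : ∀ j : Σ t, (T t).target i0 p,
      Tendsto (fun τ => (T j.1).act τ (φ j τ)) (𝓝 0) (𝓝 ((T j.1).act 0 (j.2 : V4))) :=
    fun j => by
      have := hφ1 j
      exact (T j.1).tendsto_act tendsto_id this
  have hne : ∀ᶠ τ in 𝓝[≠] (0:ℂ), τ ≠ 0 := eventually_mem_nhdsWithin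
  have hmem : ∀ j, ∀ᶠ τ in 𝓝[≠] (0:ℂ),
      (T j.1).act τ (φ j τ) ∈ critSet (some i0) F (extFam p (camAt c (τ ^ 6))) := by
    intro j
    have hlam : ∀ᶠ τ in 𝓝 (0:ℂ), ∀ i, p i 0 ⬝ᵥ (T j.1).act τ (φ j τ) ≠ 0 :=
      eventually_all.2 fun i => (tendsto_dot tendsto_const_nhds (hψ j)).eventually_ne (j.2.2.1.2.1 i)
    have h0 : ∀ᶠ τ in 𝓝 (0:ℂ), φ j τ (c 0) ≠ 0 :=
      (tendsto_pi_nhds.1 (hφ1 j) (c 0)).eventually_ne j.2.2.2.1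
    filter_upwards [hlam.filter_mono nhdsWithin_le_nhds, h0.filter_mono nhdsWithin_le_nhds,
      (hφ3 j).filter_mono nhdsWithin_le_nhds, hne] with τ a b d e
    refine (critMap_eq_zero (some i0) F _ _ (extFam_dot_ne_zero a ?_)).1 ?_
    · have hq : camAt c (τ ^ 6) 0 ⬝ᵥ (T j.1).act τ (φ j τ) = (T j.1).act τ (φ j τ) (c 0) := by
        simp [camAt]
      rw [hq]
      exact mul_ne_zero (pow_ne_zero _ e) b
    · rw [← (T j.1).sys_eq hcF i0 p e]
      exact d
  have hnd : ∀ᶠ τ in 𝓝[≠] (0:ℂ), ∀ j,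
      Nondeg (some i0) F (extFam p (camAt c (τ ^ 6))) ((T j.1).act τ (φ j τ)) := by
    refine eventually_all.2 fun j => ?_
    filter_upwards [((hpair j).eventually (hφ4 j)).filter_mono nhdsWithin_le_nhds, hmem j, hne]
      with τ a b e
    exact (partialInj_critMap b).1 ((T j.1).partialInj_of_sys hcF e a)
  have hfinal := eventually_eq_range (E := V4) (J := Σ t, (T t).target i0 p) (𝓝[≠] (0:ℂ))
    (fun τ => critSet (some i0) F (extFam p (camAt c (τ ^ 6))))
    (fun j τ => (T j.1).act τ (φ j τ)) hmem
  have := hfinal ?_ ?_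
  · filter_upwards [this, hnd] with τ ⟨a, b, d⟩ hp
    refine ⟨a, ?_, ?_⟩
    · rw [b, Nat.card_sigma]
      exact Finset.sum_congr rfl fun t _ => Nat.card_coe_set_eq _
    · rw [d]
      rintro _ ⟨j, rfl⟩
      exact hp j
  · rintro ⟨t, x, hx⟩ ⟨t', x', hx'⟩ hij
    by_cases htt : t = t'
    · subst htt
      have hxx : x ≠ x' := fun h => hij (by subst h; rfl)
      have := ((hφ1 ⟨t, x, hx⟩).sub (hφ1 ⟨t, x', hx'⟩)).eventually_ne (sub_ne_zero.2 hxx)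
      filter_upwards [this.filter_mono nhdsWithin_le_nhds, hne] with τ a e h
      exact sub_ne_zero.1 a ((T t).act_injective e h)
    · have := ((hψ ⟨t, x, hx⟩).sub (hψ ⟨t', x', hx'⟩)).eventually_ne
        (sub_ne_zero.2 (hsep t t' htt x hx x' hx'))
      filter_upwards [this.filter_mono nhdsWithin_le_nhds] with τ a
      exact sub_ne_zero.1 a
  · intro U hU y hy
    obtain ⟨t, x, x0, h1, h2, h3, h4⟩ := hclass U hU y hy
    have hpr : Tendsto (fun τ => (τ, x τ)) U (𝓝 (0, x0)) :=
      (tendsto_id.mono_left (hU.trans nhdsWithin_le_nhds)).prodMk_nhds h2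
    have hsys : ∀ᶠ τ in U, (T t).sys i0 p (τ, x τ) = 0 := by
      filter_upwards [h1, hy, hne.filter_mono hU] with τ a b e
      rw [(T t).sys_eq hcF i0 p e, a]
      exact (critMap_eq_zero _ F _ _ b.2.1).2 b
    have hs0 : (T t).sys i0 p (0, x0) = 0 := by
      have hcont := ((T t).contDiffAt_sys i0 (z := (0, x0)) h4 h3).continuousAt.tendsto
      exact tendsto_nhds_unique ((hcont.comp hpr).congr' hsys) tendsto_const_nhds
    have hx0 := ((T t).sys_zero_iff h3 h4).1 hs0
    refine ⟨⟨t, x0, hx0⟩, ?_⟩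
    filter_upwards [hpr.eventually (hφ2 ⟨t, x0, hx0⟩), hsys, h1] with τ a b d
    show y τ = (T t).act τ (φ ⟨t, x0, hx0⟩ τ)
    rw [a.1 b, d]

end

section

variable {ι : Type} [Fintype ι] {c : Fin 3 → Fin 4} {F : Finset (Fin 4)} {i0 : ι} {p : Fam ι}

lemma gradOne_camAt (c : Fin 3 → Fin 4) (w : ℂ) (y : V4) :
    gradOne (camAt c w) y = w • gradOne (camAt c 1) y := by
  simp only [gradOne, Fin.sum_univ_three, coef, camAt, Matrix.cons_val, smul_dotProduct,
    smul_eq_mul, one_smul, smul_add, smul_smul]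
  congr 1
  congr 1
  · congr 1; ring
  · congr 1; ring
  · congr 1; ring

lemma tendsto_root {T : Type*} (U : Ultrafilter T) {z : T → ℂ} {m : ℕ} (hm : m ≠ 0) {κ : ℂ}
    (h : Tendsto (fun t => z t ^ m) U (𝓝 κ)) : ∃ z0, Tendsto z U (𝓝 z0) ∧ z0 ^ m = κ := by
  have hb : ∀ᶠ t in U, ‖z t‖ ≤ ‖κ‖ + 2 := by
    filter_upwards [h.norm.eventually_lt_const (lt_add_one ‖κ‖)] with t ht
    rw [norm_pow] at ht
    by_contra! hc
    have h1 : 1 ≤ ‖z t‖ := by linarith [norm_nonneg κ]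
    have := le_self_pow₀ h1 hm
    linarith
  obtain ⟨z0, hz⟩ := exists_tendsto_of_bounded U z _ hb
  exact ⟨z0, hz, tendsto_nhds_unique (hz.pow m) h⟩

/-- The conclusion of the classification for a given scaling. -/
def Scaling.Lifts (s : Scaling c F) (p : Fam ι) (U : Ultrafilter ℂ) (y : ℂ → V4) : Prop :=
  ∃ x : ℂ → V4, ∃ x0, (∀ᶠ τ in U, s.act τ (x τ) = y τ) ∧ Tendsto x U (𝓝 x0) ∧
    x0 (c 0) ≠ 0 ∧ ∀ i, p i 0 ⬝ᵥ s.act 0 x0 ≠ 0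

lemma Scaling.lifts (s : Scaling c F) {U : Ultrafilter ℂ} (hU : ↑U ≤ 𝓝[≠] (0:ℂ)) {y : ℂ → V4}
    {y0 : V4} (hy : Tendsto y U (𝓝 y0)) (hl : ∀ i, p i 0 ⬝ᵥ y0 ≠ 0) (hZ : ∀ k ∈ s.Z, y0 k = 0)
    (ζ : V4) (hζ : ∀ k ∈ s.Z, Tendsto (fun τ => y τ k / τ ^ s.m) U (𝓝 (ζ k)))
    (h0 : (if c 0 ∈ s.Z then ζ (c 0) else y0 (c 0)) ≠ 0) : s.Lifts p U y := by
  refine ⟨fun τ k => if k ∈ s.Z then y τ k / τ ^ s.m else y τ k,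
    fun k => if k ∈ s.Z then ζ k else y0 k, ?_, ?_, h0, ?_⟩
  · filter_upwards [hU eventually_mem_nhdsWithin] with τ hτ
    have hτ : τ ≠ 0 := hτ
    funext k
    by_cases hk : k ∈ s.Z
    · simp only [act, hk, if_true]; field_simp
    · simp [act, hk]
  · rw [tendsto_pi_nhds]
    intro k
    by_cases hk : k ∈ s.Z
    · simpa [hk] using hζ k hk
    · simpa [hk] using tendsto_pi_nhds.1 hy k
  · have : s.act 0 (fun k => if k ∈ s.Z then ζ k else y0 k) = y0 := by
      funext k
      by_cases hk : k ∈ s.Z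
      · simp [s.act_zero, hk, hZ k hk]
      · simp [s.act_zero, hk]
    rwa [this]

/-- A family of critical points of an extended family which converges away from the poles of the
original family. -/
structure Approach (i0 : ι) (F : Finset (Fin 4)) (p : Fam ι) (c : Fin 3 → Fin 4)
    (U : Ultrafilter ℂ) (y : ℂ → V4) (y0 : V4) : Prop where
  le : ↑U ≤ 𝓝[≠] (0:ℂ)
  tendsto : Tendsto y U (𝓝 y0)
  supp : ∀ k ∉ F, y0 k = 0
  one : p i0 0 ⬝ᵥ y0 = 1
  ne : ∀ i, p i 0 ⬝ᵥ y0 ≠ 0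
  crit : ∀ᶠ τ in U, y τ (c 0) ≠ 0
  grad : ∀ k ∈ F, Tendsto (fun τ => τ ^ 6 * gradOne (camAt c 1) (y τ) k) U
    (𝓝 (-grad p y0 k))

lemma exists_approach {U : Ultrafilter ℂ} (hU : ↑U ≤ 𝓝[≠] (0:ℂ)) {y : ℂ → V4}
    (hy : ∀ᶠ τ in U, y τ ∈ critSet (some i0) F (extFam p (camAt c (τ ^ 6))))
    (h1 : Gen1 F (extFam p (camAt c 1))) (h3 : Gen3 F (extFam p (camAt c 1)))
    (h2 : Gen2 F (extFam p (camAt c 1)) (fun o => o.elim 0 1)) :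
    ∃ y0, Approach i0 F p c U y y0 := by
  have hU0 : Tendsto (fun τ : ℂ => τ) U (𝓝 0) := tendsto_id.mono_left (hU.trans nhdsWithin_le_nhds)
  have hne : ∀ᶠ τ in U, τ ≠ (0:ℂ) := hU eventually_mem_nhdsWithin
  have hfirst : ∀ w : ℂ, camAt c w 0 = camAt c 1 0 := fun w => by simp [camAt]
  have hlam : ∀ᶠ τ in U, ∀ i, extFam p (camAt c 1) i 0 ⬝ᵥ y τ ≠ 0 := by
    filter_upwards [hy] with τ h
    rintro (_ | i)
    · have := h.2.1 none
      simpa [extFam, hfirst (τ ^ 6)] using this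
    · exact h.2.1 (some i)
  have hgr : ∀ᶠ τ in U, ∀ k ∈ F,
      τ ^ 6 * gradOne (camAt c 1) (y τ) k + grad p (y τ) k = 0 := by
    filter_upwards [hy] with τ h k hk
    have := h.2.2.1 k hk
    rwa [grad_extFam, gradOne_camAt] at this
  obtain ⟨y0, hy0, hs, hone, hl⟩ := exists_limit U (p := fun _ => extFam p (camAt c 1))
    (p0 := extFam p (camAt c 1)) (w := fun τ o => o.elim (τ ^ 6) 1) (w0 := fun o => o.elim 0 1)
    (y := y) (F := F) (some i0) tendsto_const_nhds (by
      rw [tendsto_pi_nhds]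
      rintro (_ | i)
      · simpa using hU0.pow 6
      · exact tendsto_const_nhds)
    (hy.mono fun t ht => ht.1) hlam
    (by
      filter_upwards [hgr] with τ h k hk
      have := h k hk
      simpa [Fintype.sum_option, extFam, grad] using this)
    (hy.mono fun t ht => ht.2.2.2) h1 h3 h2 (by simp)
  have hl' : ∀ i, p i 0 ⬝ᵥ y0 ≠ 0 := fun i => hl (some i) (by simp)
  refine ⟨y0, hU, hy0, hs, hone, hl', ?_, fun k hk => ?_⟩
  · filter_upwards [hlam] with τ h
    simpa [extFam, camAt] using h none
  · refine ((tendsto_pi_nhds.1 (tendsto_grad tendsto_const_nhds hy0 hl') k).neg).congr' ?_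
    filter_upwards [hgr] with τ h
    linear_combination -(h k hk)

namespace Approach
variable {U : Ultrafilter ℂ} {y : ℂ → V4} {y0 : V4}

lemma coef_tendsto (h : Approach i0 F p c U y y0) {j : Fin 3} (hj : c j ∈ F)
    (hc : ∀ r, r ≠ j → c r ≠ c j) :
    Tendsto (fun τ => τ ^ 6 * coef (camAt c 1) (y τ) j) U (𝓝 (-PaperED.grad p y0 (c j))) := by
  refine (h.grad _ hj).congr fun τ => ?_
  congr 1
  simp only [gradOne, Finset.sum_apply]
  rw [Finset.sum_eq_single j]
  · simp [camAt_one]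
  · intro r _ hr
    simp [camAt_one, (hc r hr).symm]
  · simp

lemma grad_eq_zero (h : Approach i0 F p c U y y0) {k : Fin 4} (hk : k ∈ F) (hc : ∀ r, c r ≠ k) :
    PaperED.grad p y0 k = 0 := by
  have h1 := h.grad k hk
  have : ∀ τ, gradOne (camAt c 1) (y τ) k = 0 := fun τ => by
    simp [gradOne, camAt_one, fun r => (hc r).symm]
  simp only [this, mul_zero] at h1
  have := tendsto_nhds_unique h1 tendsto_const_nhds
  simpa using this

lemma coord (h : Approach i0 F p c U y y0) (k : Fin 4) :
    Tendsto (fun τ => y τ k) U (𝓝 (y0 k)) := tendsto_pi_nhds.1 h.tendsto k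

lemma ne_zero (h : Approach i0 F p c U y y0) : ∀ᶠ τ in U, τ ≠ (0:ℂ) :=
  h.le eventually_mem_nhdsWithin

lemma mem_critSet (h : Approach i0 F p c U y y0) {F' : Finset (Fin 4)}
    (h1 : ∀ k ∈ F, k ∉ F' → y0 k = 0) (h2 : ∀ k ∈ F', PaperED.grad p y0 k = 0) :
    y0 ∈ critSet i0 F' p := by
  refine ⟨fun k hk => ?_, h.ne, h2, h.one⟩
  by_cases hkF : k ∈ F
  · exact h1 k hkF hk
  · exact h.supp k hkF

lemma lifts_triv (h : Approach i0 F p c U y y0) (h0 : y0 (c 0) ≠ 0) :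
    (Scaling.triv c F).Lifts p U y :=
  Scaling.lifts _ h.le h.tendsto h.ne (by simp [Scaling.triv]) 0 (by simp [Scaling.triv])
    (by simpa [Scaling.triv] using h0)

lemma lifts_single (h : Approach i0 F p c U y y0) (hF : ∀ r, c r ∈ F)
    (hc : ∀ r, r ≠ 0 → c r ≠ c 0) (hg : GradNe i0 F (c 0) p) (h0 : y0 (c 0) = 0)
    (h1 : y0 (c 1) ≠ 0) (h2 : y0 (c 2) ≠ 0) : (Scaling.single (hF 0) hc).Lifts p U y := by
  have hC := h.coef_tendsto (hF 0) hc
  simp only [coef_camAt_zero] at hC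
  have ha := h.coord (c 0)
  rw [h0] at ha
  have hb : ∀ r, r ≠ 0 → y0 (c r) ≠ 0 := by
    intro r hr; fin_cases r
    · exact absurd rfl hr
    · exact h1
    · exact h2
  have hne : ∀ r, r ≠ 0 → ∀ᶠ τ in U, y τ (c r) ≠ 0 := fun r hr =>
    (h.coord (c r)).eventually_ne (hb r hr)
  have hzero : ∀ r, r ≠ 0 → Tendsto (fun τ => τ ^ 6 * coef (camAt c 1) (y τ) r) U (𝓝 0) := by
    intro r hr
    have hlim := ((hC.mul ha).div (h.coord (c r)) (hb r hr)).const_mul (-1/2)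
    simp only [mul_zero, zero_div] at hlim
    refine hlim.congr' ?_
    filter_upwards [h.crit, hne r hr, hne (-r) (neg_fin_three r hr).1] with τ e1 e2 e3
    have hm := mul_camAt c (y τ) (y τ) hr
    have hm' : y τ (c 1) * y τ (c 2) = y τ (c r) * y τ (c (-r)) := by linear_combination hm / 2
    simp only [Pi.div_apply]
    have hm'' : -2 * y τ (c 1) * y τ (c 2) = -2 * (y τ (c r) * y τ (c (-r))) := by
      linear_combination -2 * hm'
    rw [coef_camAt _ _ hr, hm'']
    field_simp
  have hgrad : ∀ k ∈ F, k ≠ c 0 → PaperED.grad p y0 k = 0 := by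
    intro k hk hk0
    have hlim := h.grad k hk
    have h3 : Tendsto (fun τ => τ ^ 6 * gradOne (camAt c 1) (y τ) k) U (𝓝 0) := by
      have h4 : Tendsto (fun τ => ∑ r, (τ ^ 6 * coef (camAt c 1) (y τ) r) * camAt c 1 r k) U
          (𝓝 (∑ r : Fin 3, 0)) := by
        refine tendsto_finsetSum _ fun r _ => ?_
        by_cases hr : r = 0
        · subst hr
          simp [camAt_one, hk0]
        · simpa using (hzero r hr).mul_const (camAt c 1 r k)
      simp only [Finset.sum_const_zero] at h4
      refine h4.congr fun τ => ?_
      simp only [gradOne, Finset.sum_apply, Finset.mul_sum, Pi.smul_apply, smul_eq_mul]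
      exact Finset.sum_congr rfl fun r _ => by ring
    simpa using tendsto_nhds_unique hlim h3
  have hmem : y0 ∈ critSet i0 (F \ {c 0}) p :=
    h.mem_critSet (by
      intro k hk hk'
      have : k = c 0 := by simpa [hk] using hk'
      rw [this, h0]) (by
      intro k hk
      rw [Finset.mem_sdiff, Finset.mem_singleton] at hk
      exact hgrad k hk.1 hk.2)
  have hG := hg _ Finset.sdiff_subset (by simp) y0 hmem (c 0) (by simp)
  have hcube : Tendsto (fun τ => (y τ (c 0) / τ ^ 2) ^ 3) U
      (𝓝 (-2 * y0 (c 1) * y0 (c 2) / -PaperED.grad p y0 (c 0))) := by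
    have := (((h.coord (c 1)).const_mul (-2)).mul (h.coord (c 2))).div hC (neg_ne_zero.2 hG)
    refine this.congr' ?_
    filter_upwards [h.crit, hne 1 (by simp), hne 2 (by simp), h.ne_zero] with τ e1 e2 e3 e4
    simp only [Pi.div_apply]
    field_simp
  obtain ⟨z0, hz, hz0⟩ := tendsto_root U three_ne_zero hcube
  refine Scaling.lifts _ h.le h.tendsto h.ne ?_ (fun _ => z0) ?_ ?_
  · intro k hk
    rw [show k = c 0 by simpa [Scaling.single] using hk, h0]
  · intro k hk
    rw [show k = c 0 by simpa [Scaling.single] using hk]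
    exact hz
  · have : z0 ≠ 0 := by
      rintro rfl
      refine div_ne_zero (mul_ne_zero (mul_ne_zero ?_ h1) h2) (neg_ne_zero.2 hG) (hz0.symm.trans ?_)
      · norm_num
      · simp
    simpa [Scaling.single] using this

end Approach

end

section

variable {ι : Type} [Fintype ι] {c : Fin 3 → Fin 4} {F : Finset (Fin 4)} {i0 : ι} {p : Fam ι}

lemma fin_three_cases : ∀ j r : Fin 3, j ≠ 0 → r = 0 ∨ r = j ∨ r = -j := by decide

namespace Approach
variable {U : Ultrafilter ℂ} {y : ℂ → V4} {y0 : V4}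

lemma lifts_pair (h : Approach i0 F p c U y y0) (hF : ∀ r, c r ∈ F)
    (hc : Function.Injective c) (hg : GradNe i0 F (c 0) p) {j : Fin 3} (hj : j ≠ 0)
    (h0 : y0 (c 0) = 0) (h1 : y0 (c j) = 0) (h2 : y0 (c (-j)) ≠ 0) :
    (Scaling.pair hF hc hj).Lifts p U y := by
  have hn := neg_fin_three j hj
  have hC := fun r => h.coef_tendsto (hF r) (fun s hs => hc.ne hs)
  have hb := h.coord (c (-j))
  have hbne := hb.eventually_ne h2
  have ha := h.coord (c 0)
  rw [h0] at ha
  have e0 : ∀ τ, coef (camAt c 1) (y τ) 0 = -2 * (y τ (c j) * y τ (c (-j))) / y τ (c 0) ^ 3 := by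
    intro τ
    have := mul_camAt c (y τ) (y τ) hj
    rw [coef_camAt_zero]
    congr 1
    linear_combination -this
  have ej : ∀ τ, coef (camAt c 1) (y τ) j = y τ (c (-j)) / y τ (c 0) ^ 2 := fun τ =>
    coef_camAt _ _ hj
  have en : ∀ τ, coef (camAt c 1) (y τ) (-j) = y τ (c j) / y τ (c 0) ^ 2 := fun τ => by
    rw [coef_camAt _ _ hn.1, neg_neg]
  have hC0 := hC 0
  have hCj := hC j
  have hCn := hC (-j)
  simp only [e0] at hC0
  simp only [ej] at hCj
  simp only [en] at hCn
  have hGn : PaperED.grad p y0 (c (-j)) = 0 := by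
    have hlim := ((hC0.mul ha).div hb h2).const_mul (-1/2)
    simp only [mul_zero, zero_div] at hlim
    have := tendsto_nhds_unique hCn (hlim.congr' ?_)
    · simpa using this
    · filter_upwards [h.crit, hbne] with τ e1 e2
      simp only [Pi.div_apply]
      field_simp
  have hmem : y0 ∈ critSet i0 (F \ {c 0, c j}) p := by
    refine h.mem_critSet ?_ ?_
    · intro k hk hk'
      have : k = c 0 ∨ k = c j := by simpa [hk, or_iff_not_imp_left] using hk'
      rcases this with rfl | rfl <;> assumption
    · intro k hk
      simp only [Finset.mem_sdiff, Finset.mem_insert, Finset.mem_singleton, not_or] at hk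
      by_cases hkn : c (-j) = k
      · rw [← hkn, hGn]
      · refine h.grad_eq_zero hk.1 fun r hr => ?_
        rcases fin_three_cases j r hj with rfl | rfl | rfl
        · exact hk.2.1 hr.symm
        · exact hk.2.2 hr.symm
        · exact hkn hr
  have hG := hg _ Finset.sdiff_subset (by simp) y0 hmem
  have hGj := hG (c j) (by simp)
  have hG0 := hG (c 0) (by simp)
  have hsq : Tendsto (fun τ => (y τ (c 0) / τ ^ 3) ^ 2) U
      (𝓝 (y0 (c (-j)) / -PaperED.grad p y0 (c j))) := by
    refine (hb.div hCj (neg_ne_zero.2 hGj)).congr' ?_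
    filter_upwards [h.crit, hbne, h.ne_zero] with τ e1 e2 e4
    simp only [Pi.div_apply]
    field_simp
  obtain ⟨z0, hz, hz0⟩ := tendsto_root U two_ne_zero hsq
  have hz0' : z0 ≠ 0 := by
    rintro rfl
    exact div_ne_zero h2 (neg_ne_zero.2 hGj) (hz0.symm.trans (by simp))
  have hsecond := ((hC0.mul (hz.pow 3)).div hb h2).const_mul (-1/2)
  have hcj : c j ≠ c 0 := hc.ne hj
  refine Scaling.lifts _ h.le h.tendsto h.ne ?_ (fun k => if k = c 0 then z0 else
    (-1/2 * (-PaperED.grad p y0 (c 0) * z0 ^ 3 / y0 (c (-j))))) ?_ ?_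
  · intro k hk
    have : k = c 0 ∨ k = c j := by simpa [Scaling.pair] using hk
    rcases this with rfl | rfl <;> assumption
  · intro k hk
    have : k = c 0 ∨ k = c j := by simpa [Scaling.pair] using hk
    rcases this with rfl | rfl
    · simpa [Scaling.pair] using hz
    · rw [if_neg hcj]
      refine hsecond.congr' ?_
      filter_upwards [h.crit, hbne, h.ne_zero] with τ e1 e2 e4
      simp only [Pi.div_apply, Scaling.pair]
      field_simp
  · simpa [Scaling.pair] using hz0'

lemma lifts_full (h : Approach i0 F p c U y y0) (hF : ∀ r, c r ∈ F)
    (hc : Function.Injective c) (hg : GradNe i0 F (c 0) p) (h0 : ∀ r, y0 (c r) = 0) :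
    (Scaling.full hF).Lifts p U y := by
  have hC := fun r => h.coef_tendsto (hF r) (fun s hs => hc.ne hs)
  have hC0 := hC 0
  have hC1 := hC 1
  have hC2 := hC 2
  simp only [coef_camAt_zero] at hC0
  simp only [coef_camAt _ _ (show (1 : Fin 3) ≠ 0 by decide), show -(1 : Fin 3) = 2 from rfl] at hC1
  simp only [coef_camAt _ _ (show (2 : Fin 3) ≠ 0 by decide), show -(2 : Fin 3) = 1 from rfl] at hC2
  have hmem : y0 ∈ critSet i0 (F \ (Scaling.full hF).Z) p := by
    refine h.mem_critSet ?_ ?_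
    · intro k hk hk'
      have : k = c 0 ∨ k = c 1 ∨ k = c 2 := by
        rw [← Scaling.mem_full hF]; simpa [hk] using hk'
      rcases this with rfl | rfl | rfl <;> exact h0 _
    · intro k hk
      rw [Finset.mem_sdiff, Scaling.mem_full] at hk
      refine h.grad_eq_zero hk.1 fun r hr => hk.2 ?_
      subst hr
      fin_cases r <;> simp
  have hG : ∀ r, PaperED.grad p y0 (c r) ≠ 0 := fun r =>
    hg _ Finset.sdiff_subset (by simp [Scaling.mem_full]) y0 hmem (c r) (by simp [Scaling.full])
  have hne : ∀ r, -PaperED.grad p y0 (c r) ≠ 0 := fun r => neg_ne_zero.2 (hG r)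
  have hy1 : ∀ᶠ τ in U, y τ (c 1) ≠ 0 := by
    filter_upwards [hC2.eventually_ne (hne 2)] with τ e h
    simp [h] at e
  have hy2 : ∀ᶠ τ in U, y τ (c 2) ≠ 0 := by
    filter_upwards [hC1.eventually_ne (hne 1)] with τ e h
    simp [h] at e
  have hz := (hC0.div (hC1.mul hC2) (mul_ne_zero (hne 1) (hne 2))).const_mul (-1/2)
  set z0 := -1 / 2 * (-PaperED.grad p y0 (c 0) / (-PaperED.grad p y0 (c 1) * -PaperED.grad p y0 (c 2)))
    with hz0
  have hz0' : z0 ≠ 0 :=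
    mul_ne_zero (by norm_num) (div_ne_zero (hne 0) (mul_ne_zero (hne 1) (hne 2)))
  have hz' : Tendsto (fun τ => y τ (c 0) / τ ^ 6) U (𝓝 z0) := by
    refine hz.congr' ?_
    filter_upwards [h.crit, hy1, hy2, h.ne_zero] with τ e1 e2 e3 e4
    simp only [Pi.div_apply]
    field_simp
  refine Scaling.lifts _ h.le h.tendsto h.ne ?_ (fun k => if k = c 0 then z0 else
    if k = c 1 then -PaperED.grad p y0 (c 2) * z0 ^ 2 else -PaperED.grad p y0 (c 1) * z0 ^ 2) ?_ ?_
  · intro k hk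
    rw [Scaling.mem_full] at hk
    rcases hk with rfl | rfl | rfl <;> exact h0 _
  · intro k hk
    have h10 : c 1 ≠ c 0 := hc.ne (by decide)
    have h20 : c 2 ≠ c 0 := hc.ne (by decide)
    have h21 : c 2 ≠ c 1 := hc.ne (by decide)
    rw [Scaling.mem_full] at hk
    rcases hk with rfl | rfl | rfl
    · simpa [Scaling.full] using hz'
    · rw [if_neg h10, if_pos rfl]
      refine (hC2.mul (hz'.pow 2)).congr' ?_
      filter_upwards [h.crit, h.ne_zero] with τ e1 e4
      simp only [Scaling.full]
      field_simp
    · rw [if_neg h20, if_neg h21]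
      refine (hC1.mul (hz'.pow 2)).congr' ?_
      filter_upwards [h.crit, h.ne_zero] with τ e1 e4
      simp only [Scaling.full]
      field_simp
  · have : (Scaling.full hF).Z = Finset.univ.image c := rfl
    rw [if_pos (by simp [this])]
    simpa using hz0'

end Approach

end

section

variable {ι : Type} [Fintype ι] {c : Fin 3 → Fin 4} {F : Finset (Fin 4)} {i0 : ι} {p : Fam ι}

/-- Coordinates used for a new camera: three distinct ones, or two if `F` consists of these. -/
structure Forms (c : Fin 3 → Fin 4) (F : Finset (Fin 4)) : Prop where
  mem : ∀ r, c r ∈ F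
  ne : ∀ r, r ≠ 0 → c r ≠ c 0
  inj : Function.Injective c ∨ c 1 = c 2 ∧ F = {c 0, c 1}

lemma camAt_dot {w : ℂ} (hw : w ≠ 0) (r : Fin 3) (y : V4) : camAt c w r ⬝ᵥ y = 0 ↔ y (c r) = 0 := by
  fin_cases r <;> simp [camAt, hw]

lemma camAt_apply_zero {w : ℂ} (hw : w ≠ 0) (r : Fin 3) (k : Fin 4) :
    camAt c w r k = 0 ↔ k ≠ c r := by
  fin_cases r <;> simp [camAt, hw, Pi.single_apply]

lemma Forms.card_sdiff_le (hc : Forms c F) : (F \ Finset.univ.image c).card ≤ 1 := by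
  rcases hc.inj with h | ⟨-, h⟩
  · have h1 : (Finset.univ.image c).card = 3 := by
      rw [Finset.card_image_of_injective _ h]; rfl
    have h2 : (F \ Finset.univ.image c).card ≤ (Finset.univ \ Finset.univ.image c).card :=
      Finset.card_le_card (Finset.sdiff_subset_sdiff (Finset.subset_univ _) le_rfl)
    rw [Finset.card_sdiff_of_subset (Finset.subset_univ _), h1] at h2
    simpa using h2
  · have : F \ Finset.univ.image c = ∅ := by
      rw [Finset.sdiff_eq_empty_iff_subset]
      intro k hk
      rw [h] at hk
      simp only [Finset.mem_insert, Finset.mem_singleton] at hk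
      rcases hk with rfl | rfl <;> simp
    rw [this]; simp

lemma Forms.sdiff_eq_empty (hc : Forms c F) (hF : F.card ≤ 3) : F \ Finset.univ.image c = ∅ := by
  rw [Finset.sdiff_eq_empty_iff_subset]
  rcases hc.inj with h | ⟨-, h⟩
  · have h1 : (Finset.univ.image c).card = 3 := by
      rw [Finset.card_image_of_injective _ h]; rfl
    have h2 : Finset.univ.image c ⊆ F := by
      intro k hk
      obtain ⟨r, -, rfl⟩ := Finset.mem_image.1 hk
      exact hc.mem r
    exact (Finset.eq_of_subset_of_card_le h2 (by omega)).ge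
  · intro k hk
    rw [h] at hk
    simp only [Finset.mem_insert, Finset.mem_singleton] at hk
    rcases hk with rfl | rfl <;> simp

lemma sdiff_image_supp {y : V4} (hy : ∀ k ∉ F, y k = 0) (h : ∀ r, y (c r) = 0) :
    ∀ k ∉ F \ Finset.univ.image c, y k = 0 := by
  intro k hk
  by_cases hF : k ∈ F
  · have : k ∈ Finset.univ.image c := by simpa [hF] using hk
    obtain ⟨r, -, rfl⟩ := Finset.mem_image.1 this
    exact h r
  · exact hy k hF

lemma gen3_extFam (hp : Minors p) (hc : Forms c F) {w : ℂ} (hw : w ≠ 0) :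
    Gen3 F (extFam p (camAt c w)) := by
  classical
  rintro y hy hy0 (_ | i) (_ | j) hij h hl
  · exact hij rfl
  · have h' : ∀ r, y (c r) = 0 := fun r => (camAt_dot hw r y).1 (h r)
    exact hy0 (hp.eq_zero (T := {(j, 0)}) (by simpa using hc.card_sdiff_le)
      (sdiff_image_supp hy h') (by simpa [extFam] using hl))
  · have h' : y (c 0) = 0 := (camAt_dot hw 0 y).1 hl
    have hcard : (F.erase (c 0)).card ≤ 3 := by
      have := F.card_le_univ
      rw [Finset.card_erase_of_mem (hc.mem 0)]
      rw [Fintype.card_fin] at this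
      omega
    refine hy0 (hp.eq_zero_of_centre hcard (fun k hk => ?_) i h)
    by_cases hk0 : k = c 0
    · rw [hk0, h']
    · exact hy k fun hF => hk (Finset.mem_erase.2 ⟨hk0, hF⟩)
  · exact hp.gen3 F y hy hy0 i j (fun e => hij (by rw [e])) h hl

lemma gen1_extFam (hp : Minors p) (hc : Forms c F) {w : ℂ} (hw : w ≠ 0) :
    Gen1 F (extFam p (camAt c w)) := by
  classical
  intro y hy hy0 a ha hsum
  have hnone : ∀ r, a none r ≠ 0 → y (c 0) = 0 ∧ y (c r) = 0 := fun r hr =>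
    ⟨(camAt_dot hw 0 y).1 (ha none r hr).1, (camAt_dot hw r y).1 (ha none r hr).2⟩
  have hsplit : ∀ k ∈ F, (∑ r, a none r * camAt c w r k) +
      (∑ i, ∑ r, a (some i) r • p i r) k = 0 := by
    intro k hk
    have := hsum k hk
    rw [Fintype.sum_option] at this
    simpa [extFam] using this
  have hsome : (fun i => a (some i)) = 0 := by
    refine hp.gen1 (F.filter fun k => y k ≠ 0) y (fun k hk => ?_) hy0 _
      (fun i r h => ha (some i) r h) (fun k hk => ?_)
    · by_contra h
      exact hk (Finset.mem_filter.2 ⟨by_contra fun hF => h (hy k hF), h⟩)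
    · rw [Finset.mem_filter] at hk
      have h0 : ∑ r, a none r * camAt c w r k = 0 := by
        refine Finset.sum_eq_zero fun r _ => ?_
        by_cases hr : a none r = 0
        · simp [hr]
        · rw [(camAt_apply_zero hw r k).2, mul_zero]
          rintro rfl
          exact hk.2 (hnone r hr).2
      have := hsplit k hk.1
      rwa [h0, zero_add] at this
  have hsum0 : ∀ k ∈ F, ∑ r, a none r * camAt c w r k = 0 := by
    intro k hk
    have := hsplit k hk
    have h2 : ∀ i, a (some i) = 0 := fun i => congrFun hsome i
    simpa [h2] using this
  have hn : ∀ r, (∀ s, s ≠ r → c s = c r → a none s = 0) → a none r = 0 := by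
    intro r hr
    have := hsum0 (c r) (hc.mem r)
    rw [Finset.sum_eq_single r] at this
    · exact (mul_eq_zero.1 this).resolve_right fun h => (camAt_apply_zero hw r _).1 h rfl
    · intro s _ hs
      by_cases h : c s = c r
      · rw [hr s hs h, zero_mul]
      · rw [(camAt_apply_zero hw s _).2 (Ne.symm h), mul_zero]
    · simp
  have h12 : ∀ r, a none r = 0 := by
    rcases hc.inj with h | ⟨h, hF⟩
    · exact fun r => hn r fun s hs h' => absurd (h h') hs
    · have h1 : ∀ r, r ≠ 0 → a none r = 0 := by
        intro r hr
        by_contra hcon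
        have h2 := hnone r hcon
        refine hy0 (funext fun k => ?_)
        by_cases hk : k ∈ F
        · rw [hF] at hk
          simp only [Finset.mem_insert, Finset.mem_singleton] at hk
          have hr1 : c r = c 1 := by
            fin_cases r
            · exact absurd rfl hr
            · rfl
            · exact h.symm
          rcases hk with rfl | rfl
          · exact h2.1
          · rw [← hr1]; exact h2.2
        · exact hy k hk
      intro r
      by_cases hr : r = 0
      · subst hr
        exact hn 0 fun s hs _ => h1 s hs
      · exact h1 r hr
  funext o r
  cases o with
  | none => exact h12 r
  | some i => exact congrFun (congrFun hsome i) r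

lemma gen2_extFam_limit (h : Gen2 F p 1) (q : Fin 3 → V4) :
    Gen2 F (extFam p q) (fun o => o.elim 0 1) := by
  rintro y hy hy0 (_ | i) hi hr
  · exact absurd rfl hi
  · obtain ⟨z, hz, h1, h2, h3⟩ := h y hy hy0 i one_ne_zero hr
    refine ⟨z, hz, h1, h2, fun s hs hsj => ?_⟩
    rw [Fintype.sum_option, hsj none (by simp)]
    simpa using h3 (fun j => s (some j)) hs fun j hj => by
      simpa [extFam] using hsj (some j) (by simpa using hj)

lemma single_mem_critSet (hl : ∀ i k, p i 0 k ≠ 0) (i0 : ι) (k : Fin 4) :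
    Pi.single k (p i0 0 k)⁻¹ ∈ critSet i0 {k} p := by
  have h0 : ∀ i, p i 0 ⬝ᵥ (Pi.single k (p i0 0 k)⁻¹ : V4) ≠ 0 := fun i => by
    simpa using ⟨hl i k, hl i0 k⟩
  refine ⟨fun l hl => by simp at hl; simp [hl], h0, fun l hl' => ?_, by simp [hl]⟩
  rw [Finset.mem_singleton] at hl'
  subst hl'
  have := grad_dot p _ h0
  simpa [hl] using this

lemma Minors.apply_ne_zero (hp : Minors p) (i : ι) (r : Fin 3) (k : Fin 4) : p i r k ≠ 0 := by
  intro h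
  have := hp.eq_zero (F := {k}) (T := {(i, r)}) (by simp) (y := Pi.single k 1)
    (fun l hl => by simp at hl; simp [hl]) (by simpa using h)
  simpa using congrFun this k

lemma gen2_extFam (hp : Minors p) (h : Gen2 F p 1) (hc : Forms c F)
    (hg : GradNe i0 F (c 0) p) :
    ∀ᶠ τ in 𝓝[≠] (0:ℂ), Gen2 F (extFam p (camAt c (τ ^ 6))) 1 := by
  classical
  have hτ : ∀ᶠ τ in 𝓝[≠] (0:ℂ), τ ≠ 0 := eventually_mem_nhdsWithin
  by_cases hF : F.card ≤ 3
  · filter_upwards [hτ] with τ hτ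
    rintro y hy hy0 (_ | i) - hr
    · have h' : ∀ r, y (c r) = 0 := fun r => (camAt_dot (pow_ne_zero 6 hτ) r y).1 (hr r)
      have := sdiff_image_supp hy h'
      rw [hc.sdiff_eq_empty hF] at this
      exact absurd (funext fun k => this k (by simp)) hy0
    · exact absurd (hp.eq_zero_of_centre hF hy i hr) hy0
  have hFu : F = Finset.univ := by
    have := F.card_le_univ
    rw [Fintype.card_fin] at this
    exact Finset.eq_univ_of_card F (by rw [Fintype.card_fin]; omega)
  have hF' : ∀ k, k ∉ F → False := fun k hk => hk (by simp [hFu])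
  have hcentre : ∀ i, ∃ z : V4, p i 1 ⬝ᵥ z = 0 ∧ p i 2 ⬝ᵥ z = 0 ∧
      ∑ j ∈ Finset.univ.erase i, gradOne (p j) (centre (p i)) ⬝ᵥ z ≠ 0 := by
    intro i
    obtain ⟨z, -, h1, h2, h3⟩ := h (centre (p i)) (fun k hk => (hF' k hk).elim)
      (hp.centre_ne_zero i) i one_ne_zero (dot_centre _)
    refine ⟨z, h1, h2, ?_⟩
    have := h3 (fun j => if j = i then 0 else gradOne (p j) (centre (p i)) ⬝ᵥ z) (by simp)
      (fun j hj => by simp [hj])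
    rwa [← Finset.add_sum_erase _ _ (Finset.mem_univ i), if_pos rfl, zero_add,
      Finset.sum_congr rfl fun j hj => if_neg (Finset.ne_of_mem_erase hj)] at this
  choose z hz1 hz2 hz3 using hcentre
  have hsmall : ∀ i, ∀ᶠ τ in 𝓝[≠] (0:ℂ), gradOne (camAt c (τ ^ 6)) (centre (p i)) ⬝ᵥ z i +
      ∑ j ∈ Finset.univ.erase i, gradOne (p j) (centre (p i)) ⬝ᵥ z i ≠ 0 := by
    intro i
    simp only [gradOne_camAt c (_ ^ 6), smul_dotProduct, smul_eq_mul]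
    have h1 : Tendsto (fun τ : ℂ => τ ^ 6 * (gradOne (camAt c 1) (centre (p i)) ⬝ᵥ z i) +
      ∑ j ∈ Finset.univ.erase i, gradOne (p j) (centre (p i)) ⬝ᵥ z i) (𝓝 0)
      (𝓝 (0 ^ 6 * (gradOne (camAt c 1) (centre (p i)) ⬝ᵥ z i) +
      ∑ j ∈ Finset.univ.erase i, gradOne (p j) (centre (p i)) ⬝ᵥ z i)) :=
      ((tendsto_id.pow 6).mul_const _).add_const _
    refine (h1.eventually_ne ?_).filter_mono nhdsWithin_le_nhds
    simpa using hz3 i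
  have hcinj : Function.Injective c := by
    rcases hc.inj with h | ⟨-, h⟩
    · exact h
    · exact absurd (by rw [h]; exact Finset.card_le_two.trans (by norm_num)) hF
  filter_upwards [hτ, eventually_all.2 hsmall] with τ hτ hs
  rintro y hy hy0 (_ | i) - hr
  · have h' : ∀ r, y (c r) = 0 := fun r => (camAt_dot (pow_ne_zero 6 hτ) r y).1 (hr r)
    refine ⟨Pi.single (c 0) 1, fun k hk => (hF' k hk).elim, ?_, ?_, fun s hs0 hsj => ?_⟩
    · simp [extFam, camAt, hc.ne 1 (by decide)]
    · simp [extFam, camAt, hc.ne 2 (by decide)]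
    · rw [Fintype.sum_option, hs0, zero_add]
      have : ∑ j, s (some j) = grad p y (c 0) := by
        rw [grad, Finset.sum_apply]
        refine Finset.sum_congr rfl fun j _ => ?_
        rw [hsj (some j) (by simp)]
        simp [extFam]
      rw [this]
      obtain ⟨x, hx⟩ : ∃ x, y x ≠ 0 := by
        by_contra! hcon
        exact hy0 (funext hcon)
      have hxc : ∀ r, x ≠ c r := fun r h => hx (h ▸ h' r)
      have hyx : ∀ k, k ≠ x → y k = 0 := by
        intro k hk
        by_contra hyk
        have hkc : ∀ r, k ≠ c r := fun r h => hyk (h ▸ h' r)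
        have h1 := hc.card_sdiff_le
        refine hk (Finset.card_le_one.1 h1 k ?_ x ?_)
        · simpa [hFu] using fun r => (hkc r).symm
        · simpa [hFu] using fun r => (hxc r).symm
      have hy' : y = (y x * p i0 0 x) • (Pi.single x (p i0 0 x)⁻¹ : V4) := by
        funext k
        by_cases hk : k = x
        · subst hk
          simp [hp.apply_ne_zero]
        · simp [hk, hyx k hk]
      rw [hy', grad_smul _ _ (mul_ne_zero hx (hp.apply_ne_zero _ _ _))]
      refine mul_ne_zero (inv_ne_zero (mul_ne_zero hx (hp.apply_ne_zero _ _ _))) ?_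
      exact hg {x} (by simp [hFu]) (by simpa using (hxc 0).symm) _
        (single_mem_critSet (fun i k => hp.apply_ne_zero i 0 k) i0 x) (c 0)
        (by simpa using (hxc 0).symm)
  · obtain ⟨κ, rfl⟩ := hp.eq_smul_centre hr
    have hκ : κ ≠ 0 := by
      rintro rfl
      simp at hy0
    refine ⟨z i, fun k hk => (hF' k hk).elim, hz1 i, hz2 i, fun s hs0 hsj => ?_⟩
    rw [Fintype.sum_option, ← Finset.add_sum_erase _ _ (Finset.mem_univ i), hs0, zero_add,
      hsj none (by simp), Finset.sum_congr rfl fun j hj => hsj (some j)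
        (by simpa using Finset.ne_of_mem_erase hj)]
    simp only [Pi.one_apply, one_mul, extFam, Option.elim, gradOne_smul _ _ hκ, smul_dotProduct,
      smul_eq_mul, ← Finset.mul_sum, ← mul_add]
    exact mul_ne_zero (inv_ne_zero hκ) (hs i)

end

section

variable {ι : Type} [Fintype ι] {c : Fin 3 → Fin 4} {F : Finset (Fin 4)} {i0 : ι} {p : Fam ι}

lemma gradNe_of_critCount {N : Finset (Fin 4) → ℕ} (hN : ∀ F' ⊆ F, CritCount i0 F' (N F'))
    (hF : F.card ≤ 2 * Fintype.card ι + 1) (hp : Indep p) {a : Fin 4} (ha : a ∈ F) :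
    GradNe i0 F a p := by
  intro F' hF' haF y hy x hx
  have : F'.card < F.card := Finset.card_lt_card ⟨hF', fun h => haF (h ha)⟩
  exact (hN F' hF').grad_ne_zero (by omega) hp hy hx

/-- A coordinate distinguishing two scalings. -/
def Scaling.Separates (s s' : Scaling c F) : Prop :=
  ∃ k ∈ s'.Z, k ∉ s.Z ∧ (c 0 ∈ s.Z ∨ k = c 0)

lemma Scaling.Separates.ne {s s' : Scaling c F} (h : s.Separates s') (hg : GradNe i0 F (c 0) p)
    {x x' : V4} (hx : x ∈ s.target i0 p) : s.act 0 x ≠ s'.act 0 x' := by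
  obtain ⟨k, hk', hk, h0⟩ := h
  intro he
  have h1 := congrFun he k
  rw [s'.act_zero, if_pos hk'] at h1
  rcases h0 with h0 | rfl
  · exact hg.apply_ne_zero Finset.sdiff_subset (by simp [h0]) hx.1
      (by simpa [hk] using s'.hZ hk') h1
  · rw [s.act_zero, if_neg hk] at h1
    exact hx.2.1 h1

lemma critCount_extend {κ : Type} [Fintype κ] (T : κ → Scaling c F) {N : Finset (Fin 4) → ℕ}
    (hN : ∀ F' ⊆ F, CritCount i0 F' (N F')) (hF : F.card ≤ 2 * Fintype.card ι + 1)
    (h2 : ∀ p : Fam ι, Indep p → Gen2 F p 1) (hc : Forms c F) (M : κ → ℕ)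
    (hM : ∀ p : Fam ι, Indep p → ∀ t, ((T t).target i0 p).Finite ∧
      ((T t).target i0 p).ncard = M t)
    (hd : ∀ p : Fam ι, Indep p → GradNe i0 F (c 0) p → ∀ t, ∀ x ∈ (T t).target i0 p,
      ∀ δ : V4, (∀ k ∉ (T t).Z, δ k = 0) → (∀ k ∈ (T t).Z, (T t).dterm 0 x δ k = 0) → δ = 0)
    (hsep : ∀ t t', t ≠ t' → (T t).Separates (T t') ∨ (T t').Separates (T t))
    (hclass : ∀ p : Fam ι, Indep p → GradNe i0 F (c 0) p → ∀ U y y0, Approach i0 F p c U y y0 →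
      ∃ t, (T t).Lifts p U y) : CritCount (some i0) F (∑ t, M t) := by
  obtain ⟨p, hp, -⟩ := exists_indep (P := fun _ => True) (p0 := (0 : Fam ι)) (by simp)
  have hg := gradNe_of_critCount hN hF hp (hc.mem 0)
  have hm := hp.minors
  have hb := count_branches (i0 := i0) (p := p) T hc.mem (fun t => (hM p hp t).1) ?_ ?_ ?_
  · have hne : ∀ᶠ τ in 𝓝[≠] (0:ℂ), τ ≠ 0 := eventually_mem_nhdsWithin
    obtain ⟨τ, ⟨h1, h3, h4⟩, h5, h6⟩ :=
      (hb.and ((gen2_extFam hm (h2 p hp) hc hg).and hne)).exists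
    refine critCount_of_example (gen1_extFam hm hc (pow_ne_zero 6 h6))
      (gen3_extFam hm hc (pow_ne_zero 6 h6)) h5 h1 ?_ h4
    rw [h3]
    exact Finset.sum_congr rfl fun t _ => (hM p hp t).2
  · intro t x hx
    exact (T t).partialInj_sys hx
      (((hN _ Finset.sdiff_subset) p hp).2.2 _ hx.1) (hd p hp hg t x hx)
  · intro t t' htt x hx x' hx'
    rcases hsep t t' htt with h | h
    · exact h.ne hg hx
    · exact (h.ne hg hx').symm
  · intro U hU y hy
    obtain ⟨y0, h⟩ := exists_approach hU hy (gen1_extFam hm hc one_ne_zero)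
      (gen3_extFam hm hc one_ne_zero) (gen2_extFam_limit (h2 p hp) _)
    exact hclass p hp hg U y y0 h

lemma dterm_triv (δ : V4) (h1 : ∀ k ∉ (Scaling.triv c F).Z, δ k = 0) :
    δ = 0 := funext fun k => h1 k (by simp [Scaling.triv])

/-- Adding a camera in the two-dimensional case. -/
lemma critCount_extend_two {a b : Fin 4} (hab : a ≠ b) {N : Finset (Fin 4) → ℕ}
    (hN : ∀ F' ⊆ {a, b}, CritCount i0 F' (N F'))
    (h2 : ∀ p : Fam ι, Indep p → Gen2 {a, b} p 1) :
    CritCount (some i0) {a, b} (N {a, b} + 3 * N {b}) := by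
  let c : Fin 3 → Fin 4 := ![a, b, b]
  have hcF : ∀ r, c r ∈ ({a, b} : Finset (Fin 4)) := by
    intro r; fin_cases r <;> simp [c]
  have hcne : ∀ r, r ≠ 0 → c r ≠ c 0 := by
    intro r hr
    fin_cases r
    · exact absurd rfl hr
    · exact hab.symm
    · exact hab.symm
  have hc : Forms c {a, b} := ⟨hcF, hcne, Or.inr ⟨rfl, rfl⟩⟩
  have hι : 0 < Fintype.card ι := Fintype.card_pos_iff.2 ⟨i0⟩
  have hF : ({a, b} : Finset (Fin 4)).card ≤ 2 * Fintype.card ι + 1 := by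
    have := Finset.card_le_two (a := a) (b := b)
    omega
  have hsd : ({a, b} : Finset (Fin 4)) \ {c 0} = {b} := by
    ext k
    simp only [Finset.mem_sdiff, Finset.mem_insert, Finset.mem_singleton, c, Matrix.cons_val_zero]
    constructor
    · rintro ⟨h | h, h'⟩
      · exact absurd h h'
      · exact h
    · rintro rfl
      exact ⟨Or.inr rfl, hab.symm⟩
  have := critCount_extend (κ := Fin 2) (i0 := i0) (T := ![Scaling.triv c {a, b},
    Scaling.single (hcF 0) hcne]) hN hF h2 hc ![N {a, b}, 3 * N {b}] ?_ ?_ ?_ ?_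
  · simpa [Fin.sum_univ_two] using this
  · intro p hp t
    have hg := gradNe_of_critCount hN hF hp (hc.mem 0)
    fin_cases t
    · have := hN _ le_rfl p hp
      show ((Scaling.triv c {a, b}).target i0 p).Finite ∧ _ = N {a, b}
      have e := Scaling.target_triv (hcF 0) hg
      exact ⟨e ▸ this.1, by rw [← this.2.1, ← e]; rfl⟩
    · have h1 := hN {b} (by simp) p hp
      have := Scaling.card_target_single hcF hcne hg (by rw [hsd]; exact h1.1)
      rw [hsd, h1.2.1] at this
      exact this
  · intro p hp hg t x hx δ d1 d2
    fin_cases t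
    · exact dterm_triv δ d1
    · exact Scaling.dterm_single hcF hcne hg hx δ d1 d2
  · intro t t' htt
    fin_cases t <;> fin_cases t' <;> first | exact absurd rfl htt | skip
    · exact Or.inl ⟨c 0, by simp [Scaling.single], by simp [Scaling.triv], Or.inr rfl⟩
    · exact Or.inr ⟨c 0, by simp [Scaling.single], by simp [Scaling.triv], Or.inr rfl⟩
  · intro p hp hg U y y0 h
    by_cases h0 : y0 (c 0) = 0
    · have h1 : y0 (c 1) ≠ 0 := by
        intro h1
        have h3 : y0 = 0 := funext fun k => by
          by_cases hk : k ∈ ({a, b} : Finset (Fin 4))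
          · simp only [Finset.mem_insert, Finset.mem_singleton] at hk
            rcases hk with rfl | rfl
            · exact h0
            · exact h1
          · exact h.supp k hk
        have := h.one
        rw [h3] at this
        simp at this
      exact ⟨1, h.lifts_single hcF hcne hg h0 h1 h1⟩
    · exact ⟨0, h.lifts_triv h0⟩

/-- Adding a camera when at least three coordinates are available. -/
lemma critCount_extend_three (hcF : ∀ r, c r ∈ F) (hci : Function.Injective c)
    {N : Finset (Fin 4) → ℕ}
    (hN : ∀ F' ⊆ F, CritCount i0 F' (N F')) (hF : F.card ≤ 2 * Fintype.card ι + 1)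
    (h2 : ∀ p : Fam ι, Indep p → Gen2 F p 1) :
    CritCount (some i0) F (N F + 3 * N (F \ {c 0}) + 2 * N (F \ {c 0, c 1}) +
      2 * N (F \ {c 0, c 2}) + N (F \ Finset.univ.image c)) := by
  have hcne : ∀ r, r ≠ 0 → c r ≠ c 0 := fun r hr => hci.ne hr
  have hc : Forms c F := ⟨hcF, hcne, Or.inl hci⟩
  have h10 : c 1 ≠ c 0 := hci.ne (by decide)
  have h20 : c 2 ≠ c 0 := hci.ne (by decide)
  have h21 : c 2 ≠ c 1 := hci.ne (by decide)
  let s0 := Scaling.triv c F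
  let s1 := Scaling.single (hcF 0) hcne
  let s2 := Scaling.pair hcF hci (j := 1) (by decide)
  let s3 := Scaling.pair hcF hci (j := 2) (by decide)
  let s4 := Scaling.full hcF
  have z0 : s0.Z = ∅ := rfl
  have z1 : s1.Z = {c 0} := rfl
  have z2 : s2.Z = {c 0, c 1} := rfl
  have z3 : s3.Z = {c 0, c 2} := rfl
  have z4 : ∀ k, k ∈ s4.Z ↔ k = c 0 ∨ k = c 1 ∨ k = c 2 := Scaling.mem_full hcF
  have := critCount_extend (κ := Fin 5) (i0 := i0) (T := ![s0, s1, s2, s3, s4]) hN hF h2 hc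
    ![N F, 3 * N (F \ {c 0}), 2 * N (F \ {c 0, c 1}), 2 * N (F \ {c 0, c 2}),
      N (F \ Finset.univ.image c)] ?_ ?_ ?_ ?_
  · simpa [Fin.sum_univ_succ, add_assoc] using this
  · intro p hp t
    have hg := gradNe_of_critCount hN hF hp (hc.mem 0)
    have hS := fun Z => hN (F \ Z) Finset.sdiff_subset p hp
    fin_cases t
    · have := hN _ le_rfl p hp
      show (s0.target i0 p).Finite ∧ _ = N F
      have e := Scaling.target_triv (hcF 0) hg
      exact ⟨e ▸ this.1, by rw [← this.2.1, ← e]; rfl⟩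
    · have := Scaling.card_target_single hcF hcne hg (hS _).1
      rw [(hS _).2.1] at this
      exact this
    · have := Scaling.card_target_pair hcF hci (j := 1) (by decide) hg (hS _).1
      rw [(hS _).2.1] at this
      exact this
    · have := Scaling.card_target_pair hcF hci (j := 2) (by decide) hg (hS _).1
      rw [(hS _).2.1] at this
      exact this
    · have := Scaling.card_target_full hcF hci hg (hS _).1
      rw [(hS _).2.1] at this
      exact this
  · intro p hp hg t x hx δ d1 d2
    fin_cases t
    · exact dterm_triv δ d1
    · exact Scaling.dterm_single hcF hcne hg hx δ d1 d2
    · exact Scaling.dterm_pair hcF hci (by decide) hg hx δ d1 d2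
    · exact Scaling.dterm_pair hcF hci (by decide) hg hx δ d1 d2
    · exact Scaling.dterm_full hcF hci hg hx δ d1 d2
  · have a01 : s0.Separates s1 := ⟨c 0, by simp [z1], by simp [z0], Or.inr rfl⟩
    have a02 : s0.Separates s2 := ⟨c 0, by simp [z2], by simp [z0], Or.inr rfl⟩
    have a03 : s0.Separates s3 := ⟨c 0, by simp [z3], by simp [z0], Or.inr rfl⟩
    have a04 : s0.Separates s4 := ⟨c 0, by simp [z4], by simp [z0], Or.inr rfl⟩
    have a12 : s1.Separates s2 := ⟨c 1, by simp [z2], by simp [z1, h10], Or.inl (by simp [z1])⟩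
    have a13 : s1.Separates s3 := ⟨c 2, by simp [z3], by simp [z1, h20], Or.inl (by simp [z1])⟩
    have a14 : s1.Separates s4 := ⟨c 1, by simp [z4], by simp [z1, h10], Or.inl (by simp [z1])⟩
    have a23 : s2.Separates s3 := ⟨c 2, by simp [z3], by simp [z2, h20, h21], Or.inl (by simp [z2])⟩
    have a24 : s2.Separates s4 := ⟨c 2, by simp [z4], by simp [z2, h20, h21], Or.inl (by simp [z2])⟩
    have a34 : s3.Separates s4 :=
      ⟨c 1, by simp [z4], by simp [z3, h10, h21.symm], Or.inl (by simp [z3])⟩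
    intro t t' htt
    fin_cases t <;> fin_cases t' <;> first
      | exact absurd rfl htt
      | exact Or.inl (by assumption)
      | exact Or.inr (by assumption)
  · intro p hp hg U y y0 h
    by_cases h0 : y0 (c 0) = 0
    · by_cases h1 : y0 (c 1) = 0
      · by_cases h2 : y0 (c 2) = 0
        · exact ⟨4, h.lifts_full hcF hci hg fun r => by fin_cases r <;> assumption⟩
        · exact ⟨2, h.lifts_pair hcF hci hg (by decide) h0 h1 h2⟩
      · by_cases h2 : y0 (c 2) = 0
        · exact ⟨3, h.lifts_pair hcF hci hg (by decide) h0 h2 h1⟩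
        · exact ⟨1, h.lifts_single hcF hcne hg h0 h1 h2⟩
    · exact ⟨0, h.lifts_triv h0⟩

end

section

variable {ι : Type} [Fintype ι] {i0 : ι} {F : Finset (Fin 4)}

lemma critCount_empty (i0 : ι) : CritCount i0 ∅ 0 := by
  intro p _
  have : critSet i0 ∅ p = ∅ := by
    ext y
    simp only [Set.mem_empty_iff_false, iff_false]
    intro h
    have h0 : y = 0 := funext fun k => h.1 k (by simp)
    have := h.2.2.2
    simp [h0] at this
  rw [this]
  simp

lemma critCount_singleton (i0 : ι) (k : Fin 4) : CritCount i0 {k} 1 := by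
  intro p hp
  have hl : ∀ i k, p i 0 k ≠ 0 := fun i k => hp.minors.apply_ne_zero i 0 k
  have hdot : ∀ y : V4, (∀ l ∉ ({k} : Finset (Fin 4)), y l = 0) → p i0 0 ⬝ᵥ y = p i0 0 k * y k := by
    intro y hy
    rw [dotProduct, Finset.sum_eq_single k]
    · intro b _ hb
      rw [hy b (by simpa using hb), mul_zero]
    · simp
  have : critSet i0 {k} p = {Pi.single k (p i0 0 k)⁻¹} := by
    refine Set.Subset.antisymm (fun y hy => ?_) (by simpa using single_mem_critSet hl i0 k)
    have h1 := hdot y hy.1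
    rw [hy.2.2.2] at h1
    refine funext fun l => ?_
    by_cases hlk : l = k
    · subst hlk
      simpa using eq_inv_of_mul_eq_one_right h1.symm
    · rw [hy.1 l (by simpa using hlk)]
      simp [hlk]
  rw [this]
  refine ⟨Set.finite_singleton _, Set.ncard_singleton _, ?_⟩
  intro y _ δ h1 _ h3
  rw [hdot δ h1] at h3
  refine funext fun l => ?_
  by_cases hlk : l = k
  · subst hlk
    exact (mul_eq_zero.1 h3).resolve_left (hl _ _)
  · exact h1 l (by simpa using hlk)

/-- One camera whose forms are the available coordinates. -/
lemma critCount_one {c : Fin 3 → Fin 4} (hc : Forms c F) (hF : F.card ≤ 3) :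
    CritCount (none : Option Empty) F 1 := by
  let p : Fam Empty := fun i => i.elim
  have hm : Minors p := by
    intro s e f
    by_cases hs : s = 0
    · subst hs; simp
    · exact (e ⟨0, Nat.pos_of_ne_zero fun h => hs (Fin.ext h)⟩).1.elim
  have hFim : ∀ k ∈ F, ∃ r, c r = k := by
    intro k hk
    have := hc.sdiff_eq_empty hF
    rw [Finset.sdiff_eq_empty_iff_subset] at this
    simpa using this hk
  have hgrad : ∀ y, grad (extFam p (camAt c 1)) y = gradOne (camAt c 1) y := by
    intro y; rw [grad_extFam]; simp [grad]
  have hhess : ∀ y δ, hess (extFam p (camAt c 1)) y δ = hessOne (camAt c 1) y δ := by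
    intro y δ; rw [hess, Fintype.sum_option]; simp [extFam]
  have h0 : c 0 ≠ c 1 ∧ c 0 ≠ c 2 := ⟨(hc.ne 1 (by decide)).symm, (hc.ne 2 (by decide)).symm⟩
  have hset : critSet (none : Option Empty) F (extFam p (camAt c 1)) = {Pi.single (c 0) 1} := by
    ext y
    simp only [critSet, hgrad, Set.mem_ofPred_eq, Set.mem_singleton_iff]
    constructor
    · rintro ⟨h1, -, h3, h4⟩
      have hy0 : y (c 0) = 1 := by simpa [extFam, camAt] using h4
      have hg1 := h3 (c 1) (hc.mem 1)
      have hg2 := h3 (c 2) (hc.mem 2)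
      simp only [gradOne, Fin.sum_univ_three, camAt_one, coef, Pi.add_apply, Pi.smul_apply,
        single_dotProduct, Matrix.cons_val, one_mul, hy0, one_pow, div_one, smul_eq_mul,
        Pi.single_apply, h0.1.symm, h0.2.symm, if_false, mul_zero, zero_add, if_true, mul_one] at hg1 hg2
      have hy12 : y (c 1) = 0 ∧ y (c 2) = 0 := by
        rcases hc.inj with h | ⟨h, -⟩
        · have := h.ne (show (1 : Fin 3) ≠ 2 by decide)
          simp [this, this.symm] at hg1 hg2
          exact ⟨hg2, hg1⟩
        · rw [h] at hg1 ⊢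
          simp at hg1
          exact ⟨hg1, hg1⟩
      funext k
      by_cases hk : k ∈ F
      · obtain ⟨r, rfl⟩ := hFim k hk
        fin_cases r
        · simpa using hy0
        · simp [hy12, h0.1.symm]
        · simp [hy12, h0.2.symm]
      · have : k ≠ c 0 := fun h => hk (h ▸ hc.mem 0)
        rw [h1 k hk]; simp [this]
    · rintro rfl
      refine ⟨fun k hk => ?_, ?_, fun k _ => ?_, by simp [extFam, camAt]⟩
      · have : k ≠ c 0 := fun h => hk (h ▸ hc.mem 0)
        simp [this]
      · rintro (_ | i)
        · simp [extFam, camAt]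
        · exact i.elim
      · simp [gradOne, Fin.sum_univ_three, coef, camAt_one, h0.1.symm, h0.2.symm]
  refine critCount_of_example (gen1_extFam hm hc one_ne_zero) (gen3_extFam hm hc one_ne_zero) ?_
    (by rw [hset]; exact Set.finite_singleton _) (by rw [hset]; exact Set.ncard_singleton _) ?_
  · rintro y hy hy0 (_ | i) - hr
    · have h' : ∀ r, y (c r) = 0 := fun r => (camAt_dot one_ne_zero r y).1 (hr r)
      have := sdiff_image_supp hy h'
      rw [hc.sdiff_eq_empty hF] at this
      exact absurd (funext fun k => this k (by simp)) hy0
    · exact i.elim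
  · intro y hy δ h1 h2 h3
    rw [hset, Set.mem_singleton_iff] at hy
    subst hy
    simp only [hhess] at h2
    have hδ0 : δ (c 0) = 0 := by simpa [extFam, camAt] using h3
    have hg1 := h2 (c 1) (hc.mem 1)
    have hg2 := h2 (c 2) (hc.mem 2)
    simp only [hessOne, Fin.sum_univ_three, camAt_one, dcoef, Pi.add_apply, Pi.smul_apply,
      single_dotProduct, Matrix.cons_val, one_mul, hδ0, smul_eq_mul,
      Pi.single_apply, h0.1.symm, h0.2.symm, if_false, mul_zero, zero_add, if_true, mul_one,
      one_pow, div_one, zero_mul, sub_zero] at hg1 hg2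
    have hy12 : δ (c 1) = 0 ∧ δ (c 2) = 0 := by
      rcases hc.inj with h | ⟨h, -⟩
      · have := h.ne (show (1 : Fin 3) ≠ 2 by decide)
        simp [this, this.symm] at hg1 hg2
        exact ⟨hg2, hg1⟩
      · rw [h] at hg1 ⊢
        simp at hg1
        exact ⟨hg1, hg1⟩
    funext k
    by_cases hk : k ∈ F
    · obtain ⟨r, rfl⟩ := hFim k hk
      fin_cases r
      · exact hδ0
      · exact hy12.1
      · exact hy12.2
    · exact h1 k hk

end

section

/-- Two cameras with six critical points. -/
def twoCams : Fam (Fin 2) :=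
  ![![![1, 0, 0, 0], ![0, 1, 1, 0], ![0, 1, -1, 0]],
    ![![0, 0, 0, 1], ![6 / 5, 1, Complex.I, 2], ![6 / 5, 1, -Complex.I, 2]]]

section TwoCams
variable (y δ : V4)

lemma twoCams_dot :
    twoCams 0 0 ⬝ᵥ y = y 0 ∧ twoCams 0 1 ⬝ᵥ y = y 1 + y 2 ∧ twoCams 0 2 ⬝ᵥ y = y 1 - y 2 ∧
    twoCams 1 0 ⬝ᵥ y = y 3 ∧
    twoCams 1 1 ⬝ᵥ y = 6 / 5 * y 0 + y 1 + 2 * y 3 + Complex.I * y 2 ∧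
    twoCams 1 2 ⬝ᵥ y = 6 / 5 * y 0 + y 1 + 2 * y 3 - Complex.I * y 2 := by
  refine ⟨?_, ?_, ?_, ?_, ?_, ?_⟩ <;> simp [twoCams, dotProduct, Fin.sum_univ_four] <;> ring

lemma twoCams_grad (h0 : y 0 ≠ 0) (h3 : y 3 ≠ 0) :
    grad twoCams y 1 = 2 * (y 1 / y 0 ^ 2 + (6 / 5 * y 0 + y 1 + 2 * y 3) / y 3 ^ 2) ∧
    grad twoCams y 2 = 2 * (-y 2 / y 0 ^ 2 + y 2 / y 3 ^ 2) ∧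
    grad twoCams y 3 = 2 * (2 * (6 / 5 * y 0 + y 1 + 2 * y 3) / y 3 ^ 2
      - ((6 / 5 * y 0 + y 1 + 2 * y 3) ^ 2 + y 2 ^ 2) / y 3 ^ 3) := by
  obtain ⟨a, b, c, d, e, f⟩ := twoCams_dot y
  refine ⟨?_, ?_, ?_⟩ <;>
  · simp only [grad, Fin.sum_univ_two, gradOne, Fin.sum_univ_three, coef, a, b, c, d, e, f]
    simp [twoCams]
    field_simp
    ring_nf
    try simp
    try ring

lemma twoCams_hess (h0 : y 0 = 1) (hδ : δ 0 = 0) (h3 : y 3 ≠ 0) :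
    hess twoCams y δ 1 = 2 * (δ 1 + (δ 1 + 2 * δ 3) / y 3 ^ 2
      - 2 * (6 / 5 + y 1 + 2 * y 3) * δ 3 / y 3 ^ 3) ∧
    hess twoCams y δ 2 = 2 * (-δ 2 + δ 2 / y 3 ^ 2 - 2 * y 2 * δ 3 / y 3 ^ 3) ∧
    hess twoCams y δ 3 = 2 * (2 * (δ 1 + 2 * δ 3) / y 3 ^ 2
      - 4 * (6 / 5 + y 1 + 2 * y 3) * δ 3 / y 3 ^ 3
      - 2 * ((6 / 5 + y 1 + 2 * y 3) * (δ 1 + 2 * δ 3) + y 2 * δ 2) / y 3 ^ 3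
      + 3 * ((6 / 5 + y 1 + 2 * y 3) ^ 2 + y 2 ^ 2) * δ 3 / y 3 ^ 4) := by
  obtain ⟨a, b, c, d, e, f⟩ := twoCams_dot y
  obtain ⟨a', b', c', d', e', f'⟩ := twoCams_dot δ
  refine ⟨?_, ?_, ?_⟩ <;>
  · simp only [hess, Fin.sum_univ_two, hessOne, Fin.sum_univ_three, dcoef, a, b, c, d, e, f,
      a', b', c', d', e', f', h0, hδ]
    simp [twoCams]
    field_simp
    ring_nf
    try simp
    try ring

end TwoCams

lemma twoCams_gen1 : Gen1 Finset.univ twoCams := by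
  intro y _ hy c hc hs
  obtain ⟨d00, d01, d02, d10, d11, d12⟩ := twoCams_dot y
  have h0 := hs 0 (by simp)
  have h1 := hs 1 (by simp)
  have h2 := hs 2 (by simp)
  have h3 := hs 3 (by simp)
  simp only [Fin.sum_univ_two, Fin.sum_univ_three] at h0 h1 h2 h3
  simp [twoCams] at h0 h1 h2 h3
  have k (i r) (h : ¬ (twoCams i 0 ⬝ᵥ y = 0 ∧ twoCams i r ⬝ᵥ y = 0)) : c i r = 0 := by
    by_contra hne; exact h (hc i r hne)
  suffices c 0 0 = 0 ∧ c 0 1 = 0 ∧ c 0 2 = 0 ∧ c 1 0 = 0 ∧ c 1 1 = 0 ∧ c 1 2 = 0 by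
    funext i r
    fin_cases i <;> fin_cases r <;> simp [this]
  have hI : Complex.I ≠ 0 := Complex.I_ne_zero
  by_cases hy0 : y 0 = 0
  · by_cases hy3 : y 3 = 0
    · have hor : y 1 ≠ 0 ∨ y 2 ≠ 0 := by
        by_contra! h
        exact hy (funext fun i => by fin_cases i <;> simp [hy0, hy3, h])
      have key : ∀ a b u v : ℂ, a ≠ b → (u ≠ 0 → y 1 + a * y 2 = 0) → (v ≠ 0 → y 1 + b * y 2 = 0) →
          u = 0 ∨ v = 0 := by
        intro a b u v hab hu hv
        by_contra! h
        have ha := hu h.1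
        have hb := hv h.2
        have h2 : (a - b) * y 2 = 0 := by linear_combination ha - hb
        have h2 := (mul_eq_zero.1 h2).resolve_left (sub_ne_zero.2 hab)
        have h1 : y 1 = 0 := by simpa [h2] using ha
        simp [h1, h2] at hor
      have l1 : c 0 1 ≠ 0 → y 1 + 1 * y 2 = 0 := fun h => by
        have := (hc 0 1 h).2; rw [d01] at this; linear_combination this
      have l2 : c 0 2 ≠ 0 → y 1 + (-1) * y 2 = 0 := fun h => by
        have := (hc 0 2 h).2; rw [d02] at this; linear_combination this
      have l3 : c 1 1 ≠ 0 → y 1 + Complex.I * y 2 = 0 := fun h => by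
        have := (hc 1 1 h).2; rw [d11] at this; linear_combination this - 6 / 5 * hy0 - 2 * hy3
      have l4 : c 1 2 ≠ 0 → y 1 + (-Complex.I) * y 2 = 0 := fun h => by
        have := (hc 1 2 h).2; rw [d12] at this; linear_combination this - 6 / 5 * hy0 - 2 * hy3
      have n1 : (1 : ℂ) ≠ -1 := by norm_num
      have n2 : (1 : ℂ) ≠ Complex.I := fun h => by simpa using congrArg Complex.re h
      have n3 : (1 : ℂ) ≠ -Complex.I := fun h => by simpa using congrArg Complex.re h
      have n4 : (-1 : ℂ) ≠ Complex.I := fun h => by simpa using congrArg Complex.re h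
      have n5 : (-1 : ℂ) ≠ -Complex.I := fun h => by simpa using congrArg Complex.re h
      have n6 : Complex.I ≠ -Complex.I := fun h => by
        have := congrArg Complex.im h; norm_num at this
      have k12 := key _ _ _ _ n1 l1 l2
      have k13 := key _ _ _ _ n2 l1 l3
      have k14 := key _ _ _ _ n3 l1 l4
      have k23 := key _ _ _ _ n4 l2 l3
      have k24 := key _ _ _ _ n5 l2 l4
      have k34 := key _ _ _ _ n6 l3 l4
      have z : c 0 1 = 0 ∧ c 0 2 = 0 ∧ c 1 1 = 0 ∧ c 1 2 = 0 := by
        clear hs hc k h0 h2 h3 l1 l2 l3 l4 key d00 d01 d02 d10 d11 d12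
        grind
      obtain ⟨z1, z2, z3, z4⟩ := z
      simp [z3, z4] at h0 h3
      exact ⟨h0, z1, z2, h3, z3, z4⟩
    · have a := k 1 0 (by simp [d10, hy3])
      have b := k 1 1 (by simp [d10, hy3])
      have e := k 1 2 (by simp [d10, hy3])
      simp [a, b, e] at h0 h1 h2 h3 ⊢
      refine ⟨h0, ?_, ?_⟩
      · linear_combination (h1 + h2) / 2
      · linear_combination (h1 - h2) / 2
  · have a := k 0 0 (by simp [d00, hy0])
    have b := k 0 1 (by simp [d00, hy0])
    have e := k 0 2 (by simp [d00, hy0])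
    simp [a, b, e] at h0 h1 h2 h3 ⊢
    have h5 : c 1 1 - c 1 2 = 0 := by
      have : Complex.I * (c 1 1 - c 1 2) = 0 := by linear_combination h2
      exact (mul_eq_zero.1 this).resolve_left hI
    have e1 : c 1 1 = 0 := by linear_combination (h1 + h5) / 2
    have e2 : c 1 2 = 0 := by linear_combination (h1 - h5) / 2
    exact ⟨by linear_combination h3 - 2 * e1 - 2 * e2, e1, e2⟩

lemma twoCams_gen3 : Gen3 Finset.univ twoCams := by
  intro y _ hy i j hij hc
  obtain ⟨d00, d01, d02, d10, d11, d12⟩ := twoCams_dot y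
  fin_cases i <;> fin_cases j
  · simp at hij
  · have a := hc 0
    have b := hc 1
    have e := hc 2
    simp only [Fin.mk_one, Fin.zero_eta, d00, d01, d02, d10] at a b e ⊢
    intro h
    have y1 : y 1 = 0 := by linear_combination (b + e) / 2
    have y2 : y 2 = 0 := by linear_combination (b - e) / 2
    exact hy (funext fun i => by fin_cases i <;> simp [a, y1, y2, h])
  · have a := hc 0
    have b := hc 1
    have e := hc 2
    simp only [Fin.mk_one, Fin.zero_eta, d00, d10, d11, d12] at a b e ⊢
    intro h
    have y2 : Complex.I * y 2 = 0 := by linear_combination (b - e) / 2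
    have y1 : y 1 = 0 := by linear_combination (b + e) / 2 - 6 / 5 * h - 2 * a
    have y2 := (mul_eq_zero.1 y2).resolve_left Complex.I_ne_zero
    exact hy (funext fun i => by fin_cases i <;> simp [a, y1, y2, h])
  · simp at hij

lemma twoCams_gen2 : Gen2 Finset.univ twoCams 1 := by
  intro y _ hy i _ hc
  obtain ⟨d00, d01, d02, d10, d11, d12⟩ := twoCams_dot y
  have hne := twoCams_gen3 y (by simp) hy
  fin_cases i
  · have h3 := hne 0 1 (by simp) hc
    rw [d10] at h3
    refine ⟨![1, 0, 0, 0], by simp, ?_, ?_, ?_⟩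
    · simp [(twoCams_dot ![1, 0, 0, 0]).2.1]
    · simp [(twoCams_dot ![1, 0, 0, 0]).2.2.1]
    intro s h0 h1
    rw [Fin.sum_univ_two]
    have h1 := h1 1 (by simp)
    simp only [Fin.zero_eta] at h0
    rw [h0, h1, zero_add, gradOne_dot_eq _ _ _ (by rwa [d10]), gradNum]
    obtain ⟨-, -, -, e10, e11, e12⟩ := twoCams_dot ![1, 0, 0, 0]
    have a := hc 0
    have b := hc 1
    have e := hc 2
    simp only [Fin.zero_eta, d00, d01, d02] at a b e
    rw [e10, e11, e12, d10, d11, d12]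
    have y1 : y 1 = 0 := by linear_combination (b + e) / 2
    have y2 : y 2 = 0 := by linear_combination (b - e) / 2
    simp [a, y1, y2, h3]
  · have h3 := hne 1 0 (by simp) hc
    rw [d00] at h3
    refine ⟨![1, 0, 0, -3 / 5], by simp, ?_, ?_, ?_⟩
    · simp [(twoCams_dot ![1, 0, 0, -3 / 5]).2.2.2.2.1]; ring
    · simp [(twoCams_dot ![1, 0, 0, -3 / 5]).2.2.2.2.2]; ring
    intro s h0 h1
    rw [Fin.sum_univ_two]
    have h1 := h1 0 (by simp)
    simp only [Fin.mk_one] at h0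
    rw [h0, h1, add_zero, gradOne_dot_eq _ _ _ (by rwa [d00]), gradNum]
    obtain ⟨e10, e11, e12, -⟩ := twoCams_dot ![1, 0, 0, -3 / 5]
    have a := hc 0
    have b := hc 1
    have e := hc 2
    simp only [Fin.mk_one, d10, d11, d12] at a b e
    rw [e10, e11, e12, d00, d01, d02]
    have y2 : Complex.I * y 2 = 0 := by linear_combination (b - e) / 2
    have y2 := (mul_eq_zero.1 y2).resolve_left Complex.I_ne_zero
    have y1 : y 1 = - (6 / 5) * y 0 := by linear_combination (b + e) / 2 - 2 * a
    simp [y1, y2, h3]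

lemma twoCams_critSet : critSet 0 Finset.univ twoCams =
    (({![1, 0, 0, -3 / 5], ![1, -6 / 5, 0, 5 / 3], ![1, -8 / 5, 4 / 5, 1], ![1, -8 / 5, -4 / 5, 1],
      ![1, 2 / 5, 4 / 5, -1], ![1, 2 / 5, -4 / 5, -1]} : Finset V4) : Set V4) := by
  ext y
  obtain ⟨d00, d01, d02, d10, d11, d12⟩ := twoCams_dot y
  have hmem : y ∈ critSet 0 Finset.univ twoCams ↔ y 0 = 1 ∧ y 3 ≠ 0 ∧
      y 1 * y 3 ^ 2 + (6 / 5 + y 1 + 2 * y 3) = 0 ∧ y 2 * (1 - y 3 ^ 2) = 0 ∧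
      2 * (6 / 5 + y 1 + 2 * y 3) * y 3 = (6 / 5 + y 1 + 2 * y 3) ^ 2 + y 2 ^ 2 := by
    have hspl : (∀ i, twoCams i 0 ⬝ᵥ y ≠ 0) ↔ y 0 ≠ 0 ∧ y 3 ≠ 0 := by
      rw [Fin.forall_fin_two, d00, d10]
    constructor
    · rintro ⟨-, h, hg, h1⟩
      obtain ⟨h0, h3⟩ := hspl.1 h
      rw [d00] at h1
      obtain ⟨g1, g2, g3⟩ := twoCams_grad y h0 h3
      rw [hg _ (Finset.mem_univ _), h1] at g1 g2 g3
      field_simp at g1 g2 g3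
      refine ⟨h1, h3, ?_, ?_, ?_⟩
      · linear_combination -g1 / 10
      · linear_combination -g2 / 2
      · linear_combination -g3 / 50
    · rintro ⟨h0, h3, h1, h2, h4⟩
      have h0' : y 0 ≠ 0 := by rw [h0]; exact one_ne_zero
      have hl := hspl.2 ⟨h0', h3⟩
      obtain ⟨g1, g2, g3⟩ := twoCams_grad y h0' h3
      have e1 : grad twoCams y 1 = 0 := by
        rw [g1, h0]; field_simp; linear_combination 10 * h1
      have e2 : grad twoCams y 2 = 0 := by
        rw [g2, h0]; field_simp; linear_combination 2 * h2
      have e3 : grad twoCams y 3 = 0 := by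
        rw [g3, h0]; field_simp; linear_combination 50 * h4
      have e0 : grad twoCams y 0 = 0 := by
        have := grad_dot twoCams y hl
        simpa [dotProduct, Fin.sum_univ_four, e1, e2, e3, h0] using this
      refine ⟨by simp, hl, fun k _ => ?_, by rw [d00, h0]⟩
      fin_cases k <;> assumption
  rw [hmem]
  have hy : ∀ a b c d : ℂ, y = ![a, b, c, d] ↔ y 0 = a ∧ y 1 = b ∧ y 2 = c ∧ y 3 = d := by
    intro a b c d
    rw [funext_iff]; simp [Fin.forall_fin_succ]
  simp only [Finset.coe_insert, Finset.coe_singleton, Set.mem_insert_iff, Set.mem_singleton_iff, hy]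
  constructor
  · rintro ⟨h0, h3, h1, h2, h4⟩
    simp only [h0, true_and]
    have hz : (y 3 - 1) * (y 3 + 1) = 0 ∨ y 2 = 0 := by
      rcases mul_eq_zero.1 h2 with h | h
      · exact Or.inr h
      · left; linear_combination -h
    rcases hz with hz | hz
    · rcases mul_eq_zero.1 hz with hz | hz
      · have z1 : y 3 = 1 := by linear_combination hz
        have s1 : y 1 = -8 / 5 := by rw [z1] at h1; linear_combination h1 / 2
        have : (y 2 - 4 / 5) * (y 2 + 4 / 5) = 0 := by
          rw [z1, s1] at h4; linear_combination -h4
        rcases mul_eq_zero.1 this with h | h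
        · right; right; left; exact ⟨s1, by linear_combination h, z1⟩
        · right; right; right; left; exact ⟨s1, by linear_combination h, z1⟩
      · have z1 : y 3 = -1 := by linear_combination hz
        have s1 : y 1 = 2 / 5 := by rw [z1] at h1; linear_combination h1 / 2
        have : (y 2 - 4 / 5) * (y 2 + 4 / 5) = 0 := by
          rw [z1, s1] at h4; linear_combination -h4
        rcases mul_eq_zero.1 this with h | h
        · right; right; right; right; left; exact ⟨s1, by linear_combination h, z1⟩
        · right; right; right; right; right; exact ⟨s1, by linear_combination h, z1⟩
    · have : (6 / 5 + y 1 + 2 * y 3) * (6 / 5 + y 1) = 0 := by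
        rw [hz] at h4; linear_combination -h4
      rcases mul_eq_zero.1 this with h | h
      · have : y 1 * y 3 ^ 2 = 0 := by linear_combination h1 - h
        have s1 := (mul_eq_zero.1 this).resolve_right (pow_ne_zero 2 h3)
        left; exact ⟨s1, hz, by linear_combination (h - s1) / 2⟩
      · have s1 : y 1 = -6 / 5 := by linear_combination h
        have : y 3 * (5 / 3 - y 3) = 0 := by rw [s1] at h1; linear_combination 5 / 6 * h1
        have := (mul_eq_zero.1 this).resolve_left h3
        right; left; exact ⟨s1, hz, by linear_combination -this⟩
  · rintro (⟨a, b, c, d⟩ | ⟨a, b, c, d⟩ | ⟨a, b, c, d⟩ | ⟨a, b, c, d⟩ | ⟨a, b, c, d⟩ | ⟨a, b, c, d⟩) <;>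
      rw [a, b, c, d] <;> norm_num

lemma critCount_twoCams : CritCount (0 : Fin 2) Finset.univ 6 := by
  refine critCount_of_example twoCams_gen1 twoCams_gen3 twoCams_gen2 ?_ ?_ ?_
  · rw [twoCams_critSet]; exact Finset.finite_toSet _
  · rw [twoCams_critSet, Set.ncard_coe_finset]
    have hne : ∀ a b c d a' b' c' d' : ℂ, ![a, b, c, d] = ![a', b', c', d'] ↔
        a = a' ∧ b = b' ∧ c = c' ∧ d = d' := by
      intro a b c d a' b' c' d'
      rw [funext_iff]; simp [Fin.forall_fin_succ]
    repeat rw [Finset.card_insert_of_notMem]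
    · simp
    all_goals
      simp only [Finset.mem_insert, Finset.mem_singleton, hne]
      norm_num
  · intro y hy δ _ h2 h0
    rw [(twoCams_dot δ).1] at h0
    rw [twoCams_critSet] at hy
    have hδ : δ 1 = 0 ∧ δ 2 = 0 ∧ δ 3 = 0 → δ = 0 := fun h =>
      funext fun k => by fin_cases k <;> simp [h, h0]
    have h2' : ∀ k, hess twoCams y δ k = 0 := fun k => h2 k (Finset.mem_univ k)
    have hcoord : ∀ a b c d : ℂ, y = ![a, b, c, d] ↔ y 0 = a ∧ y 1 = b ∧ y 2 = c ∧ y 3 = d := by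
      intro a b c d
      rw [funext_iff]; simp [Fin.forall_fin_succ]
    simp only [Finset.coe_insert, Finset.coe_singleton, Set.mem_insert_iff,
      Set.mem_singleton_iff, hcoord] at hy
    rcases hy with ⟨a, b, c, d⟩ | ⟨a, b, c, d⟩ | ⟨a, b, c, d⟩ | ⟨a, b, c, d⟩ | ⟨a, b, c, d⟩ |
      ⟨a, b, c, d⟩ <;>
    · obtain ⟨g1, g2, g3⟩ := twoCams_hess y δ a h0 (by rw [d]; norm_num)
      rw [h2', b, d] at g1 g3
      rw [h2', c, d] at g2
      rw [c] at g3
      norm_num at g1 g2 g3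
      clear h2 h2' hcoord
      refine hδ ⟨?_, ?_, ?_⟩ <;> grind

end

lemma critSet_equiv {ι ι' : Type} [Fintype ι] [Fintype ι'] (e : ι ≃ ι') (i0 : ι)
    (F : Finset (Fin 4)) (p : Fam ι') :
    critSet i0 F (fun i => p (e i)) = critSet (e i0) F p := by
  have hg : ∀ y, grad (fun i => p (e i)) y = grad p y := fun y =>
    Equiv.sum_comp e fun i => gradOne (p i) y
  ext y
  simp only [critSet, hg, Set.mem_ofPred_eq]
  rw [e.forall_congr_left]
  simp

lemma CritCount.equiv {ι ι' : Type} [Fintype ι] [Fintype ι'] (e : ι ≃ ι') {i0 : ι}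
    {F : Finset (Fin 4)} {N : ℕ} (h : CritCount i0 F N) : CritCount (e i0) F N := by
  intro p hp
  have hi : Indep fun i => p (e i) :=
    hp.comp (fun t : ι × Fin 3 × Fin 4 => (e t.1, t.2)) fun s t hst => by
      simp only [Prod.mk.injEq, EmbeddingLike.apply_eq_iff_eq] at hst
      exact Prod.ext hst.1 hst.2
  obtain ⟨h1, h2, h3⟩ := h _ hi
  rw [critSet_equiv] at h1 h2 h3
  refine ⟨h1, h2, fun y hy δ a b c => h3 y hy δ a ?_ c⟩
  have hh : hess (fun i => p (e i)) y δ = hess p y δ :=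
    Equiv.sum_comp e fun i => hessOne (p i) y δ
  rwa [hh]

lemma exists_equiv_map_eq {ι ι' : Type} [Fintype ι] [Fintype ι']
    (h : Fintype.card ι = Fintype.card ι') (i : ι) (i' : ι') : ∃ e : ι ≃ ι', e i = i' := by
  classical
  let e := Fintype.equivOfCardEq h
  exact ⟨e.trans (Equiv.swap (e i) i'), by simp⟩

/-- Twice the number of critical points for `n` cameras and `m` free coordinates. -/
def critPoly (n : ℤ) : ℕ → ℤ
  | 0 => 0
  | 1 => 2
  | 2 => 6 * n - 4
  | 3 => 9 * n ^ 2 - 13 * n + 6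
  | _ => 9 * n ^ 3 - 21 * n ^ 2 + 16 * n - 8

lemma Indep.gen2 {ι : Type} [Fintype ι] {p : Fam ι} (hp : Indep p) {F : Finset (Fin 4)}
    (h : F.card ≤ 3 ∨ 2 ≤ Fintype.card ι) : Gen2 F p 1 := by
  rcases h with h | h
  · exact hp.minors.gen2_of_card h 1
  · exact gen2_of_centrePoly hp.minors
      (GenQ.indep (P := fun p => ∀ i, centrePoly p i ≠ 0) (genQ_centrePoly h) hp) F

lemma exists_critCount_card_le_one {ι : Type} [Fintype ι] (i0 : ι) {F : Finset (Fin 4)}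
    (hF : F.card ≤ 1) (n : ℤ) : ∃ N : ℕ, CritCount i0 F N ∧ (2 * N : ℤ) = critPoly n F.card := by
  rcases Nat.le_one_iff_eq_zero_or_eq_one.1 hF with h | h
  · rw [h, Finset.card_eq_zero.1 h]
    exact ⟨0, critCount_empty i0, rfl⟩
  · rw [h]
    obtain ⟨k, rfl⟩ := Finset.card_eq_one.1 h
    exact ⟨1, critCount_singleton i0 k, rfl⟩

lemma exists_critCount_one {F : Finset (Fin 4)} (hF : F.card ≤ 3) :
    ∃ N : ℕ, CritCount (none : Option Empty) F N ∧ (2 * N : ℤ) = critPoly 1 F.card := by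
  rcases Nat.lt_or_ge F.card 2 with h | h
  · exact exists_critCount_card_le_one _ (by omega) 1
  refine ⟨1, ?_, ?_⟩
  · rcases Nat.lt_or_ge F.card 3 with h3 | h3
    · obtain ⟨a, b, hab, rfl⟩ := Finset.card_eq_two.1 (by omega : F.card = 2)
      refine critCount_one (c := ![a, b, b]) ⟨?_, ?_, Or.inr ⟨rfl, rfl⟩⟩ hF
      · intro r; fin_cases r <;> simp
      · intro r; fin_cases r <;> simp [hab.symm]
    · let c := F.orderEmbOfCardLe h3
      exact critCount_one (c := c) ⟨fun r => F.orderEmbOfCardLe_mem h3 r,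
        fun r hr => c.injective.ne hr, Or.inl c.injective⟩ hF
  · have : F.card = 2 ∨ F.card = 3 := by omega
    rcases this with h | h <;> rw [h] <;> norm_num [critPoly]

lemma exists_critCount_succ {ι : Type} [Fintype ι] {i0 : ι} {F : Finset (Fin 4)}
    (hF : F.card ≤ 3 ∨ 2 ≤ Fintype.card ι)
    (h : ∀ F' ⊆ F, ∃ N : ℕ, CritCount i0 F' N ∧ (2 * N : ℤ) = critPoly (Fintype.card ι) F'.card) :
    ∃ N : ℕ, CritCount (some i0) F N ∧
      (2 * N : ℤ) = critPoly (Fintype.card ι + 1) F.card := by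
  rcases Nat.lt_or_ge F.card 2 with h1 | h1
  · exact exists_critCount_card_le_one _ (by omega) _
  have h' : ∀ F', ∃ N : ℕ, F' ⊆ F → CritCount i0 F' N ∧
      (2 * N : ℤ) = critPoly (Fintype.card ι) F'.card := by
    intro F'
    by_cases hF' : F' ⊆ F
    · obtain ⟨N, hN⟩ := h F' hF'
      exact ⟨N, fun _ => hN⟩
    · exact ⟨0, fun h => absurd h hF'⟩
  choose N hN using h'
  have hC : ∀ F' ⊆ F, CritCount i0 F' (N F') := fun F' h => (hN F' h).1
  have hgen : ∀ p : Fam ι, Indep p → Gen2 F p 1 := fun p hp => hp.gen2 hF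
  rcases Nat.lt_or_ge F.card 3 with h3 | h3
  · obtain ⟨a, b, hab, rfl⟩ := Finset.card_eq_two.1 (by omega : F.card = 2)
    refine ⟨_, critCount_extend_two hab hC hgen, ?_⟩
    have e1 := (hN {a, b} subset_rfl).2
    have e2 := (hN {b} (by simp)).2
    rw [Finset.card_pair hab] at e1 ⊢
    rw [Finset.card_singleton] at e2
    simp only [critPoly] at e1 e2 ⊢
    push_cast
    linarith
  · let c := F.orderEmbOfCardLe h3
    have hc : ∀ r, c r ∈ F := fun r => F.orderEmbOfCardLe_mem h3 r
    have hpos : 0 < Fintype.card ι := Fintype.card_pos_iff.2 ⟨i0⟩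
    have h4 : F.card ≤ 4 := F.card_le_univ
    refine ⟨_, critCount_extend_three hc c.injective hC (by omega) hgen, ?_⟩
    have hd : ∀ s : Finset (Fin 3), (F \ s.image c).card = F.card - s.card := fun s => by
      rw [Finset.card_sdiff_of_subset (Finset.image_subset_iff.2 fun r _ => hc r),
        Finset.card_image_of_injective _ c.injective]
    have e0 := (hN F subset_rfl).2
    have e1 := (hN (F \ {c 0}) Finset.sdiff_subset).2
    have e2 := (hN (F \ {c 0, c 1}) Finset.sdiff_subset).2
    have e3 := (hN (F \ {c 0, c 2}) Finset.sdiff_subset).2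
    have e4 := (hN (F \ Finset.univ.image c) Finset.sdiff_subset).2
    rw [show (F \ {c 0}).card = F.card - 1 by simpa using hd {0}] at e1
    rw [show (F \ {c 0, c 1}).card = F.card - 2 by simpa [Finset.image_insert] using hd {0, 1}] at e2
    rw [show (F \ {c 0, c 2}).card = F.card - 2 by simpa [Finset.image_insert] using hd {0, 2}] at e3
    rw [hd, Finset.card_univ, Fintype.card_fin] at e4
    have : F.card = 3 ∨ F.card = 4 := by omega
    push_cast
    rcases this with h | h <;> rw [h] at e0 e1 e2 e3 e4 ⊢ <;>
      simp only [critPoly, Nat.reduceSub] at e0 e1 e2 e3 e4 ⊢ <;>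
      linear_combination e0 + 3 * e1 + 2 * e2 + 2 * e3 + e4

lemma exists_critCount (n : ℕ) : ∀ (ι : Type) [Fintype ι] (i0 : ι) (F : Finset (Fin 4)),
    Fintype.card ι = n + 1 → (F.card ≤ 3 ∨ 1 ≤ n) →
    ∃ N : ℕ, CritCount i0 F N ∧ (2 * N : ℤ) = critPoly (n + 1) F.card := by
  induction n with
  | zero =>
    intro ι _ i0 F hι hF
    obtain ⟨e, rfl⟩ := exists_equiv_map_eq (ι := Option Empty) (by simp [hι]) none i0
    obtain ⟨N, h, h'⟩ := exists_critCount_one (F := F) (by omega)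
    exact ⟨N, h.equiv e, by simpa using h'⟩
  | succ n ih =>
    intro ι _ i0 F hι hF
    by_cases hb : n = 0 ∧ F.card = 4
    · obtain ⟨rfl, hF4⟩ := hb
      obtain ⟨e, rfl⟩ := exists_equiv_map_eq (ι := Fin 2) (by simp [hι]) 0 i0
      have : F = Finset.univ := Finset.eq_univ_of_card _ (by simp [hF4])
      subst this
      refine ⟨6, critCount_twoCams.equiv e, ?_⟩
      rw [hF4]
      norm_num [critPoly]
    · have h4 : F.card ≤ 4 := F.card_le_univ
      obtain ⟨e, rfl⟩ := exists_equiv_map_eq (ι := Option (Fin (n + 1))) (by simp [hι]) (some 0) i0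
      have hcond : F.card ≤ 3 ∨ 1 ≤ n := by omega
      obtain ⟨N, h, h'⟩ := exists_critCount_succ (i0 := (0 : Fin (n + 1))) (F := F)
        (by rw [Fintype.card_fin]; omega) fun F' hF' => by
          have := ih (Fin (n + 1)) 0 F' (by simp)
            (hcond.imp_left (Finset.card_le_card hF').trans)
          simpa using this
      exact ⟨N, h.equiv e, by simpa using h'⟩

lemma aeval_sumElim {σ τ : Type} (P : MvPolynomial (τ ⊕ σ) ℚ) (x : σ → ℂ) (y : τ → ℂ) :
    MvPolynomial.aeval (Sum.elim y x) P =
      MvPolynomial.eval₂ (MvPolynomial.aeval (R := ℚ) x).toRingHom y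
        (MvPolynomial.sumAlgEquiv ℚ τ σ P) := by
  induction P using MvPolynomial.induction_on with
  | C a => simp
  | add p q hp hq => simp only [map_add, MvPolynomial.eval₂_add, hp, hq]
  | mul_X p s hp =>
    simp only [map_mul, MvPolynomial.eval₂_mul, hp]
    cases s <;> simp

/-- A system of equations without solutions at algebraically independent parameters has no
solutions at all parameters off a hypersurface defined over `ℚ`. -/
lemma genQ_no_solution {σ τ A : Type} [Finite σ] [Finite τ] {f : A → (τ ⊕ σ → ℂ) → ℂ}
    (hf : ∀ a, RPoly (f a))
    (h : ∀ x : σ → ℂ, AlgebraicIndependent ℚ x → ∀ y, ¬ ∀ a, f a (Sum.elim y x) = 0) :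
    GenQ fun x : σ → ℂ => ∀ y, ¬ ∀ a, f a (Sum.elim y x) = 0 := by
  choose P hP using hf
  let g : A → MvPolynomial τ (MvPolynomial σ ℚ) := fun a => MvPolynomial.sumAlgEquiv ℚ τ σ (P a)
  have hg : ∀ a x y, f a (Sum.elim y x) =
      MvPolynomial.eval₂ (MvPolynomial.aeval (R := ℚ) x).toRingHom y (g a) := fun a x y => by
    rw [hP, aeval_sumElim]
  let I : Ideal (MvPolynomial τ (MvPolynomial σ ℚ)) := Ideal.span (Set.range g)
  by_cases hI : ∃ r : MvPolynomial σ ℚ, r ≠ 0 ∧ MvPolynomial.C r ∈ I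
  · obtain ⟨r, hr, hrI⟩ := hI
    refine ⟨r, hr, fun x hx y hy => hx ?_⟩
    have hle : I ≤ RingHom.ker
        (MvPolynomial.eval₂Hom (MvPolynomial.aeval (R := ℚ) x).toRingHom y) := by
      rw [Ideal.span_le]
      rintro _ ⟨a, rfl⟩
      have := hy a
      rw [hg] at this
      simpa using this
    have := hle hrI
    simpa using this
  · exfalso
    obtain ⟨x, -, hx⟩ := exists_algebraicIndependent (σ := σ) Set.univ isOpen_univ Set.univ_nonempty
    let K := FractionRing (MvPolynomial σ ℚ)
    have hinj : Function.Injective (MvPolynomial.aeval (R := ℚ) x).toRingHom := hx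
    let φ : K →+* ℂ := IsFractionRing.lift (A := MvPolynomial σ ℚ) hinj
    have hφ : ∀ r, φ (algebraMap _ K r) = MvPolynomial.aeval (R := ℚ) x r := fun r =>
      IsFractionRing.lift_algebraMap hinj r
    let : Algebra K ℂ := φ.toAlgebra
    let J : Ideal (MvPolynomial τ K) := I.map (MvPolynomial.map (algebraMap _ K))
    let := MvPolynomial.algebraMvPolynomial (R := MvPolynomial σ ℚ) (S := K) (σ := τ)
    have hJ : J ≠ ⊤ := by
      have := (IsLocalization.map_algebraMap_ne_top_iff_disjoint
        ((nonZeroDivisors (MvPolynomial σ ℚ)).map (MvPolynomial.C (σ := τ)))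
        (MvPolynomial τ K) I).2 (by
          rw [Set.disjoint_left]
          rintro _ ⟨r, hr, rfl⟩ hrI
          exact hI ⟨r, nonZeroDivisors.ne_zero hr, hrI⟩)
      exact this
    have hz : (MvPolynomial.zeroLocus ℂ J).Nonempty := by
      by_contra hne
      rw [Set.not_nonempty_iff_eq_empty] at hne
      have := MvPolynomial.vanishingIdeal_zeroLocus_eq_radical (K := ℂ) J
      rw [hne, MvPolynomial.vanishingIdeal_empty] at this
      exact hJ (Ideal.radical_eq_top.1 this.symm)
    obtain ⟨y, hy⟩ := hz
    refine h x hx y fun a => ?_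
    have := (MvPolynomial.mem_zeroLocus_iff.1 hy) _
      (Ideal.mem_map_of_mem _ (Ideal.subset_span ⟨a, rfl⟩))
    rw [hg, ← this, MvPolynomial.aeval_def, MvPolynomial.eval₂_map]
    congr 1
    ext r
    · simp
    · exact (hφ _).symm

section

/-- `gradOne` with the inverse of the denominator as a separate argument. -/
def gradInv (q : Fin 3 → V4) (t : ℂ) (y : V4) (k : Fin 4) : ℂ :=
  -2 * (q 1 ⬝ᵥ y) * (q 2 ⬝ᵥ y) * t ^ 3 * q 0 k + (q 2 ⬝ᵥ y) * t ^ 2 * q 1 k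
    + (q 1 ⬝ᵥ y) * t ^ 2 * q 2 k

/-- `hessOne` with the inverse of the denominator as a separate argument. -/
def hessInv (q : Fin 3 → V4) (t : ℂ) (y δ : V4) (k : Fin 4) : ℂ :=
  (-2 * ((q 1 ⬝ᵥ δ) * (q 2 ⬝ᵥ y) + (q 1 ⬝ᵥ y) * (q 2 ⬝ᵥ δ)) * t ^ 3
      + 6 * (q 1 ⬝ᵥ y) * (q 2 ⬝ᵥ y) * (q 0 ⬝ᵥ δ) * t ^ 4) * q 0 k
    + ((q 2 ⬝ᵥ δ) * t ^ 2 - 2 * (q 2 ⬝ᵥ y) * (q 0 ⬝ᵥ δ) * t ^ 3) * q 1 k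
    + ((q 1 ⬝ᵥ δ) * t ^ 2 - 2 * (q 1 ⬝ᵥ y) * (q 0 ⬝ᵥ δ) * t ^ 3) * q 2 k

lemma gradOne_eq_gradInv (q : Fin 3 → V4) (t : ℂ) (y : V4) (h : t * (q 0 ⬝ᵥ y) = 1) (k : Fin 4) :
    gradOne q y k = gradInv q t y k := by
  obtain rfl : t = (q 0 ⬝ᵥ y)⁻¹ := eq_inv_of_mul_eq_one_left h
  simp [gradOne, gradInv, Fin.sum_univ_three, coef, div_eq_mul_inv]

lemma hessOne_eq_hessInv (q : Fin 3 → V4) (t : ℂ) (y δ : V4) (h : t * (q 0 ⬝ᵥ y) = 1)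
    (k : Fin 4) : hessOne q y δ k = hessInv q t y δ k := by
  obtain rfl : t = (q 0 ⬝ᵥ y)⁻¹ := eq_inv_of_mul_eq_one_left h
  simp [hessOne, hessInv, Fin.sum_univ_three, dcoef, div_eq_mul_inv]

section
variable {σ : Type} {q : (σ → ℂ) → Fin 3 → V4} {t : (σ → ℂ) → ℂ} {y δ : (σ → ℂ) → V4}

lemma rpoly_gradInv (hq : ∀ r k, RPoly fun x => q x r k) (ht : RPoly t)
    (hy : ∀ k, RPoly fun x => y x k) (k : Fin 4) : RPoly fun x => gradInv (q x) (t x) (y x) k := by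
  have hd : ∀ r, RPoly fun x => q x r ⬝ᵥ y x := fun r => RPoly.dot (hq r) hy
  have h2 : RPoly fun _ : σ → ℂ => (-2 : ℂ) := by simpa using RPoly.intCast (σ := σ) (-2)
  exact (((((h2.mul (hd 1)).mul (hd 2)).mul (ht.pow 3)).mul (hq 0 k)).add
    (((hd 2).mul (ht.pow 2)).mul (hq 1 k))).add (((hd 1).mul (ht.pow 2)).mul (hq 2 k))

lemma rpoly_hessInv (hq : ∀ r k, RPoly fun x => q x r k) (ht : RPoly t)
    (hy : ∀ k, RPoly fun x => y x k) (hδ : ∀ k, RPoly fun x => δ x k) (k : Fin 4) :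
    RPoly fun x => hessInv (q x) (t x) (y x) (δ x) k := by
  have hd : ∀ r, RPoly fun x => q x r ⬝ᵥ y x := fun r => RPoly.dot (hq r) hy
  have he : ∀ r, RPoly fun x => q x r ⬝ᵥ δ x := fun r => RPoly.dot (hq r) hδ
  have hm2 : RPoly fun _ : σ → ℂ => (-2 : ℂ) := by simpa using RPoly.intCast (σ := σ) (-2)
  have h2 : RPoly fun _ : σ → ℂ => (2 : ℂ) := by simpa using RPoly.intCast (σ := σ) 2
  have h6 : RPoly fun _ : σ → ℂ => (6 : ℂ) := by simpa using RPoly.intCast (σ := σ) 6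
  have hs : ∀ r, RPoly fun x => (q x r ⬝ᵥ δ x) * t x ^ 2 -
      2 * (q x r ⬝ᵥ y x) * (q x 0 ⬝ᵥ δ x) * t x ^ 3 := fun r =>
    ((he r).mul (ht.pow 2)).sub (((h2.mul (hd r)).mul (he 0)).mul (ht.pow 3))
  exact (((((hm2.mul (((he 1).mul (hd 2)).add ((hd 1).mul (he 2)))).mul (ht.pow 3)).add
    ((((h6.mul (hd 1)).mul (hd 2)).mul (he 0)).mul (ht.pow 4))).mul (hq 0 k)).add
    ((hs 2).mul (hq 1 k))).add ((hs 1).mul (hq 2 k))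
end

variable {ι : Type} [Fintype ι]

/-- The equations of degenerate critical points, in the unknowns `y`, `1 / l`, a direction `δ`
and a form `w` with `w δ = 1`. -/
def degenerateEqn (i0 : ι) (p : Fam ι) (y : V4) (t : ι → ℂ) (δ w : V4) :
    ι ⊕ Fin 4 ⊕ Fin 4 ⊕ Fin 3 → ℂ :=
  Sum.elim (fun i => t i * (p i 0 ⬝ᵥ y) - 1) <|
  Sum.elim (fun k => ∑ i, gradInv (p i) (t i) y k) <|
  Sum.elim (fun k => ∑ i, hessInv (p i) (t i) y δ k)
    ![p i0 0 ⬝ᵥ y - 1, p i0 0 ⬝ᵥ δ, w ⬝ᵥ δ - 1]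

lemma exists_degenerateEqn {i0 : ι} {p : Fam ι} {y : V4} (hy : y ∈ critSet i0 Finset.univ p)
    (hn : ¬ Nondeg i0 Finset.univ p y) :
    ∃ t δ w, ∀ a, degenerateEqn i0 p y t δ w a = 0 := by
  obtain ⟨-, hl, hg, h0⟩ := hy
  simp only [Nondeg, not_forall] at hn
  obtain ⟨δ, -, hh, hδ, hne⟩ := hn
  obtain ⟨k, hk⟩ := Function.ne_iff.1 hne
  have ht : ∀ i, (p i 0 ⬝ᵥ y)⁻¹ * (p i 0 ⬝ᵥ y) = 1 := fun i => inv_mul_cancel₀ (hl i)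
  refine ⟨fun i => (p i 0 ⬝ᵥ y)⁻¹, δ, Pi.single k (δ k)⁻¹, ?_⟩
  rintro (i | k | k | r)
  · simp [degenerateEqn, ht]
  · have := hg k (Finset.mem_univ k)
    simpa [degenerateEqn, ← gradOne_eq_gradInv _ _ _ (ht _), grad] using this
  · have := hh k (Finset.mem_univ k)
    simpa [degenerateEqn, ← hessOne_eq_hessInv _ _ _ _ (ht _), hess] using this
  · have hk' : δ k ≠ 0 := hk
    fin_cases r <;> simp [degenerateEqn, h0, hδ, hk']

lemma degenerate_of_eqn {i0 : ι} {p : Fam ι} {y : V4} {t : ι → ℂ} {δ w : V4}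
    (h : ∀ a, degenerateEqn i0 p y t δ w a = 0) :
    y ∈ critSet i0 Finset.univ p ∧ ¬ Nondeg i0 Finset.univ p y := by
  have ht : ∀ i, t i * (p i 0 ⬝ᵥ y) = 1 := fun i => sub_eq_zero.1 (h (Sum.inl i))
  have h0 : p i0 0 ⬝ᵥ y = 1 := sub_eq_zero.1 (h (Sum.inr (Sum.inr (Sum.inr 0))))
  have h1 : p i0 0 ⬝ᵥ δ = 0 := h (Sum.inr (Sum.inr (Sum.inr 1)))
  have h2 : w ⬝ᵥ δ = 1 := sub_eq_zero.1 (h (Sum.inr (Sum.inr (Sum.inr 2))))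
  refine ⟨⟨by simp, fun i => right_ne_zero_of_mul_eq_one (ht i), fun k _ => ?_, h0⟩, fun hn => ?_⟩
  · have := h (Sum.inr (Sum.inl k))
    simpa [degenerateEqn, ← gradOne_eq_gradInv _ _ _ (ht _), grad] using this
  · have := hn δ (by simp) (fun k _ => ?_) h1
    · simp [this] at h2
    · have := h (Sum.inr (Sum.inr (Sum.inl k)))
      simpa [degenerateEqn, ← hessOne_eq_hessInv _ _ _ _ (ht _), hess] using this

lemma genQ_nondeg {i0 : ι} {N : ℕ} (hN : CritCount i0 Finset.univ N) :
    GenQ fun x : ι × Fin 3 × Fin 4 → ℂ =>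
      ∀ y ∈ critSet i0 Finset.univ (famOf x), Nondeg i0 Finset.univ (famOf x) y := by
  let τ := (Fin 4 ⊕ ι) ⊕ (Fin 4 ⊕ Fin 4)
  let f : (ι ⊕ Fin 4 ⊕ Fin 4 ⊕ Fin 3) → (τ ⊕ (ι × Fin 3 × Fin 4) → ℂ) → ℂ := fun a z =>
    degenerateEqn i0 (famOf fun s => z (.inr s)) (fun k => z (.inl (.inl (.inl k))))
      (fun i => z (.inl (.inl (.inr i)))) (fun k => z (.inl (.inr (.inl k))))
      (fun k => z (.inl (.inr (.inr k)))) a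
  have hf : ∀ a, RPoly (f a) := by
    have hp : ∀ i r k, RPoly fun z : τ ⊕ (ι × Fin 3 × Fin 4) → ℂ =>
        famOf (fun s => z (.inr s)) i r k := fun i r k => RPoly.coord _
    have h1 : RPoly fun _ : τ ⊕ (ι × Fin 3 × Fin 4) → ℂ => (1 : ℂ) := by
      simpa using RPoly.intCast (σ := τ ⊕ (ι × Fin 3 × Fin 4)) 1
    rintro (i | k | k | r)
    · exact ((RPoly.coord _).mul (RPoly.dot (hp i 0) fun k => RPoly.coord _)).sub h1
    · exact RPoly.sum _ fun i _ => rpoly_gradInv (hp i) (RPoly.coord _) (fun k => RPoly.coord _) k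
    · exact RPoly.sum _ fun i _ => rpoly_hessInv (hp i) (RPoly.coord _) (fun k => RPoly.coord _)
        (fun k => RPoly.coord _) k
    · fin_cases r
      · exact (RPoly.dot (hp i0 0) fun k => RPoly.coord _).sub h1
      · exact RPoly.dot (hp i0 0) fun k => RPoly.coord _
      · exact (RPoly.dot (fun k => RPoly.coord _) fun k => RPoly.coord _).sub h1
  refine (genQ_no_solution hf fun x hx z hz => ?_).mono fun x hx y hy => ?_
  · obtain ⟨h1, h2⟩ := degenerate_of_eqn hz
    exact h2 ((hN (famOf x) hx).2.2 _ h1)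
  · by_contra hn
    obtain ⟨t, δ, w, h⟩ := exists_degenerateEqn hy hn
    exact hx (Sum.elim (Sum.elim y t) (Sum.elim δ w)) h

end

section

variable {ι : Type} [Fintype ι]

/-- The joint camera map is immersive at the critical points. -/
def JInj (p : Fam ι) : Prop :=
  ∀ y : V4, (∀ i, p i 0 ⬝ᵥ y ≠ 0) → grad p y = 0 → ∀ δ : V4,
    (∀ i r, (p i r ⬝ᵥ δ) * (p i 0 ⬝ᵥ y) = (p i 0 ⬝ᵥ δ) * (p i r ⬝ᵥ y)) → ∃ κ : ℂ, δ = κ • y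

lemma Minors.dot_centre_ne_zero {p : Fam ι} (hp : Minors p) {i j : ι} (h : j ≠ i) :
    p j 0 ⬝ᵥ centre (p i) ≠ 0 :=
  hp.gen3 Finset.univ (centre (p i)) (by simp) (hp.centre_ne_zero i) i j h (dot_centre _)

lemma Minors.exists_smul_centre {p : Fam ι} (hp : Minors p) {y δ : V4}
    (hl : ∀ i, p i 0 ⬝ᵥ y ≠ 0)
    (hδ : ∀ i r, (p i r ⬝ᵥ δ) * (p i 0 ⬝ᵥ y) = (p i 0 ⬝ᵥ δ) * (p i r ⬝ᵥ y))
    (hne : ¬ ∃ κ : ℂ, δ = κ • y) (i : ι) :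
    ∃ κ s : ℂ, s ≠ 0 ∧ δ = κ • y + s • centre (p i) := by
  obtain ⟨s, hs⟩ := hp.eq_smul_centre (i := i)
    (y := δ - ((p i 0 ⬝ᵥ δ) / (p i 0 ⬝ᵥ y)) • y) fun r => by
      rw [dotProduct_sub, dotProduct_smul, smul_eq_mul]
      have := hδ i r
      have := hl i
      field_simp
      linear_combination hδ i r
  refine ⟨(p i 0 ⬝ᵥ δ) / (p i 0 ⬝ᵥ y), s, ?_, by rw [← hs]; abel⟩
  rintro rfl
  exact hne ⟨_, by simpa [sub_eq_zero] using hs⟩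

lemma Minors.exists_eq_baseline {p : Fam ι} (hp : Minors p) {y δ : V4}
    (hl : ∀ i, p i 0 ⬝ᵥ y ≠ 0)
    (hδ : ∀ i r, (p i r ⬝ᵥ δ) * (p i 0 ⬝ᵥ y) = (p i 0 ⬝ᵥ δ) * (p i r ⬝ᵥ y))
    (hne : ¬ ∃ κ : ℂ, δ = κ • y) {i j : ι} (hij : j ≠ i) :
    ∃ a b : ℂ, y = a • centre (p i) + b • centre (p j) := by
  obtain ⟨κ, s, hs, h1⟩ := hp.exists_smul_centre hl hδ hne i
  obtain ⟨κ', s', hs', h2⟩ := hp.exists_smul_centre hl hδ hne j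
  have h3 : (κ - κ') • y = (-s) • centre (p i) + s' • centre (p j) := by
    rw [sub_smul, neg_smul, sub_eq_iff_eq_add, add_assoc, add_comm (s' • _), ← h2, h1]
    abel
  have hκ : κ - κ' ≠ 0 := by
    intro h0
    rw [h0, zero_smul] at h3
    have := congrArg (p j 0 ⬝ᵥ ·) h3
    simp only [dotProduct_add, dotProduct_smul, dot_centre, dotProduct_zero, smul_eq_mul, mul_zero,
      add_zero] at this
    exact mul_ne_zero (neg_ne_zero.2 hs) (hp.dot_centre_ne_zero hij) this.symm
  refine ⟨(κ - κ')⁻¹ * (-s), (κ - κ')⁻¹ * s', ?_⟩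
  rw [mul_smul, mul_smul, ← smul_add, ← h3, inv_smul_smul₀ hκ]

lemma gradOne_add_centre (q : Fin 3 → V4) (y : V4) (a : ℂ) :
    gradOne q (y + a • centre q) = gradOne q y := by
  simp [gradOne, coef, dotProduct_add, dotProduct_smul, dot_centre]

lemma gradOne_centre_add (q : Fin 3 → V4) (y : V4) (a : ℂ) :
    gradOne q (a • centre q + y) = gradOne q y := by
  rw [add_comm, gradOne_add_centre]

lemma jInj_of_three {p : Fam ι} (hp : Minors p) {i j k : ι} (hij : j ≠ i)
    (h : (p k 0 ⬝ᵥ centre (p i)) * (p k 1 ⬝ᵥ centre (p j)) -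
      (p k 0 ⬝ᵥ centre (p j)) * (p k 1 ⬝ᵥ centre (p i)) ≠ 0) : JInj p := by
  intro y hl _ δ hδ
  by_contra hne
  obtain ⟨a, b, hy⟩ := hp.exists_eq_baseline hl hδ hne hij
  obtain ⟨κ, s, hs, h1⟩ := hp.exists_smul_centre hl hδ hne i
  obtain ⟨κ', s', hs', h2⟩ := hp.exists_smul_centre hl hδ hne k
  obtain ⟨A, B, hAB⟩ : ∃ A B : ℂ, s' • centre (p k) = A • centre (p i) + B • centre (p j) := by
    refine ⟨(κ - κ') * a + s, (κ - κ') * b, ?_⟩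
    have h3 : s' • centre (p k) = (κ - κ') • y + s • centre (p i) := by
      rw [sub_smul, sub_add_eq_add_sub, ← h1, h2]; abel
    rw [h3, hy]
    module
  have hr : ∀ r, A * (p k r ⬝ᵥ centre (p i)) + B * (p k r ⬝ᵥ centre (p j)) = 0 := fun r => by
    have := congrArg (p k r ⬝ᵥ ·) hAB
    simpa [dotProduct_add, dotProduct_smul, dot_centre] using this.symm
  have hA : A = 0 := by
    refine (mul_eq_zero.1 ?_).resolve_right h
    linear_combination (p k 1 ⬝ᵥ centre (p j)) * hr 0 - (p k 0 ⬝ᵥ centre (p j)) * hr 1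
  have hB : B = 0 := by
    refine (mul_eq_zero.1 ?_).resolve_right h
    linear_combination (p k 0 ⬝ᵥ centre (p i)) * hr 1 - (p k 1 ⬝ᵥ centre (p i)) * hr 0
  rw [hA, hB, zero_smul, zero_smul, add_zero, smul_eq_zero] at hAB
  exact hAB.elim hs' (hp.centre_ne_zero k)

lemma jInj_of_two {p : Fam ι} (hp : Minors p) {i j : ι} (hij : i ≠ j) (hu : ∀ k, k = i ∨ k = j)
    {z w : V4} (h : gradNum (p i) (centre (p j)) z * gradNum (p j) (centre (p i)) w -
      gradNum (p i) (centre (p j)) w * gradNum (p j) (centre (p i)) z ≠ 0) : JInj p := by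
  classical
  intro y hl hg δ hδ
  by_contra hne
  obtain ⟨a, b, hy⟩ := hp.exists_eq_baseline hl hδ hne hij.symm
  have hli := hp.dot_centre_ne_zero hij
  have hlj := hp.dot_centre_ne_zero hij.symm
  have ha : a ≠ 0 := by
    rintro rfl
    exact hl j (by rw [hy]; simp [dot_centre])
  have hb : b ≠ 0 := by
    rintro rfl
    exact hl i (by rw [hy]; simp [dot_centre])
  have huniv : (Finset.univ : Finset ι) = {i, j} := by
    ext k; simpa using hu k
  rw [grad, huniv, Finset.sum_pair hij, hy, gradOne_centre_add, gradOne_add_centre,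
    gradOne_smul _ _ hb, gradOne_smul _ _ ha] at hg
  have hx : ∀ x, b⁻¹ * (gradNum (p i) (centre (p j)) x / (p i 0 ⬝ᵥ centre (p j)) ^ 3) +
      a⁻¹ * (gradNum (p j) (centre (p i)) x / (p j 0 ⬝ᵥ centre (p i)) ^ 3) = 0 := fun x => by
    rw [← gradOne_dot_eq _ _ _ hli, ← gradOne_dot_eq _ _ _ hlj, ← smul_eq_mul, ← smul_eq_mul,
      ← smul_dotProduct, ← smul_dotProduct, ← add_dotProduct, hg, zero_dotProduct]
  have hz := hx z
  have hw := hx w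
  field_simp at hz hw
  refine h ((mul_eq_zero.1 (?_ : (a * (p j 0 ⬝ᵥ centre (p i)) ^ 3) * _ = 0)).resolve_left
    (mul_ne_zero ha (pow_ne_zero 3 hlj)))
  linear_combination gradNum (p j) (centre (p i)) w * hz - gradNum (p j) (centre (p i)) z * hw

lemma genQ_jInj {i j : ι} (hij : i ≠ j) :
    GenQ fun x : ι × Fin 3 × Fin 4 → ℂ => JInj (famOf x) := by
  classical
  have hc : ∀ i k, RPoly fun x : ι × Fin 3 × Fin 4 → ℂ => centre (famOf x i) k := fun i =>
    rpoly_cross (rpoly_famOf i 0) (rpoly_famOf i 1) (rpoly_famOf i 2)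
  by_cases hu : ∀ k, k = i ∨ k = j
  · have hs : ∀ a k, RPoly fun _ : ι × Fin 3 × Fin 4 → ℂ => (Pi.single a 1 : V4) k := fun a k => by
      by_cases h : k = a
      · subst h; simpa using RPoly.intCast (σ := ι × Fin 3 × Fin 4) 1
      · simpa [h] using RPoly.intCast (σ := ι × Fin 3 × Fin 4) 0
    let p0 : Fam ι := fun k => if k = i then
      ![Pi.single 1 1, Pi.single 1 1 + Pi.single 2 1, Pi.single 1 1 + Pi.single 3 1] else
      ![Pi.single 0 1, Pi.single 0 1 + Pi.single 2 1, Pi.single 0 1 + 2 • Pi.single 3 1]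
    refine (genQ_minors.and (GenQ.of_rpoly (((RPoly.gradNum (rpoly_famOf i) (hc j) (hs 2)).mul
      (RPoly.gradNum (rpoly_famOf j) (hc i) (hs 3))).sub
      ((RPoly.gradNum (rpoly_famOf i) (hc j) (hs 3)).mul
      (RPoly.gradNum (rpoly_famOf j) (hc i) (hs 2)))) (fun t => p0 t.1 t.2.1 t.2.2) ?_)).mono
      fun x hx => jInj_of_two hx.1 hij hu hx.2
    have hf : famOf (fun t : ι × Fin 3 × Fin 4 => p0 t.1 t.2.1 t.2.2) = p0 := rfl
    rw [hf]
    have hi : centre (p0 i) = Pi.single 0 1 := by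
      funext k
      simp only [centre, cross, p0]
      fin_cases k <;> simp [det_four]
    have hj : centre (p0 j) = Pi.single 1 (-2) := by
      funext k
      simp only [centre, cross, p0, if_neg hij.symm]
      fin_cases k <;> simp [det_four]
    rw [hi, hj]
    simp [gradNum, p0, hij.symm]
    norm_num
  · push Not at hu
    obtain ⟨k, hki, hkj⟩ := hu
    let p0 : Fam ι := fun m => if m = i then ![Pi.single 1 1, Pi.single 2 1, Pi.single 3 1] else
      if m = j then ![Pi.single 0 1, Pi.single 2 1, Pi.single 3 1] else
      ![Pi.single 0 1, Pi.single 1 1, 0]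
    refine (genQ_minors.and (GenQ.of_rpoly (((RPoly.dot (rpoly_famOf k 0) (hc i)).mul
      (RPoly.dot (rpoly_famOf k 1) (hc j))).sub ((RPoly.dot (rpoly_famOf k 0) (hc j)).mul
      (RPoly.dot (rpoly_famOf k 1) (hc i)))) (fun t => p0 t.1 t.2.1 t.2.2) ?_)).mono
      fun x hx => jInj_of_three hx.1 hij.symm hx.2
    have hf : famOf (fun t : ι × Fin 3 × Fin 4 => p0 t.1 t.2.1 t.2.2) = p0 := rfl
    rw [hf]
    have hi : centre (p0 i) = Pi.single 0 1 := by
      funext k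
      simp only [centre, cross, p0]
      fin_cases k <;> simp [det_four]
    have hj : centre (p0 j) = Pi.single 1 (-1) := by
      funext k
      simp only [centre, cross, p0, if_neg hij.symm]
      fin_cases k <;> simp [det_four]
    rw [hi, hj]
    simp [p0, hki, hkj]

end

lemma diffAt_apply {n : ℕ} (p : MvPolynomial (Fin n) ℂ) (x v : Fin n → ℂ) :
    diffAt p x v = ∑ i, MvPolynomial.eval x (MvPolynomial.pderiv i p) * v i := by
  simp [diffAt]

lemma hasDerivAt_eval {n : ℕ} (p : MvPolynomial (Fin n) ℂ) {γ : ℂ → Fin n → ℂ} {v : Fin n → ℂ}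
    {t : ℂ} (hγ : HasDerivAt γ v t) :
    HasDerivAt (fun s => MvPolynomial.eval (γ s) p) (diffAt p (γ t) v) t := by
  rw [diffAt_apply]
  induction p using MvPolynomial.induction_on with
  | C a => simpa using hasDerivAt_const t a
  | add p q hp hq =>
    simp only [map_add, add_mul, Finset.sum_add_distrib]
    exact hp.add hq
  | mul_X p i hp =>
    have hi := (hasDerivAt_pi.1 hγ) i
    simp only [map_mul, MvPolynomial.eval_X]
    refine (hp.mul hi).congr_deriv ?_
    symm
    simp only [Derivation.leibniz, MvPolynomial.pderiv_X, map_add, smul_eq_mul, map_mul,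
      MvPolynomial.eval_X, add_mul, Finset.sum_add_distrib]
    rw [add_comm, Finset.sum_mul]
    congr 1
    · exact Finset.sum_congr rfl fun j _ => by ring
    · rw [Finset.sum_eq_single i]
      · simp
      · intro j _ hj; simp [hj.symm]
      · simp

lemma mem_zTangent {n : ℕ} {X : Set (Fin n → ℂ)} {x v : Fin n → ℂ} :
    v ∈ zTangent X x ↔ ∀ p : MvPolynomial (Fin n) ℂ, (∀ y ∈ X, MvPolynomial.eval y p = 0) →
      diffAt p x v = 0 := by
  simp [zTangent, Submodule.mem_iInf]

/-- The velocity of a curve in the closure of `X` is a tangent vector. -/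
lemma mem_zTangent_of_curve {n : ℕ} {X : Set (Fin n → ℂ)} {γ : ℂ → Fin n → ℂ} {v : Fin n → ℂ}
    (hγ : HasDerivAt γ v 0) (h : ∀ᶠ t in 𝓝[≠] (0 : ℂ), γ t ∈ closure X) :
    v ∈ zTangent X (γ 0) := by
  refine mem_zTangent.2 fun p hp => ?_
  have hz : ∀ y ∈ closure X, MvPolynomial.eval y p = 0 := fun y hy =>
    closure_minimal hp (isClosed_singleton.preimage (MvPolynomial.continuous_eval p)) hy
  have h1 := hasDerivAt_eval p hγ
  have h2 : ∀ᶠ t in 𝓝[≠] (0 : ℂ), MvPolynomial.eval (γ t) p = 0 := h.mono fun t ht => hz _ ht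
  have h3 := h1.continuousAt.tendsto.mono_left (nhdsWithin_le_nhds (s := {0}ᶜ))
  have h0 : MvPolynomial.eval (γ 0) p = 0 :=
    tendsto_nhds_unique h3 (tendsto_const_nhds.congr' (h2.mono fun t ht => ht.symm))
  have h4 := hasDerivAt_iff_tendsto_slope.1 h1
  refine tendsto_nhds_unique h4 (tendsto_const_nhds.congr' (h2.mono fun t ht => ?_))
  simp [slope, ht, h0]

section

/-- The indexing of the coordinates of `ℂ²ⁿ` by cameras. -/
def camEquiv (n : ℕ) : Fin n × Fin 2 ≃ Fin (2 * n) where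
  toFun q := ⟨2 * q.1.1 + q.2.1, by have := q.1.2; have := q.2.2; omega⟩
  invFun s := (⟨s.1 / 2, by have := s.2; omega⟩, ⟨s.1 % 2, by omega⟩)
  left_inv q := by
    have := q.2.2
    ext <;> simp only <;> omega
  right_inv s := by
    ext
    simp only
    omega

lemma sum_camEquiv {n : ℕ} (f : Fin (2 * n) → ℂ) :
    ∑ s, f s = ∑ i, (f (camEquiv n (i, 0)) + f (camEquiv n (i, 1))) := by
  simp [← (camEquiv n).sum_comp f, Fintype.sum_prod_type]

lemma funext_cam {n : ℕ} {f g : Fin (2 * n) → ℂ}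
    (h : ∀ i k, f (camEquiv n (i, k)) = g (camEquiv n (i, k))) : f = g := by
  funext s
  obtain ⟨⟨i, k⟩, rfl⟩ := (camEquiv n).surjective s
  exact h i k

variable {n : ℕ}

/-- The coordinates of the joint image of `y` under the cameras with rows `B`. -/
def psi (B : Fin n → Fin 3 → V4) (y : V4) (s : Fin (2 * n)) : ℂ :=
  (B ((camEquiv n).symm s).1 ((camEquiv n).symm s).2.succ ⬝ᵥ y) /
    (B ((camEquiv n).symm s).1 0 ⬝ᵥ y)

/-- The linear form vanishing at the points of `ℙ³` with image coordinate `x s`. -/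
def backForm (B : Fin n → Fin 3 → V4) (x : Fin (2 * n) → ℂ) (s : Fin (2 * n)) : V4 :=
  B ((camEquiv n).symm s).1 ((camEquiv n).symm s).2.succ -
    x s • B ((camEquiv n).symm s).1 0

/-- The differential of `psi`. -/
def dpsi (B : Fin n → Fin 3 → V4) (y : V4) : V4 →ₗ[ℂ] (Fin (2 * n) → ℂ) where
  toFun δ s := (backForm B (psi B y) s ⬝ᵥ δ) / (B ((camEquiv n).symm s).1 0 ⬝ᵥ y)
  map_add' a b := by
    funext s
    simp [dotProduct_add, add_div]
  map_smul' c a := by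
    funext s
    simp [dotProduct_smul, mul_div_assoc]

lemma psi_apply (B : Fin n → Fin 3 → V4) (y : V4) (i : Fin n) (k : Fin 2) :
    psi B y (camEquiv n (i, k)) = (B i k.succ ⬝ᵥ y) / (B i 0 ⬝ᵥ y) := by
  simp [psi]

lemma backForm_apply (B : Fin n → Fin 3 → V4) (x : Fin (2 * n) → ℂ) (i : Fin n) (k : Fin 2) :
    backForm B x (camEquiv n (i, k)) = B i k.succ - x (camEquiv n (i, k)) • B i 0 := by
  simp [backForm]

lemma dpsi_apply (B : Fin n → Fin 3 → V4) (y δ : V4) (i : Fin n) (k : Fin 2) :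
    dpsi B y δ (camEquiv n (i, k)) =
      (B i k.succ ⬝ᵥ δ - (B i k.succ ⬝ᵥ y) / (B i 0 ⬝ᵥ y) * (B i 0 ⬝ᵥ δ)) / (B i 0 ⬝ᵥ y) := by
  simp [dpsi, backForm_apply, psi_apply, sub_dotProduct, smul_dotProduct]

lemma hasDerivAt_psi_apply (B : Fin n → Fin 3 → V4) {y : V4} (δ : V4) {i : Fin n}
    (h : B i 0 ⬝ᵥ y ≠ 0) (k : Fin 2) :
    HasDerivAt (fun t : ℂ => psi B (y + t • δ) (camEquiv n (i, k)))
      (dpsi B y δ (camEquiv n (i, k))) 0 := by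
  simp only [psi_apply, dpsi_apply]
  refine ((hasDerivAt_dot (B i k.succ) y δ).div (hasDerivAt_dot (B i 0) y δ)
    (by simpa using h)).congr_deriv ?_
  simp only [zero_smul, add_zero]
  field_simp

lemma hasDerivAt_psi (B : Fin n → Fin 3 → V4) {y : V4} (δ : V4) (h : ∀ i, B i 0 ⬝ᵥ y ≠ 0) :
    HasDerivAt (fun t : ℂ => psi B (y + t • δ)) (dpsi B y δ) 0 := by
  refine hasDerivAt_pi.2 fun s => ?_
  obtain ⟨⟨i, k⟩, rfl⟩ := (camEquiv n).surjective s
  exact hasDerivAt_psi_apply B δ (h i) k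

lemma eventually_dot_ne_zero {q y : V4} (δ : V4) (h : q ⬝ᵥ y ≠ 0) :
    ∀ᶠ t : ℂ in 𝓝 0, q ⬝ᵥ (y + t • δ) ≠ 0 :=
  (hasDerivAt_dot q y δ).continuousAt.eventually_ne (by simpa using h)

lemma dpsi_mem_zTangent {B : Fin n → Fin 3 → V4} {X : Set (Fin (2 * n) → ℂ)}
    (hX : ∀ y, (∀ i, B i 0 ⬝ᵥ y ≠ 0) → psi B y ∈ X) {y : V4} (h : ∀ i, B i 0 ⬝ᵥ y ≠ 0) (δ : V4) :
    dpsi B y δ ∈ zTangent X (psi B y) := by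
  have := mem_zTangent_of_curve (X := X) (hasDerivAt_psi B δ h) (by
    refine Filter.Eventually.filter_mono nhdsWithin_le_nhds ?_
    filter_upwards [eventually_all.2 fun i => eventually_dot_ne_zero δ (h i)] with t ht
    exact subset_closure (hX _ ht))
  simpa using this

/-- The family of triples of linear forms whose sum of `u v / l ^ 2` is the squared distance. -/
def famED (B : Fin n → Fin 3 → V4) (α : Fin (2 * n) → ℂ) : Fam (Fin n) := fun i =>
  ![B i 0,
    backForm B α (camEquiv n (i, 0)) + Complex.I • backForm B α (camEquiv n (i, 1)),
    backForm B α (camEquiv n (i, 0)) - Complex.I • backForm B α (camEquiv n (i, 1))]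

lemma famED_zero (B : Fin n → Fin 3 → V4) (α : Fin (2 * n) → ℂ) (i : Fin n) :
    famED B α i 0 = B i 0 := rfl

lemma famED_dot_eq_zero_iff (B : Fin n → Fin 3 → V4) (α : Fin (2 * n) → ℂ) (i : Fin n) (z : V4) :
    (famED B α i 1 ⬝ᵥ z = 0 ∧ famED B α i 2 ⬝ᵥ z = 0) ↔
      ∀ k : Fin 2, B i k.succ ⬝ᵥ z = α (camEquiv n (i, k)) * (B i 0 ⬝ᵥ z) := by
  have hI := Complex.I_mul_I
  simp only [famED, backForm_apply, Fin.forall_fin_two, Matrix.cons_val_one, Matrix.cons_val_zero,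
    Matrix.cons_val, add_dotProduct, sub_dotProduct, smul_dotProduct, smul_eq_mul]
  constructor
  · rintro ⟨h1, h2⟩
    constructor
    · linear_combination (h1 + h2) / 2
    · linear_combination (-Complex.I / 2) * (h1 - h2) +
        (B i (Fin.succ 1) ⬝ᵥ z - α (camEquiv n (i, 1)) * (B i 0 ⬝ᵥ z)) * hI
  · rintro ⟨h1, h2⟩
    constructor
    · linear_combination h1 + Complex.I * h2
    · linear_combination h1 - Complex.I * h2

lemma gradOne_famED (B : Fin n → Fin 3 → V4) (α : Fin (2 * n) → ℂ) (i : Fin n) (y δ : V4)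
    (h : B i 0 ⬝ᵥ y ≠ 0) :
    gradOne (famED B α i) y ⬝ᵥ δ =
      2 * ((psi B y (camEquiv n (i, 0)) - α (camEquiv n (i, 0))) * dpsi B y δ (camEquiv n (i, 0)) +
      (psi B y (camEquiv n (i, 1)) - α (camEquiv n (i, 1))) * dpsi B y δ (camEquiv n (i, 1))) := by
  have hI := Complex.I_sq
  simp only [gradOne, Fin.sum_univ_three, add_dotProduct, smul_dotProduct, coef, dpsi_apply,
    psi_apply, famED, backForm_apply, Matrix.cons_val_one, Matrix.cons_val_zero,
    Matrix.cons_val, sub_dotProduct, smul_eq_mul]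
  field_simp
  ring_nf
  simp only [hI]
  ring

lemma grad_famED (B : Fin n → Fin 3 → V4) (α : Fin (2 * n) → ℂ) (y δ : V4)
    (h : ∀ i, B i 0 ⬝ᵥ y ≠ 0) :
    grad (famED B α) y ⬝ᵥ δ = 2 * ∑ s, (psi B y s - α s) * dpsi B y δ s := by
  rw [grad, sum_dot, sum_camEquiv, Finset.mul_sum]
  exact Finset.sum_congr rfl fun i _ => gradOne_famED B α i y δ (h i)

lemma centre_famED (B : Fin n → Fin 3 → V4) (α : Fin (2 * n) → ℂ) (i : Fin n) :
    centre (famED B α i) = (-2 * Complex.I) • centre (B i) := by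
  funext k
  simp only [centre, cross, det_four, famED, backForm_apply, Matrix.of_apply, Pi.smul_apply,
    smul_eq_mul, Matrix.cons_val_one, Matrix.cons_val_zero, Matrix.cons_val,
    Pi.add_apply, Pi.sub_apply]
  simp only [Fin.succ_zero_eq_one, Fin.succ_one_eq_two]
  ring

end

lemma cross_ne_zero {f : Fin 3 → V4} (hf : LinearIndependent ℂ f) :
    cross (f 0) (f 1) (f 2) ≠ 0 := by
  obtain ⟨w, hw⟩ := exists_linearIndependent_cons_of_lt_finrank hf (by simp)
  intro h0
  have h1 := cross_dot (f 0) (f 1) (f 2) w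
  rw [h0, zero_dotProduct] at h1
  have h2 : Matrix.of ![w, f 0, f 1, f 2] = Matrix.of (Fin.cons w f : Fin 4 → V4) := by
    ext i j
    fin_cases i <;> rfl
  rw [h2] at h1
  have h3 := (Matrix.linearIndependent_rows_iff_isUnit
    (A := Matrix.of (Fin.cons w f : Fin 4 → V4))).1 hw
  rw [Matrix.isUnit_iff_isUnit_det, ← h1] at h3
  exact not_isUnit_zero h3

lemma exists_cross_ne_zero {κ : Type} [Fintype κ] (S : κ → V4) {y : V4} (hy : y ≠ 0)
    (h0 : ∀ s, S s ⬝ᵥ y = 0) (hker : ∀ δ, (∀ s, S s ⬝ᵥ δ = 0) → ∃ c : ℂ, δ = c • y) :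
    ∃ t : Fin 3 → κ, ∃ h : ℂ, h ≠ 0 ∧ cross (S (t 0)) (S (t 1)) (S (t 2)) = h • y := by
  have hk : LinearMap.ker (Matrix.of S).mulVecLin = Submodule.span ℂ {y} := by
    ext δ
    rw [LinearMap.mem_ker, Submodule.mem_span_singleton]
    constructor
    · intro h
      obtain ⟨c, hc⟩ := hker δ fun s => congrFun h s
      exact ⟨c, hc.symm⟩
    · rintro ⟨c, rfl⟩
      funext s
      have := h0 s
      simp [Matrix.mulVec, this]
  have hr : Module.finrank ℂ (Submodule.span ℂ (Set.range S)) = 3 := by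
    have h1 := (Matrix.of S).rank_eq_finrank_span_row
    have h2 := LinearMap.finrank_range_add_finrank_ker (Matrix.of S).mulVecLin
    rw [hk, finrank_span_singleton hy] at h2
    rw [Matrix.rank] at h1
    simp only [Module.finrank_fin_fun] at h2
    have h3 : (Matrix.of S).row = S := rfl
    rw [h3] at h1
    exact h1.symm.trans (Nat.succ_injective h2)
  have h4 := Submodule.exists_fun_fin_finrank_span_eq ℂ (Set.range S)
  rw [hr] at h4
  obtain ⟨f, hf, hspan, hli⟩ := h4
  choose t ht using hf
  have hT := cross_ne_zero hli
  obtain ⟨c, hc⟩ := hker (cross (f 0) (f 1) (f 2)) fun s => by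
    have hs : S s ∈ Submodule.span ℂ (Set.range f) := by
      rw [hspan]
      exact Submodule.subset_span ⟨s, rfl⟩
    refine Submodule.span_induction (p := fun v _ => v ⬝ᵥ cross (f 0) (f 1) (f 2) = 0)
      ?_ (zero_dotProduct _) (fun a b _ _ ha hb => by rw [add_dotProduct, ha, hb, add_zero])
      (fun r a _ ha => by rw [smul_dotProduct, ha, smul_zero]) hs
    rintro _ ⟨r, rfl⟩
    fin_cases r
    · exact dot_cross_fst _ _ _
    · exact dot_cross_snd _ _ _
    · exact dot_cross_trd _ _ _
  refine ⟨t, c, ?_, by simp only [ht, hc]⟩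
  rintro rfl
  exact hT (by rw [hc, zero_smul])

/-- A polynomial function of two groups of variables, with the second group specialised. -/
lemma RPoly.exists_eval {σ τ : Type} {f : (σ ⊕ τ → ℂ) → ℂ} (hf : RPoly f) (b : τ → ℂ) :
    ∃ P : MvPolynomial σ ℂ, ∀ x, f (Sum.elim x b) = MvPolynomial.eval x P := by
  obtain ⟨P, hP⟩ := hf
  refine ⟨MvPolynomial.aeval (Sum.elim MvPolynomial.X fun t => MvPolynomial.C (b t)) P,
    fun x => ?_⟩
  rw [hP]
  clear hP
  induction P using MvPolynomial.induction_on with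
  | C a => simp
  | add p q hp hq => simp only [map_add, hp, hq]
  | mul_X p i hp => rw [map_mul, map_mul, map_mul, hp]; rcases i with i | i <;> simp

section

variable {n : ℕ}

lemma rpoly_backForm (s : Fin (2 * n)) (k : Fin 4) :
    RPoly fun z : Fin (2 * n) ⊕ (Fin n × Fin 3 × Fin 4) → ℂ =>
      backForm (fun i r k => z (.inr (i, r, k))) (fun s => z (.inl s)) s k :=
  (RPoly.coord _).sub ((RPoly.coord _).mul (RPoly.coord _))

lemma det_eq_zero_of_dot {f : Fin 4 → V4} {y : V4} (hy : y ≠ 0) (h : ∀ r, f r ⬝ᵥ y = 0) :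
    (Matrix.of f).det = 0 :=
  Matrix.exists_mulVec_eq_zero_iff.1 ⟨y, hy, funext h⟩

lemma exists_dpsi_of_mem_zTangent {B : Fin n → Fin 3 → V4} {X : Set (Fin (2 * n) → ℂ)}
    (hX : ∀ x ∈ X, ∃ y : V4, y ≠ 0 ∧ ∀ s, backForm B x s ⬝ᵥ y = 0) {y : V4} (hy : y ≠ 0)
    (hl : ∀ i, B i 0 ⬝ᵥ y ≠ 0) (hinj : ∀ δ, dpsi B y δ = 0 → ∃ c : ℂ, δ = c • y)
    {v : Fin (2 * n) → ℂ} (hv : v ∈ zTangent X (psi B y)) : ∃ δ, dpsi B y δ = v := by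
  have h0 : ∀ s, backForm B (psi B y) s ⬝ᵥ y = 0 := fun s => by
    obtain ⟨⟨i, k⟩, rfl⟩ := (camEquiv n).surjective s
    rw [backForm_apply, psi_apply, sub_dotProduct, smul_dotProduct, smul_eq_mul,
      div_mul_cancel₀ _ (hl i), sub_self]
  obtain ⟨t, c, hc, hT⟩ := exists_cross_ne_zero (backForm B (psi B y)) hy h0 fun δ hδ =>
    hinj δ (funext fun s => by simp [dpsi, hδ s])
  let T : (Fin (2 * n) → ℂ) → V4 := fun x =>
    cross (backForm B x (t 0)) (backForm B x (t 1)) (backForm B x (t 2))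
  have hTr : ∀ k, RPoly fun z : Fin (2 * n) ⊕ (Fin n × Fin 3 × Fin 4) → ℂ =>
      cross (backForm (fun i r k => z (.inr (i, r, k))) (fun s => z (.inl s)) (t 0))
        (backForm (fun i r k => z (.inr (i, r, k))) (fun s => z (.inl s)) (t 1))
        (backForm (fun i r k => z (.inr (i, r, k))) (fun s => z (.inl s)) (t 2)) k := fun k =>
    rpoly_cross (rpoly_backForm _) (rpoly_backForm _) (rpoly_backForm _) k
  have hTp : ∀ k, ∃ P : MvPolynomial (Fin (2 * n)) ℂ, ∀ x, T x k = MvPolynomial.eval x P :=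
    fun k => (hTr k).exists_eval fun q => B q.1 q.2.1 q.2.2
  have hEp : ∀ s, ∃ P : MvPolynomial (Fin (2 * n)) ℂ, ∀ x,
      backForm B x s ⬝ᵥ T x = MvPolynomial.eval x P := fun s =>
    (RPoly.dot (rpoly_backForm s) hTr).exists_eval fun q => B q.1 q.2.1 q.2.2
  choose P hP using hTp
  choose Q hQ using hEp
  have hline : HasDerivAt (fun τ : ℂ => psi B y + τ • v) v 0 := by
    simpa using ((hasDerivAt_id (0 : ℂ)).smul_const v).const_add (psi B y)
  have hline0 : psi B y + (0 : ℂ) • v = psi B y := by simp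
  let T' : V4 := fun k => diffAt (P k) (psi B y) v
  have hT' : ∀ k, HasDerivAt (fun τ : ℂ => T (psi B y + τ • v) k) (T' k) 0 := fun k => by
    have := hasDerivAt_eval (P k) hline
    rw [hline0] at this
    simpa only [hP] using this
  have hkey : ∀ s, v s * (B ((camEquiv n).symm s).1 0 ⬝ᵥ (c • y)) =
      backForm B (psi B y) s ⬝ᵥ T' := fun s => by
    have h1 := hasDerivAt_eval (Q s) hline
    rw [hline0, mem_zTangent.1 hv (Q s) fun x hx => by
      obtain ⟨z, hz, hxz⟩ := hX x hx
      rw [← hQ, dotProduct_comm, cross_dot]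
      refine det_eq_zero_of_dot hz fun r => ?_
      fin_cases r <;> exact hxz _] at h1
    have h2 : HasDerivAt (fun τ : ℂ => backForm B (psi B y + τ • v) s ⬝ᵥ T (psi B y + τ • v))
        (∑ k, (-(v s * B ((camEquiv n).symm s).1 0 k) * T (psi B y) k +
          backForm B (psi B y) s k * T' k)) 0 := by
      refine HasDerivAt.fun_sum fun k _ => ?_
      have h3 : HasDerivAt (fun τ : ℂ => backForm B (psi B y + τ • v) s k)
          (-(v s * B ((camEquiv n).symm s).1 0 k)) 0 :=
        (((hasDerivAt_pi.1 hline) s).mul_const _).const_sub _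
      exact (h3.mul (hT' k)).congr_deriv (by simp only [hline0])
    simp only [hQ] at h2
    have h4 := h2.unique h1
    have h5 : T (psi B y) = c • y := hT
    rw [h5, Finset.sum_add_distrib] at h4
    have h6 : ∑ k, -(v s * B ((camEquiv n).symm s).1 0 k) * (c • y) k =
        -(v s * (B ((camEquiv n).symm s).1 0 ⬝ᵥ (c • y))) := by
      rw [dotProduct, Finset.mul_sum, ← Finset.sum_neg_distrib]
      exact Finset.sum_congr rfl fun k _ => by ring
    rw [h6] at h4
    have h7 : backForm B (psi B y) s ⬝ᵥ T' = ∑ k, backForm B (psi B y) s k * T' k := rfl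
    rw [h7]
    linear_combination -h4
  refine ⟨c⁻¹ • T', funext fun s => ?_⟩
  rw [map_smul]
  simp only [Pi.smul_apply, dpsi, LinearMap.coe_mk, AddHom.coe_mk, ← hkey s, dotProduct_smul,
    smul_eq_mul]
  have := hl ((camEquiv n).symm s).1
  field_simp

lemma finrank_zTangent {B : Fin n → Fin 3 → V4} {X : Set (Fin (2 * n) → ℂ)}
    (hX : ∀ x ∈ X, ∃ y : V4, y ≠ 0 ∧ ∀ s, backForm B x s ⬝ᵥ y = 0)
    (hX' : ∀ y, (∀ i, B i 0 ⬝ᵥ y ≠ 0) → psi B y ∈ X) {y : V4} (hy : y ≠ 0)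
    (hl : ∀ i, B i 0 ⬝ᵥ y ≠ 0) (hinj : ∀ δ, dpsi B y δ = 0 → ∃ c : ℂ, δ = c • y) :
    zTangent X (psi B y) = LinearMap.range (dpsi B y) ∧
      Module.finrank ℂ (zTangent X (psi B y)) = 3 := by
  have h1 : zTangent X (psi B y) = LinearMap.range (dpsi B y) := by
    refine le_antisymm (fun v hv => exists_dpsi_of_mem_zTangent hX hy hl hinj hv) ?_
    rintro _ ⟨δ, rfl⟩
    exact dpsi_mem_zTangent hX' hl δ
  have hk : LinearMap.ker (dpsi B y) = Submodule.span ℂ {y} := by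
    ext δ
    rw [LinearMap.mem_ker, Submodule.mem_span_singleton]
    constructor
    · intro h
      obtain ⟨c, hc⟩ := hinj δ h
      exact ⟨c, hc.symm⟩
    · rintro ⟨c, rfl⟩
      refine funext_cam fun i k => ?_
      rw [dpsi_apply, dotProduct_smul, dotProduct_smul]
      have := hl i
      simp only [smul_eq_mul, Pi.zero_apply]
      field_simp
      simp
  refine ⟨h1, ?_⟩
  have h2 := LinearMap.finrank_range_add_finrank_ker (dpsi B y)
  rw [hk, finrank_span_singleton hy, ← h1] at h2
  simp only [Module.finrank_fin_fun] at h2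
  exact Nat.succ_injective h2

end

section

variable {n : ℕ}

lemma exists_dot_eq {q : Fin 3 → V4} (hq : centre q ≠ 0) (c : Fin 3 → ℂ) :
    ∃ δ : V4, ∀ r, q r ⬝ᵥ δ = c r := by
  obtain ⟨k, hk⟩ := Function.ne_iff.1 hq
  have hdet : (Matrix.of ![Pi.single k 1, q 0, q 1, q 2]).det ≠ 0 := hk
  obtain ⟨δ, hδ⟩ := Matrix.mulVec_surjective_iff_isUnit.2
    ((Matrix.isUnit_iff_isUnit_det _).2 hdet.isUnit) (Fin.cons 0 c)
  refine ⟨δ, fun r => ?_⟩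
  have h := congrFun hδ r.succ
  fin_cases r <;> exact h

/-- General position of the triples of linear forms defining the squared distance. -/
structure GoodFam {ι : Type} [Fintype ι] (p : Fam ι) : Prop where
  minors : Minors p
  centrePoly : ∀ i, centrePoly p i ≠ 0
  jInj : JInj p

lemma JInj.dpsi_inj {B : Fin n → Fin 3 → V4} {α : Fin (2 * n) → ℂ} (h : JInj (famED B α)) {y : V4}
    (hl : ∀ i, B i 0 ⬝ᵥ y ≠ 0) (hg : grad (famED B α) y = 0) (δ : V4) (hδ : dpsi B y δ = 0) :
    ∃ c : ℂ, δ = c • y := by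
  refine h y hl hg δ fun i r => ?_
  have hk : ∀ k : Fin 2, (B i k.succ ⬝ᵥ δ) * (B i 0 ⬝ᵥ y) = (B i 0 ⬝ᵥ δ) * (B i k.succ ⬝ᵥ y) :=
    fun k => by
    have h1 := congrFun hδ (camEquiv n (i, k))
    have := hl i
    rw [dpsi_apply, Pi.zero_apply, div_eq_zero_iff, or_iff_left this] at h1
    field_simp at h1
    linear_combination h1
  have h0 := hk 0
  have h1 := hk 1
  simp only [famED, backForm_apply]
  fin_cases r
  · simp only [Fin.zero_eta, Matrix.cons_val_zero]
  · simp only [Fin.mk_one, Matrix.cons_val_one, Matrix.cons_val_zero, add_dotProduct,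
      sub_dotProduct, smul_dotProduct, smul_eq_mul]
    linear_combination h0 + Complex.I * h1
  · simp only [Fin.reduceFinMk, Matrix.cons_val, Matrix.cons_val_zero, sub_dotProduct,
      smul_dotProduct, smul_eq_mul]
    linear_combination h0 - Complex.I * h1

lemma psi_eq_of_backForm {B : Fin n → Fin 3 → V4} {x : Fin (2 * n) → ℂ} {y : V4} {i : Fin n}
    (hi : B i 0 ⬝ᵥ y ≠ 0) {k : Fin 2} (h : backForm B x (camEquiv n (i, k)) ⬝ᵥ y = 0) :
    psi B y (camEquiv n (i, k)) = x (camEquiv n (i, k)) := by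
  rw [backForm_apply, sub_dotProduct, smul_dotProduct, smul_eq_mul] at h
  rw [psi_apply, div_eq_iff hi]
  linear_combination h

lemma tendsto_psi_apply {B : Fin n → Fin 3 → V4} {y : V4} (δ : V4) {i : Fin n}
    (h : B i 0 ⬝ᵥ y ≠ 0) (k : Fin 2) :
    Tendsto (fun t : ℂ => psi B (y + t • δ) (camEquiv n (i, k))) (𝓝[≠] 0)
      (𝓝 (psi B y (camEquiv n (i, k)))) := by
  have := (hasDerivAt_psi_apply B δ h k).continuousAt.tendsto
  simp only [zero_smul, add_zero] at this
  exact this.mono_left nhdsWithin_le_nhds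

lemma eventually_dot_line_ne_zero {B : Fin n → Fin 3 → V4} {y δ : V4} {j : Fin n}
    (hj : B j 0 ⬝ᵥ y = 0) (hδ : B j 0 ⬝ᵥ δ ≠ 0) (hne : ∀ i, i ≠ j → B i 0 ⬝ᵥ y ≠ 0) :
    ∀ᶠ t : ℂ in 𝓝[≠] 0, ∀ i, B i 0 ⬝ᵥ (y + t • δ) ≠ 0 := by
  refine eventually_all.2 fun i => ?_
  rcases eq_or_ne i j with rfl | hi
  · filter_upwards [self_mem_nhdsWithin] with t ht
    rw [dotProduct_add, hj, zero_add, dotProduct_smul]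
    exact mul_ne_zero ht hδ
  · exact (eventually_dot_ne_zero δ (hne i hi)).filter_mono nhdsWithin_le_nhds

/-- The exceptional plane over a camera centre is tangent to the variety. -/
lemma single_mem_zTangent {B : Fin n → Fin 3 → V4} {X : Set (Fin (2 * n) → ℂ)}
    (hX : ∀ y, (∀ i, B i 0 ⬝ᵥ y ≠ 0) → psi B y ∈ X) {x : Fin (2 * n) → ℂ} {y : V4}
    (hxy : ∀ s, backForm B x s ⬝ᵥ y = 0) {j : Fin n} (hj : B j 0 ⬝ᵥ y = 0)
    (hc : centre (B j) ≠ 0) (hne : ∀ i, i ≠ j → B i 0 ⬝ᵥ y ≠ 0) (k : Fin 2) :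
    Pi.single (camEquiv n (j, k)) 1 ∈ zTangent X x := by
  have hd : HasDerivAt (fun t : ℂ => x + t • (Pi.single (camEquiv n (j, k)) 1 : Fin (2 * n) → ℂ))
      (Pi.single (camEquiv n (j, k)) 1) 0 := by
    simpa using ((hasDerivAt_id (0 : ℂ)).smul_const
      (Pi.single (camEquiv n (j, k)) 1 : Fin (2 * n) → ℂ)).const_add x
  have := mem_zTangent_of_curve (X := X) hd (Eventually.of_forall fun t => ?_)
  · simpa using this
  obtain ⟨δ, hδ⟩ := exists_dot_eq hc (Fin.cons 1 fun r =>
    (x + t • (Pi.single (camEquiv n (j, k)) 1 : Fin (2 * n) → ℂ)) (camEquiv n (j, r)))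
  have hδ0 : B j 0 ⬝ᵥ δ = 1 := hδ 0
  have hjr : ∀ r : Fin 2, B j r.succ ⬝ᵥ y = 0 := fun r => by
    have := hxy (camEquiv n (j, r))
    rwa [backForm_apply, sub_dotProduct, smul_dotProduct, hj, smul_zero, sub_zero] at this
  refine mem_closure_of_tendsto (f := fun τ : ℂ => psi B (y + τ • δ)) (b := 𝓝[≠] 0)
    (tendsto_pi_nhds.2 fun s => ?_) ((eventually_dot_line_ne_zero hj (by simp [hδ0]) hne).mono
      fun τ hτ => hX _ hτ)
  obtain ⟨⟨i, r⟩, rfl⟩ := (camEquiv n).surjective s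
  rcases eq_or_ne i j with rfl | hi
  · refine tendsto_const_nhds.congr' ?_
    filter_upwards [self_mem_nhdsWithin] with τ hτ
    have hτ' : τ ≠ 0 := hτ
    rw [psi_apply, dotProduct_add, dotProduct_add, hj, hjr, dotProduct_smul, dotProduct_smul, hδ0,
      hδ r.succ, Fin.cons_succ]
    simp only [zero_add, smul_eq_mul, mul_one]
    rw [mul_div_cancel_left₀ _ hτ']
  · have h1 := tendsto_psi_apply (B := B) δ (hne i hi) r
    rw [psi_eq_of_backForm (hne i hi) (hxy _)] at h1
    simpa [hi] using h1

lemma dot_ne_zero_of_critical {B : Fin n → Fin 3 → V4} {X : Set (Fin (2 * n) → ℂ)}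
    (hX : ∀ y, (∀ i, B i 0 ⬝ᵥ y ≠ 0) → psi B y ∈ X) {α : Fin (2 * n) → ℂ}
    (hp : GoodFam (famED B α)) {x : Fin (2 * n) → ℂ}
    (hcrit : ∀ v ∈ zTangent X x, ∑ s, (x s - α s) * v s = 0) {y : V4} (hy : y ≠ 0)
    (hxy : ∀ s, backForm B x s ⬝ᵥ y = 0) (j : Fin n) : B j 0 ⬝ᵥ y ≠ 0 := by
  classical
  intro hj
  have hall : ∀ r, famED B α j r ⬝ᵥ y = 0 := by
    have := (famED_dot_eq_zero_iff B α j y).2 fun k => by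
      have := hxy (camEquiv n (j, k))
      rw [backForm_apply, sub_dotProduct, smul_dotProduct, hj, smul_zero, sub_zero] at this
      rw [this, hj, mul_zero]
    intro r
    fin_cases r
    exacts [hj, this.1, this.2]
  have hne : ∀ i, i ≠ j → B i 0 ⬝ᵥ y ≠ 0 := fun i hi =>
    hp.minors.gen3 Finset.univ y (by simp) hy j i hi hall
  have hcj : centre (B j) ≠ 0 := fun h => hp.minors.centre_ne_zero j (by
    rw [centre_famED, h, smul_zero])
  have hxα : ∀ k, x (camEquiv n (j, k)) = α (camEquiv n (j, k)) := fun k => by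
    have := hcrit _ (single_mem_zTangent hX hxy hj hcj hne k)
    rw [Finset.sum_eq_single (camEquiv n (j, k)) (by
      intro s _ hs
      rw [Pi.single_eq_of_ne hs, mul_zero]) (by simp)] at this
    rwa [Pi.single_eq_same, mul_one, sub_eq_zero] at this
  obtain ⟨z, -, hz1, hz2, hz⟩ := gen2_of_centrePoly hp.minors hp.centrePoly Finset.univ y (by simp)
    hy j one_ne_zero hall
  have hsum := hz (fun i => if i = j then 0 else gradOne (famED B α i) y ⬝ᵥ z) (by simp)
    fun i hi => by simp [hi]
  have hzk := (famED_dot_eq_zero_iff B α j z).1 ⟨hz1, hz2⟩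
  have hzj : B j 0 ⬝ᵥ z ≠ 0 := fun h0 => by
    obtain ⟨a, ha⟩ := hp.minors.eq_smul_centre hall
    obtain ⟨b, hb⟩ := hp.minors.eq_smul_centre (i := j) (y := z) fun r => by
      fin_cases r
      exacts [h0, hz1, hz2]
    have ha0 : a ≠ 0 := fun h => hy (by rw [ha, h, zero_smul])
    refine hsum (Finset.sum_eq_zero fun i _ => ?_)
    split_ifs with hi
    · rfl
    have hzy : z = (b / a) • y := by
      rw [hb, ha, smul_smul, div_mul_cancel₀ _ ha0]
    rw [hzy, dotProduct_smul, gradOne_dot (famED B α i) _ (hne i hi), smul_zero]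
  let γ : ℂ → Fin (2 * n) → ℂ := fun t s =>
    if ((camEquiv n).symm s).1 = j then α s else psi B (y + t • z) s
  let v : Fin (2 * n) → ℂ := fun s => if ((camEquiv n).symm s).1 = j then 0 else dpsi B y z s
  have hγ : HasDerivAt γ v 0 := by
    refine hasDerivAt_pi.2 fun s => ?_
    obtain ⟨⟨i, k⟩, rfl⟩ := (camEquiv n).surjective s
    simp only [γ, v, Equiv.symm_apply_apply]
    split_ifs with hi
    · exact hasDerivAt_const _ _
    · exact hasDerivAt_psi_apply B z (hne i hi) k
  have hγ0 : γ 0 = x := by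
    refine funext_cam fun i k => ?_
    simp only [γ, Equiv.symm_apply_apply, zero_smul, add_zero]
    split_ifs with hi
    · rw [hi, hxα]
    · exact psi_eq_of_backForm (hne i hi) (hxy _)
  have hv : v ∈ zTangent X x := by
    rw [← hγ0]
    refine mem_zTangent_of_curve hγ ?_
    filter_upwards [eventually_dot_line_ne_zero hj hzj hne, self_mem_nhdsWithin] with t ht ht0
    have ht0' : t ≠ 0 := ht0
    have : γ t = psi B (y + t • z) := by
      refine funext_cam fun i k => ?_
      simp only [γ, Equiv.symm_apply_apply]
      split_ifs with hi
      · subst hi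
        refine (psi_eq_of_backForm (ht i) ?_).symm
        have h1 := hxy (camEquiv n (i, k))
        rw [backForm_apply, sub_dotProduct, smul_dotProduct, hj, smul_zero, sub_zero] at h1
        rw [backForm_apply, sub_dotProduct, smul_dotProduct, dotProduct_add, dotProduct_add, h1,
          hj, dotProduct_smul, dotProduct_smul, hzk k]
        simp only [smul_eq_mul]
        ring
      · rfl
    rw [this]
    exact subset_closure (hX _ ht)
  have hfin := hcrit v hv
  rw [sum_camEquiv] at hfin
  refine hsum ?_
  refine (Eq.trans ?_ (congrArg (2 * ·) hfin)).trans (mul_zero 2)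
  simp only [Finset.mul_sum]
  refine Finset.sum_congr rfl fun i _ => ?_
  simp only [v, Equiv.symm_apply_apply]
  split_ifs with hi
  · simp
  · rw [gradOne_famED B α i y z (hne i hi), psi_eq_of_backForm (hne i hi) (hxy _),
      psi_eq_of_backForm (hne i hi) (hxy _)]

end

section

variable {n : ℕ}

lemma psi_smul (B : Fin n → Fin 3 → V4) (y : V4) {c : ℂ} (hc : c ≠ 0) :
    psi B (c • y) = psi B y := by
  refine funext_cam fun i k => ?_
  rw [psi_apply, psi_apply, dotProduct_smul, dotProduct_smul, smul_eq_mul, smul_eq_mul,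
    mul_div_mul_left _ _ hc]

lemma edCritSet_eq_image {B : Fin n → Fin 3 → V4} {X : Set (Fin (2 * n) → ℂ)}
    (hX : ∀ x ∈ X, ∃ y : V4, y ≠ 0 ∧ ∀ s, backForm B x s ⬝ᵥ y = 0)
    (hX' : ∀ y, (∀ i, B i 0 ⬝ᵥ y ≠ 0) → psi B y ∈ X) {α : Fin (2 * n) → ℂ}
    (hp : GoodFam (famED B α)) (i0 : Fin n) :
    edCritSet X 3 α = psi B '' critSet i0 Finset.univ (famED B α) := by
  ext x
  constructor
  · rintro ⟨hxX, -, hcrit⟩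
    obtain ⟨y, hy, hxy⟩ := hX x hxX
    have hl := dot_ne_zero_of_critical hX' hp hcrit hy hxy
    have hx : psi B y = x := funext_cam fun i k => psi_eq_of_backForm (hl i) (hxy _)
    have hg : grad (famED B α) y = 0 := by
      refine dotProduct_eq_zero _ fun δ => ?_
      rw [grad_famED B α y δ hl, hx, hcrit _ (hx ▸ dpsi_mem_zTangent hX' hl δ), mul_zero]
    have hc : (B i0 0 ⬝ᵥ y)⁻¹ ≠ 0 := inv_ne_zero (hl i0)
    refine ⟨(B i0 0 ⬝ᵥ y)⁻¹ • y, ⟨by simp, fun i => ?_, fun k _ => ?_, ?_⟩, ?_⟩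
    · rw [famED_zero, dotProduct_smul]
      exact mul_ne_zero hc (hl i)
    · rw [grad_smul _ _ hc, hg, smul_zero, Pi.zero_apply]
    · rw [famED_zero, dotProduct_smul, smul_eq_mul, inv_mul_cancel₀ (hl i0)]
    · rw [psi_smul B y hc, hx]
  · rintro ⟨y, ⟨-, hl, hg, h1⟩, rfl⟩
    have hg0 : grad (famED B α) y = 0 := funext fun k => hg k (Finset.mem_univ k)
    have hy : y ≠ 0 := fun h => by simp [h] at h1
    obtain ⟨hT, hr⟩ := finrank_zTangent hX hX' hy hl (hp.jInj.dpsi_inj hl hg0)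
    refine ⟨hX' y hl, hr, fun v hv => ?_⟩
    rw [hT] at hv
    obtain ⟨δ, rfl⟩ := hv
    have := grad_famED B α y δ hl
    rw [hg0, zero_dotProduct] at this
    exact (mul_eq_zero.1 this.symm).resolve_left two_ne_zero

lemma psi_injOn {B : Fin n → Fin 3 → V4} {α : Fin (2 * n) → ℂ}
    (hp : GoodFam (famED B α)) (i0 : Fin n) :
    Set.InjOn (psi B) (critSet i0 Finset.univ (famED B α)) := by
  rintro y ⟨-, hl, hg, h1⟩ y' ⟨-, hl', -, h1'⟩ h
  have hg0 : grad (famED B α) y = 0 := funext fun k => hg k (Finset.mem_univ k)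
  obtain ⟨c, rfl⟩ := hp.jInj.dpsi_inj hl hg0 y' (funext_cam fun i k => by
    have h2 := congrFun h (camEquiv n (i, k))
    have h3 := hl i
    have h4 := hl' i
    rw [famED_zero] at h3 h4
    rw [psi_apply, psi_apply, div_eq_div_iff h3 h4] at h2
    rw [dpsi_apply, Pi.zero_apply, div_eq_zero_iff]
    left
    field_simp
    linear_combination -h2)
  rw [dotProduct_smul, h1, smul_eq_mul, mul_one] at h1'
  rw [h1', one_smul]

end

section

variable {n : ℕ}

lemma dotProduct_star_ne_zero {v : Fin 3 → ℂ} (hv : v ≠ 0) : v ⬝ᵥ star v ≠ 0 := by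
  open scoped ComplexOrder in
  rw [dotProduct_comm]
  exact fun h => hv (dotProduct_star_self_eq_zero.1 h)

/-- The orthogonal projection onto the line spanned by `v`. -/
def lineProj (v : Fin 3 → ℂ) : Matrix (Fin 3) (Fin 3) ℂ :=
  Matrix.of fun r c => v r * star (v c) / (v ⬝ᵥ star v)

lemma lineProj_mulVec (v w : Fin 3 → ℂ) :
    (lineProj v).mulVec w = ((w ⬝ᵥ star v) / (v ⬝ᵥ star v)) • v := by
  ext r
  simp only [lineProj, Matrix.mulVec, dotProduct, Matrix.of_apply, Fin.sum_univ_three,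
    Pi.smul_apply, smul_eq_mul, Pi.star_apply]
  ring

lemma lineProj_smul {c : ℂ} (hc : c ≠ 0) (v : Fin 3 → ℂ) : lineProj (c • v) = lineProj v := by
  ext r s
  have h : star c ≠ 0 := star_ne_zero.2 hc
  simp only [lineProj, Matrix.of_apply, Pi.smul_apply, smul_eq_mul, star_mul', star_smul,
    smul_dotProduct, dotProduct_smul]
  rw [show c * v r * (star c * star (v s)) = (star c * c) * (v r * star (v s)) by ring,
    show star c * (c * v ⬝ᵥ star v) = (star c * c) * (v ⬝ᵥ star v) by ring,
    mul_div_mul_left _ _ (mul_ne_zero h hc)]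

lemma lineProj_mulVec_smul {v : Fin 3 → ℂ} (hv : v ≠ 0) (c : ℂ) :
    (lineProj v).mulVec (c • v) = c • v := by
  have : v ⬝ᵥ star v ≠ 0 := dotProduct_star_ne_zero hv
  rw [lineProj_mulVec, smul_dotProduct, smul_eq_mul, mul_div_cancel_right₀ _ this]

/-- The orthogonal projection onto the line given by a point of `ℙ²`. -/
def pointProj : P2 → Matrix (Fin 3) (Fin 3) ℂ :=
  Quotient.lift (fun v : {v : Fin 3 → ℂ // v ≠ 0} => lineProj v.1) (by
    rintro ⟨a, ha⟩ ⟨b, hb⟩ ⟨u, hu⟩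
    have : u.1 • b = a := hu
    simp only [← this]
    exact lineProj_smul u.ne_zero b)

lemma continuous_pointProj : Continuous pointProj := by
  refine Continuous.quotient_lift (s := projectivizationSetoid ℂ (Fin 3 → ℂ)) ?_ _
  refine continuous_matrix fun r c => ?_
  have h (j : Fin 3) : Continuous fun v : {v : Fin 3 → ℂ // v ≠ 0} => v.1 j :=
    (continuous_apply j).comp continuous_subtype_val
  refine ((h r).mul (h c).star).div
    (continuous_finsetSum _ fun j _ => (h j).mul (h j).star) ?_
  exact fun v => dotProduct_star_ne_zero v.2

lemma pointProj_mkP {v : Fin 3 → ℂ} (hv : v ≠ 0) : pointProj (mkP v) = lineProj v := by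
  rw [mkP, dif_pos hv]
  rfl

lemma mkP_smul {c : ℂ} (hc : c ≠ 0) (v : Fin 3 → ℂ) (hv : v ≠ 0) : mkP (c • v) = mkP v := by
  rw [mkP, mkP, dif_pos hv, dif_pos (smul_ne_zero hc hv), Projectivization.mk_eq_mk_iff']
  exact ⟨c, rfl⟩

lemma exists_of_mem_mvVariety {A : Fin n → Matrix (Fin 3) (Fin 4) ℂ} {P : Fin n → P2}
    (hP : P ∈ mvVariety A) :
    ∃ y : V4, y ≠ 0 ∧ ∀ i, (pointProj (P i)).mulVec ((A i).mulVec y) = (A i).mulVec y := by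
  let S : Set ((Fin n → P2) × Metric.sphere (0 : V4) 1) :=
    {z | ∀ i, (pointProj (z.1 i)).mulVec ((A i).mulVec z.2.1) = (A i).mulVec z.2.1}
  have hS : IsClosed S := by
    simp only [S, Set.ofPred_forall]
    refine isClosed_iInter fun i => ?_
    refine isClosed_eq ?_ ?_
    · refine Continuous.matrix_mulVec ?_ ?_
      · exact continuous_pointProj.comp ((continuous_apply i).comp continuous_fst)
      · exact continuous_const.matrix_mulVec (continuous_subtype_val.comp continuous_snd)
    · exact continuous_const.matrix_mulVec (continuous_subtype_val.comp continuous_snd)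
  have hcl : IsClosed (Prod.fst '' S) := isClosedMap_fst_of_compactSpace S hS
  have hsub : mvImage A ⊆ Prod.fst '' S := by
    rintro Q ⟨y, hy, hA, hQ⟩
    have hy' : ‖y‖ ≠ 0 := norm_ne_zero_iff.2 hy
    refine ⟨(Q, ⟨((‖y‖ : ℂ)⁻¹) • y, by simp [norm_smul, hy']⟩), fun i => ?_, rfl⟩
    simp only [hQ i, pointProj_mkP (hA i), Matrix.mulVec_smul]
    rw [← Matrix.mulVec_smul]
    exact lineProj_mulVec_smul (hA i) _
  obtain ⟨⟨Q, y⟩, hQ, rfl⟩ := closure_minimal hsub hcl hP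
  exact ⟨y.1, fun h => by have := y.2; simp [h] at this, hQ⟩

/-- The rows of the cameras in the coordinates of the charts, up to scaling. -/
def chartRows (A : Fin n → Matrix (Fin 3) (Fin 4) ℂ) (Cs : Fin n → Matrix (Fin 3) (Fin 3) ℂ) :
    Fin n → Fin 3 → V4 :=
  fun i r => ((Cs i).adjugate * A i) r

lemma chartRows_dot (A : Fin n → Matrix (Fin 3) (Fin 4) ℂ)
    (Cs : Fin n → Matrix (Fin 3) (Fin 3) ℂ) (i : Fin n) (r : Fin 3) (y : V4) :
    chartRows A Cs i r ⬝ᵥ y = (Cs i).adjugate.mulVec ((A i).mulVec y) r := by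
  rw [Matrix.mulVec_mulVec]
  rfl

lemma affLift_ne_zero (z : Fin 2 → ℂ) : affLift z ≠ 0 :=
  fun h => one_ne_zero (congrFun h 0)

lemma mulVec_affLift_ne_zero {C : Matrix (Fin 3) (Fin 3) ℂ} (hC : IsUnit C.det)
    (z : Fin 2 → ℂ) : C.mulVec (affLift z) ≠ 0 := fun h =>
  affLift_ne_zero z (Matrix.eq_zero_of_mulVec_eq_zero hC.ne_zero h)

lemma exists_backForm_of_mem {A : Fin n → Matrix (Fin 3) (Fin 4) ℂ}
    {Cs : Fin n → Matrix (Fin 3) (Fin 3) ℂ} (hC : ∀ i, IsUnit (Cs i).det)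
    {x : Fin (2 * n) → ℂ} (hx : x ∈ affineMV A Cs) :
    ∃ y : V4, y ≠ 0 ∧ ∀ s, backForm (chartRows A Cs) x s ⬝ᵥ y = 0 := by
  obtain ⟨y, hy, h⟩ := exists_of_mem_mvVariety hx
  refine ⟨y, hy, fun s => ?_⟩
  obtain ⟨⟨i, k⟩, rfl⟩ := (camEquiv n).surjective s
  have hi := h i
  rw [chartMapN, pointProj_mkP (mulVec_affLift_ne_zero (hC i) _), lineProj_mulVec] at hi
  generalize (_ : ℂ) / _ = κ at hi
  have key : ∀ r, chartRows A Cs i r ⬝ᵥ y = κ * (Cs i).det * affLift (camCoord n x i) r :=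
    fun r => by
    rw [chartRows_dot, ← hi, Matrix.mulVec_smul, Matrix.mulVec_mulVec, Matrix.adjugate_mul,
      Matrix.smul_mulVec, Matrix.one_mulVec]
    simp [mul_assoc]
  rw [backForm_apply, sub_dotProduct, smul_dotProduct, key, key]
  simp only [affLift, Fin.cons_succ, Fin.cons_zero, camCoord, smul_eq_mul]
  change _ * x (camEquiv n (i, k)) - _ = _
  ring

lemma psi_mem_affineMV {A : Fin n → Matrix (Fin 3) (Fin 4) ℂ}
    {Cs : Fin n → Matrix (Fin 3) (Fin 3) ℂ} (hC : ∀ i, IsUnit (Cs i).det) (i0 : Fin n) (y : V4)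
    (hy : ∀ i, chartRows A Cs i 0 ⬝ᵥ y ≠ 0) : psi (chartRows A Cs) y ∈ affineMV A Cs := by
  refine subset_closure ⟨y, fun h => hy i0 (by simp [h]), fun i h => hy i ?_, fun i => ?_⟩
  · simp [chartRows_dot, h]
  · have h1 : (chartRows A Cs i 0 ⬝ᵥ y) • affLift (camCoord n (psi (chartRows A Cs) y) i) =
        (Cs i).adjugate.mulVec ((A i).mulVec y) := by
      ext r
      rw [← chartRows_dot]
      refine Fin.cases (by simp [affLift]) (fun k => ?_) r
      have h2 : camCoord n (psi (chartRows A Cs) y) i k = _ := psi_apply (chartRows A Cs) y i k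
      simp only [affLift, Pi.smul_apply, Fin.cons_succ, smul_eq_mul, h2]
      exact mul_div_cancel₀ _ (hy i)
    have h3 := congrArg (Cs i).mulVec h1
    rw [Matrix.mulVec_smul, Matrix.mulVec_mulVec, Matrix.mul_adjugate, Matrix.smul_mulVec,
      Matrix.one_mulVec] at h3
    have hA : (A i).mulVec y ≠ 0 := fun h => hy i (by simp [chartRows_dot, h])
    rw [chartMapN, ← mkP_smul (hy i) _ (mulVec_affLift_ne_zero (hC i) _), h3,
      mkP_smul (hC i).ne_zero _ hA]

end

section

/-- Functions given by complex polynomials. -/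
def CPoly {σ : Type} (f : (σ → ℂ) → ℂ) : Prop :=
  ∃ P : MvPolynomial σ ℂ, ∀ x, f x = MvPolynomial.eval x P

section CPoly

variable {σ τ : Type}

lemma CPoly.coord (s : σ) : CPoly fun x : σ → ℂ => x s :=
  ⟨MvPolynomial.X s, fun x => by simp⟩

lemma CPoly.const (c : ℂ) : CPoly fun _ : σ → ℂ => c :=
  ⟨MvPolynomial.C c, fun x => by simp⟩

lemma CPoly.add {f g : (σ → ℂ) → ℂ} (hf : CPoly f) (hg : CPoly g) :
    CPoly fun x => f x + g x := by
  obtain ⟨P, hP⟩ := hf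
  obtain ⟨Q, hQ⟩ := hg
  exact ⟨P + Q, fun x => by simp [hP, hQ]⟩

lemma CPoly.mul {f g : (σ → ℂ) → ℂ} (hf : CPoly f) (hg : CPoly g) :
    CPoly fun x => f x * g x := by
  obtain ⟨P, hP⟩ := hf
  obtain ⟨Q, hQ⟩ := hg
  exact ⟨P * Q, fun x => by simp [hP, hQ]⟩

lemma CPoly.sub {f g : (σ → ℂ) → ℂ} (hf : CPoly f) (hg : CPoly g) :
    CPoly fun x => f x - g x := by
  obtain ⟨P, hP⟩ := hf
  obtain ⟨Q, hQ⟩ := hg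
  exact ⟨P - Q, fun x => by simp [hP, hQ]⟩

lemma CPoly.sum {α : Type*} (s : Finset α) {f : α → (σ → ℂ) → ℂ} (hf : ∀ a, CPoly (f a)) :
    CPoly fun x => ∑ a ∈ s, f a x := by
  choose P hP using hf
  exact ⟨∑ a ∈ s, P a, fun x => by simp [hP]⟩

lemma CPoly.aeval {f : (σ → ℂ) → τ → ℂ} (hf : ∀ t, CPoly fun x => f x t)
    (r : MvPolynomial τ ℚ) : CPoly fun x => MvPolynomial.aeval (f x) r := by
  choose P hP using hf
  refine ⟨MvPolynomial.aeval P r, fun x => ?_⟩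
  have hx : f x = fun t => MvPolynomial.eval x (P t) := funext fun t => hP t x
  change MvPolynomial.aeval (f x) r = _
  rw [hx, ← MvPolynomial.coe_aeval_eq_eval, AlgHom.coe_toRingHom,
    ← AlgHom.restrictScalars_apply ℚ (MvPolynomial.aeval x), ← AlgHom.comp_apply,
    MvPolynomial.comp_aeval]
  rfl

lemma CPoly.famED {n : ℕ} {B : (σ → ℂ) → Fin n → Fin 3 → V4} {α : (σ → ℂ) → Fin (2 * n) → ℂ}
    (hB : ∀ i r k, CPoly fun x => B x i r k) (hα : ∀ s, CPoly fun x => α x s)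
    (t : Fin n × Fin 3 × Fin 4) :
    CPoly fun x => PaperED.famED (B x) (α x) t.1 t.2.1 t.2.2 := by
  obtain ⟨i, r, k⟩ := t
  have h (s : Fin (2 * n)) : CPoly fun x => backForm (B x) (α x) s k :=
    (hB _ _ _).sub ((hα _).mul (hB _ _ _))
  fin_cases r
  · exact hB i 0 k
  · exact (h _).add ((CPoly.const _).mul (h _))
  · exact (h _).sub ((CPoly.const _).mul (h _))

end CPoly

lemma exists_real_poly {σ : Type} (P : MvPolynomial σ ℂ) :
    ∃ R S : MvPolynomial σ ℝ, P = MvPolynomial.map (algebraMap ℝ ℂ) R +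
      MvPolynomial.C Complex.I * MvPolynomial.map (algebraMap ℝ ℂ) S := by
  induction P using MvPolynomial.induction_on with
  | C z =>
    refine ⟨.C z.re, .C z.im, ?_⟩
    simp only [MvPolynomial.map_C, ← map_mul, ← map_add, Complex.coe_algebraMap]
    rw [mul_comm, Complex.re_add_im]
  | add P Q hP hQ =>
    obtain ⟨R, S, rfl⟩ := hP
    obtain ⟨R', S', rfl⟩ := hQ
    refine ⟨R + R', S + S', ?_⟩
    simp only [map_add]
    ring
  | mul_X P s hP =>
    obtain ⟨R, S, rfl⟩ := hP
    refine ⟨R * .X s, S * .X s, ?_⟩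
    simp only [map_mul, MvPolynomial.map_X]
    ring

lemma generically_real {σ : Type} {f : (σ → ℂ) → ℂ} (hf : CPoly f) {x0 : σ → ℂ}
    (h0 : f x0 ≠ 0) : Generically (K := ℝ) fun a : σ → ℝ => f (fun s => (a s : ℂ)) ≠ 0 := by
  obtain ⟨P, hP⟩ := hf
  obtain ⟨R, S, hRS⟩ := exists_real_poly P
  have hev (a : σ → ℝ) : f (fun s => (a s : ℂ)) =
      (MvPolynomial.eval a R : ℂ) + Complex.I * (MvPolynomial.eval a S : ℂ) := by
    have h (T : MvPolynomial σ ℝ) : MvPolynomial.eval (fun s => (a s : ℂ))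
        (MvPolynomial.map (algebraMap ℝ ℂ) T) = (MvPolynomial.eval a T : ℂ) :=
      MvPolynomial.map_eval (algebraMap ℝ ℂ) a T |>.symm
    rw [hP, hRS, map_add, map_mul, MvPolynomial.eval_C, h, h]
  by_cases hR : R = 0
  · refine ⟨S, ?_, fun a ha h => ha ?_⟩
    · rintro rfl
      simp [hP, hRS, hR] at h0
    · have := congrArg Complex.im (hev a)
      simpa [h] using this.symm
  · refine ⟨R, hR, fun a ha h => ha ?_⟩
    have := congrArg Complex.re (hev a)
    simpa [h] using this.symm

lemma genQ_goodFam {n : ℕ} (hn : 2 ≤ n) (i0 : Fin n) :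
    GenQ fun x : Fin n × Fin 3 × Fin 4 → ℂ => GoodFam (famOf x) ∧
      ∀ y ∈ critSet i0 Finset.univ (famOf x), Nondeg i0 Finset.univ (famOf x) y := by
  obtain ⟨m, rfl⟩ : ∃ m, n = m + 1 := ⟨n - 1, by omega⟩
  obtain ⟨N, hN, -⟩ := exists_critCount m (Fin (m + 1)) i0 Finset.univ (by simp)
    (Or.inr (by omega))
  have hij : (⟨0, by omega⟩ : Fin (m + 1)) ≠ ⟨1, by omega⟩ := by simp
  refine ((genQ_minors.and ((genQ_centrePoly (by simpa using hn)).and (genQ_jInj hij))).and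
    (genQ_nondeg hN)).mono ?_
  rintro x ⟨⟨h1, h2, h3⟩, h4⟩
  exact ⟨⟨h1, h2, h3⟩, h4⟩

lemma two_mul_ncard_critSet {n : ℕ} (hn : 2 ≤ n) {i0 : Fin n} {p : Fam (Fin n)} (hp : GoodFam p)
    (hnd : ∀ y ∈ critSet i0 Finset.univ p, Nondeg i0 Finset.univ p y)
    (hf : (critSet i0 Finset.univ p).Finite) :
    (2 * (critSet i0 Finset.univ p).ncard : ℤ) =
      9 * (n : ℤ) ^ 3 - 21 * (n : ℤ) ^ 2 + 16 * (n : ℤ) - 8 := by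
  obtain ⟨m, rfl⟩ : ∃ m, n = m + 1 := ⟨n - 1, by omega⟩
  obtain ⟨N, hN, hN'⟩ := exists_critCount m (Fin (m + 1)) i0 Finset.univ (by simp)
    (Or.inr (by omega))
  obtain ⟨p', hp', -, h, -⟩ := exists_indep (locally_constant (hp.minors.gen1 _)
    (hp.minors.gen3 _) (gen2_of_centrePoly hp.minors hp.centrePoly _) hf hnd)
  rw [← h, (hN p' hp').2.1, hN', Finset.card_univ, Fintype.card_fin]
  push_cast
  rfl

lemma chartRows_one {n : ℕ} (A : Fin n → Matrix (Fin 3) (Fin 4) ℂ)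
    {Cs : Fin n → Matrix (Fin 3) (Fin 3) ℂ} (hC : ∀ i, Cs i = 1) :
    chartRows A Cs = fun i => A i := by
  funext i
  change (Cs i).adjugate * A i = A i
  rw [hC, Matrix.adjugate_one, Matrix.one_mul]

lemma exists_famED_eq {n : ℕ} (p : Fam (Fin n)) : ∃ B, famED B 0 = p := by
  refine ⟨fun i => ![p i 0, (2 : ℂ)⁻¹ • (p i 1 + p i 2),
    (-(Complex.I / 2)) • (p i 1 - p i 2)], ?_⟩
  funext i r k
  have := Complex.I_mul_I
  fin_cases r
  · rfl
  · simp [famED, backForm_apply]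
    linear_combination -(p i 1 k - p i 2 k) / 2 * this
  · simp [famED, backForm_apply]
    linear_combination (p i 1 k - p i 2 k) / 2 * this

lemma cpoly_chartRows {n : ℕ} (A : Fin n → Matrix (Fin 3) (Fin 4) ℂ) (i : Fin n) (r : Fin 3)
    (k : Fin 4) :
    CPoly fun c : Fin n × Fin 3 × Fin 3 → ℂ => chartRows A (chartOf c) i r k := by
  have hadj (j : Fin 3) : CPoly fun c : Fin n × Fin 3 × Fin 3 → ℂ =>
      (chartOf c i).adjugate r j := by
    refine ⟨(Matrix.of fun r s => MvPolynomial.X (i, r, s)).adjugate r j, fun c => ?_⟩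
    have h := RingHom.map_adjugate (MvPolynomial.eval c)
      (Matrix.of fun r s : Fin 3 => MvPolynomial.X (i, r, s))
    have h2 : (MvPolynomial.eval c).mapMatrix
        (Matrix.of fun r s : Fin 3 => MvPolynomial.X (i, r, s)) = chartOf c i := by
      ext r s
      simp [chartOf]
    rw [h2] at h
    exact (congrFun (congrFun h r) j).symm
  exact CPoly.sum Finset.univ fun j => (hadj j).mul (CPoly.const (A i j k))

end

/-- **Theorem 1.1 (Multiview conjecture, [DHOST, Conj. 3.4]).** For `n ≥ 2` real
full-rank cameras in general position and a general affine chart of `(ℙ²)ⁿ`, the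
Euclidean distance degree of the affine multiview variety `Xₙ` (which is smooth of
dimension 3) is `(9/2)n³ - (21/2)n² + 8n - 4`. -/
theorem ed_degree_affine_multiview (n : ℕ) (hn : 2 ≤ n) :
    Generically (K := ℝ) (σ := Fin n × Fin 3 × Fin 4) fun a =>
      (∀ i, (camOfR a i).rank = 3) →
      Generically (K := ℂ) (σ := Fin n × Fin 3 × Fin 3) fun cpar =>
        (∀ i, IsUnit (chartOf cpar i).det) →
        ∀ k : ℕ, HasEDDeg (affineMV (camOfR a) (chartOf cpar)) 3 k →
          (2 * k : ℤ) = 9 * (n : ℤ) ^ 3 - 21 * (n : ℤ) ^ 2 + 16 * (n : ℤ) - 8 := by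
  let i0 : Fin n := ⟨0, by omega⟩
  obtain ⟨r, hr, hgood⟩ := genQ_goodFam hn i0
  obtain ⟨f, hfdef⟩ : ∃ f : (Fin n → Fin 3 → V4) → (Fin (2 * n) → ℂ) → ℂ, ∀ B α, f B α =
      MvPolynomial.aeval (fun t : Fin n × Fin 3 × Fin 4 => famED B α t.1 t.2.1 t.2.2) r :=
    ⟨_, fun _ _ => rfl⟩
  have hf {B α} (h : f B α ≠ 0) : GoodFam (famED B α) ∧
      ∀ y ∈ critSet i0 Finset.univ (famED B α), Nondeg i0 Finset.univ (famED B α) y :=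
    hgood (fun t => famED B α t.1 t.2.1 t.2.2) (hfdef B α ▸ h)
  have hfpoly {σ : Type} {B : (σ → ℂ) → Fin n → Fin 3 → V4} {α : (σ → ℂ) → Fin (2 * n) → ℂ}
      (hB : ∀ i r k, CPoly fun x => B x i r k) (hα : ∀ s, CPoly fun x => α x s) :
      CPoly fun x => f (B x) (α x) := by
    simp only [hfdef]
    exact CPoly.aeval (CPoly.famED hB hα) r
  have hfa : CPoly fun x : Fin n × Fin 3 × Fin 4 → ℂ => f (famOf x) 0 :=
    hfpoly (fun i r k => CPoly.coord (i, r, k)) fun _ => CPoly.const 0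
  obtain ⟨x0, hx0⟩ : ∃ x0 : Fin n × Fin 3 × Fin 4 → ℂ, f (famOf x0) 0 ≠ 0 := by
    obtain ⟨z, hz⟩ : ∃ z : Fin n × Fin 3 × Fin 4 → ℂ, MvPolynomial.aeval z r ≠ 0 := by
      obtain ⟨z, -, hz⟩ := exists_algebraicIndependent (σ := Fin n × Fin 3 × Fin 4)
        Set.univ isOpen_univ Set.univ_nonempty
      exact ⟨z, algebraicIndependent_iff_eval.1 hz r hr⟩
    obtain ⟨B, hB⟩ := exists_famED_eq (famOf z)
    refine ⟨fun t => B t.1 t.2.1 t.2.2, ?_⟩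
    change f B 0 ≠ 0
    rw [hfdef, hB]
    exact hz
  obtain ⟨q, hq, hqa⟩ := generically_real hfa hx0
  refine ⟨q, hq, fun a ha _ => ?_⟩
  have hfc : CPoly fun c : Fin n × Fin 3 × Fin 3 → ℂ =>
      f (chartRows (camOfR a) (chartOf c)) 0 :=
    hfpoly (cpoly_chartRows _) fun _ => CPoly.const 0
  obtain ⟨Q, hQ⟩ := hfc
  refine ⟨Q, ?_, fun c hc hunit k hk => ?_⟩
  · rintro rfl
    refine hqa a ha ?_
    let c : Fin n × Fin 3 × Fin 3 → ℂ := fun t => if t.2.1 = t.2.2 then 1 else 0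
    have hc (i : Fin n) : chartOf c i = 1 := by
      ext r s
      simp [chartOf, c, Matrix.one_apply]
    have h : f (chartRows (camOfR a) (chartOf c)) 0 = MvPolynomial.eval c 0 := hQ c
    rw [chartRows_one (camOfR a) hc, map_zero] at h
    exact h
  replace hc := (hQ c).trans_ne hc
  obtain ⟨s, hs, hsα⟩ := hk
  obtain ⟨T, hT⟩ : CPoly fun α => f (chartRows (camOfR a) (chartOf c)) α :=
    hfpoly (fun _ _ _ => CPoly.const _) CPoly.coord
  have hT0 : T ≠ 0 := by
    rintro rfl
    exact hc (by rw [hT, map_zero])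
  obtain ⟨α, hα⟩ := (dense_eval_ne_zero (s * T) (mul_ne_zero hs hT0)).nonempty
  have hα : MvPolynomial.eval α s * MvPolynomial.eval α T ≠ 0 := by rw [← map_mul]; exact hα
  obtain ⟨hfin, hcard⟩ := hsα α (left_ne_zero_of_mul hα)
  obtain ⟨hg, hnd⟩ := hf ((hT α).trans_ne (right_ne_zero_of_mul hα))
  rw [edCritSet_eq_image (fun x => exists_backForm_of_mem hunit)
    (psi_mem_affineMV hunit i0) hg i0] at hfin hcard
  have hinj := psi_injOn hg i0
  rw [hinj.ncard_image] at hcard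
  rw [← hcard]
  exact two_mul_ncard_critSet hn hg hnd ((Set.finite_image_iff hinj).1 hfin)

end PaperED
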